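/- Let (R, m) be a commutative Noetherian local ring and let M be a non-zero finitely generated Cohen-Macaulay R-module of dimension n. Then the Gorenstein projective dimension Gpd_R(M) is finite if and only if the Gorenstein flat dimension Gfd_R(H^n_m(M)) is finite, and when they are finite there is an equality Gfd_R(H^n_m(M)) = Gpd_R(M) + n. -/

import Mathlib

/-!
Definitions needed to state results of "On flat and Gorenstein flat dimensions of
local cohomology modules" by M.R. Zargar and H. Zakeri.
-/

open CategoryTheory IsLocalRing

universe u

namespace Paper

variable (R : Type u) [CommRing R]

/-! ## Resolution/coresolution dimensions with respect to a class of modules -/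

/-- `ResDimLE R P n M` : `M` admits a resolution `0 → Xₙ → ⋯ → X₀ → M → 0`
with each `Xᵢ` in the class `P`. -/
def ResDimLE (P : ModuleCat.{u} R → Prop) : ℕ → ModuleCat.{u} R → Prop
  | 0, M => P M
  | n + 1, M => ResDimLE P n M ∨
      ∃ (X : ModuleCat.{u} R) (f : X →ₗ[R] M), P X ∧ Function.Surjective f ∧
        ResDimLE P n (ModuleCat.of R (LinearMap.ker f))

/-- `CoresDimLE R P n M` : `M` admits a coresolution `0 → M → X₀ → ⋯ → Xₙ → 0`
with each `Xᵢ` in the class `P`. -/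
def CoresDimLE (P : ModuleCat.{u} R → Prop) : ℕ → ModuleCat.{u} R → Prop
  | 0, M => P M
  | n + 1, M => CoresDimLE P n M ∨
      ∃ (X : ModuleCat.{u} R) (f : M →ₗ[R] X), P X ∧ Function.Injective f ∧
        CoresDimLE P n (ModuleCat.of R (X ⧸ LinearMap.range f))

/-- The resolution dimension of `M` with respect to the class `P`, as an
extended natural number (`⊤` if there is no finite resolution). -/
noncomputable def ResDim (P : ModuleCat.{u} R → Prop) (M : ModuleCat.{u} R) : ℕ∞ :=
  sInf {n : ℕ∞ | ∃ k : ℕ, (k : ℕ∞) = n ∧ ResDimLE R P k M}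

/-- The coresolution dimension of `M` with respect to the class `P`. -/
noncomputable def CoresDim (P : ModuleCat.{u} R → Prop) (M : ModuleCat.{u} R) : ℕ∞ :=
  sInf {n : ℕ∞ | ∃ k : ℕ, (k : ℕ∞) = n ∧ CoresDimLE R P k M}

/-- Flat dimension `fd_R M`. -/
noncomputable def flatDim (M : Type u) [AddCommGroup M] [Module R M] : ℕ∞ :=
  ResDim R (fun N => Module.Flat R N) (ModuleCat.of R M)

/-- Projective dimension `pd_R M`. -/
noncomputable def projDim (M : Type u) [AddCommGroup M] [Module R M] : ℕ∞ :=
  ResDim R (fun N => Module.Projective R N) (ModuleCat.of R M)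

/-- Injective dimension `id_R M`. -/
noncomputable def injDim (M : Type u) [AddCommGroup M] [Module R M] : ℕ∞ :=
  CoresDim R (fun N => Module.Injective R N) (ModuleCat.of R M)

/-! ## Local cohomology -/

/-- The local cohomology module `H^i_𝔞(M)`, as an object of `ModuleCat R`. -/
noncomputable def lcoh (𝔞 : Ideal R) (i : ℕ) (M : Type u) [AddCommGroup M] [Module R M] :
    ModuleCat.{u} R :=
  (localCohomology 𝔞 i).obj (ModuleCat.of R M)

/-- `M` is relative Cohen-Macaulay with respect to `𝔞` with `ht_M 𝔞 = n`, i.e. the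
`n`-th local cohomology of `M` with respect to `𝔞` is the only non-vanishing one. -/
def IsRelCM (𝔞 : Ideal R) (n : ℕ) (M : Type u) [AddCommGroup M] [Module R M] : Prop :=
  (∀ i : ℕ, i ≠ n → Subsingleton (lcoh R 𝔞 i M)) ∧ ¬ Subsingleton (lcoh R 𝔞 n M)

/-! ## Depth, dimension, Cohen-Macaulay -/

/-- The depth of a module over a local ring: the supremum of the lengths of
`M`-regular sequences contained in the maximal ideal. -/
noncomputable def depth [IsLocalRing R] (M : Type u) [AddCommGroup M] [Module R M] : ℕ∞ :=
  sSup {n : ℕ∞ | ∃ rs : List R, (rs.length : ℕ∞) = n ∧ (∀ x ∈ rs, x ∈ maximalIdeal R) ∧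
    RingTheory.Sequence.IsRegular M rs}

/-- The (Krull) dimension of a module: the Krull dimension of `R` modulo
the annihilator of `M` (`⊥` for the zero module). -/
noncomputable def moduleDim (M : Type u) [AddCommGroup M] [Module R M] : WithBot ℕ∞ :=
  ringKrullDim (R ⧸ Module.annihilator R M)

/-- A finitely generated module over a local ring is Cohen-Macaulay
if its depth equals its dimension. -/
def IsCohenMacaulayModule [IsLocalRing R] (M : Type u) [AddCommGroup M] [Module R M] : Prop :=
  (depth R M : WithBot ℕ∞) = moduleDim R M

/-- A local ring is Cohen-Macaulay if it is so as a module over itself. -/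
def IsCohenMacaulayRing [IsLocalRing R] : Prop := IsCohenMacaulayModule R R

/-- A local ring is Gorenstein if it has finite injective dimension over itself. -/
def IsGorensteinRing : Prop := injDim R R ≠ ⊤

/-! ## Ext, Tor, semidualizing modules -/

/-- `Ext^i_R(A, B)`. -/
noncomputable def ext (i : ℕ) (A B : Type u) [AddCommGroup A] [Module R A]
    [AddCommGroup B] [Module R B] : ModuleCat.{u} R :=
  ((Ext R (ModuleCat.{u} R) i).obj (Opposite.op (ModuleCat.of R A))).obj (ModuleCat.of R B)

/-- `Tor^R_p(A, B)` indexed by `p : ℤ`, with the convention that it vanishes in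
negative degrees. -/
noncomputable def tor (p : ℤ) (A B : Type u) [AddCommGroup A] [Module R A]
    [AddCommGroup B] [Module R B] : ModuleCat.{u} R :=
  if 0 ≤ p then ((Tor (ModuleCat.{u} R) p.toNat).obj (ModuleCat.of R A)).obj (ModuleCat.of R B)
  else ModuleCat.of R PUnit

/-- A finitely generated module `C` is semidualizing if the natural map
`R → Hom_R(C, C)` is bijective and `Ext^i_R(C, C) = 0` for all `i ≥ 1`. -/
def IsSemidualizing (C : Type u) [AddCommGroup C] [Module R C] : Prop :=
  Module.Finite R C ∧
  Function.Bijective (fun r : R => (r • LinearMap.id : C →ₗ[R] C)) ∧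
  ∀ i : ℕ, 1 ≤ i → Subsingleton (ext R i C C)

/-! ## Gorenstein homological classes -/

/-- `N` is Gorenstein injective: it is the kernel of the `0`-th differential of some
exact complex `Y` of injective modules which stays exact under `Hom(I, -)` for every
injective module `I`. (The complex is written cohomologically.) -/
def IsGorensteinInjective (N : Type u) [AddCommGroup N] [Module R N] : Prop :=
  ∃ (Y : ℤ → ModuleCat.{u} R) (d : ∀ i : ℤ, Y i →ₗ[R] Y (i + 1)),
    (∀ i, Module.Injective R (Y i)) ∧
    (∀ i, Function.Exact (d i) (d (i + 1))) ∧
    (∀ (I : ModuleCat.{u} R), Module.Injective R I →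
      ∀ (i : ℤ) (g : I →ₗ[R] Y (i + 1)), (d (i + 1)).comp g = 0 →
        ∃ h : I →ₗ[R] Y i, (d i).comp h = g) ∧
    ∃ ι : N →ₗ[R] Y 0, Function.Injective ι ∧ Function.Exact ι (d 0)

/-- `N` is Gorenstein projective: it is the cokernel of a differential of some
exact complex `X` of projective modules which stays exact under `Hom(-, P)` for
every projective module `P`. -/
def IsGorensteinProjective (N : Type u) [AddCommGroup N] [Module R N] : Prop :=
  ∃ (X : ℤ → ModuleCat.{u} R) (d : ∀ i : ℤ, X i →ₗ[R] X (i + 1)),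
    (∀ i, Module.Projective R (X i)) ∧
    (∀ i, Function.Exact (d i) (d (i + 1))) ∧
    (∀ (P : ModuleCat.{u} R), Module.Projective R P →
      ∀ (i : ℤ) (g : X (i + 1) →ₗ[R] P), g.comp (d i) = 0 →
        ∃ h : X (i + 1 + 1) →ₗ[R] P, h.comp (d (i + 1)) = g) ∧
    ∃ π : X 0 →ₗ[R] N, Function.Surjective π ∧ Function.Exact (d (-1)) π

/-- `N` is Gorenstein flat: it is the cokernel of a differential of some exact
complex `Z` of flat modules which stays exact under `- ⊗ I` for every injective
module `I`. -/
def IsGorensteinFlat (N : Type u) [AddCommGroup N] [Module R N] : Prop :=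
  ∃ (Z : ℤ → ModuleCat.{u} R) (d : ∀ i : ℤ, Z i →ₗ[R] Z (i + 1)),
    (∀ i, Module.Flat R (Z i)) ∧
    (∀ i, Function.Exact (d i) (d (i + 1))) ∧
    (∀ (I : ModuleCat.{u} R), Module.Injective R I →
      ∀ i : ℤ, Function.Exact (LinearMap.rTensor (R := R) I (d i))
        (LinearMap.rTensor (R := R) I (d (i + 1)))) ∧
    ∃ π : Z 0 →ₗ[R] N, Function.Surjective π ∧ Function.Exact (d (-1)) π

/-- Gorenstein injective dimension `Gid_R M`. -/
noncomputable def GinjDim (M : Type u) [AddCommGroup M] [Module R M] : ℕ∞ :=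
  CoresDim R (fun N => IsGorensteinInjective R N) (ModuleCat.of R M)

/-- Gorenstein projective dimension `Gpd_R M`. -/
noncomputable def GprojDim (M : Type u) [AddCommGroup M] [Module R M] : ℕ∞ :=
  ResDim R (fun N => IsGorensteinProjective R N) (ModuleCat.of R M)

/-- Gorenstein flat dimension `Gfd_R M`. -/
noncomputable def GflatDim (M : Type u) [AddCommGroup M] [Module R M] : ℕ∞ :=
  ResDim R (fun N => IsGorensteinFlat R N) (ModuleCat.of R M)

/-! ## `C`-injective, `C`-projective, `C`-flat modules and the `G_C`-classes -/

/-- `N` is `C`-injective if `N ≅ Hom_R(C, I)` for some injective module `I`. -/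
def IsCInjective (C : Type u) [AddCommGroup C] [Module R C]
    (N : Type u) [AddCommGroup N] [Module R N] : Prop :=
  ∃ I : ModuleCat.{u} R, Module.Injective R I ∧ Nonempty (N ≃ₗ[R] (C →ₗ[R] I))

/-- `N` is `C`-projective if `N ≅ C ⊗_R P` for some projective module `P`. -/
def IsCProjective (C : Type u) [AddCommGroup C] [Module R C]
    (N : Type u) [AddCommGroup N] [Module R N] : Prop :=
  ∃ P : ModuleCat.{u} R, Module.Projective R P ∧ Nonempty (N ≃ₗ[R] TensorProduct R C P)

/-- `N` is `C`-flat if `N ≅ C ⊗_R F` for some flat module `F`. -/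
def IsCFlat (C : Type u) [AddCommGroup C] [Module R C]
    (N : Type u) [AddCommGroup N] [Module R N] : Prop :=
  ∃ F : ModuleCat.{u} R, Module.Flat R F ∧ Nonempty (N ≃ₗ[R] TensorProduct R C F)

/-- `C`-injective dimension `cid_R M`. -/
noncomputable def cInjDim (C : Type u) [AddCommGroup C] [Module R C]
    (M : Type u) [AddCommGroup M] [Module R M] : ℕ∞ :=
  CoresDim R (fun N => IsCInjective R C N) (ModuleCat.of R M)

/-- `C`-projective dimension `cpd_R M`. -/
noncomputable def cProjDim (C : Type u) [AddCommGroup C] [Module R C]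
    (M : Type u) [AddCommGroup M] [Module R M] : ℕ∞ :=
  ResDim R (fun N => IsCProjective R C N) (ModuleCat.of R M)

/-- `N` is `G_C`-injective: `N` is the kernel of the `0`-th differential of an exact
complex `Y` (a complete `I_C I`-coresolution) with `Y i` injective in degrees belonging
to the coresolution part and `C`-injective elsewhere, such that `Hom(I', Y)` is exact
for every `C`-injective module `I'`. -/
def IsGCInjective (C : Type u) [AddCommGroup C] [Module R C]
    (N : Type u) [AddCommGroup N] [Module R N] : Prop :=
  ∃ (Y : ℤ → ModuleCat.{u} R) (d : ∀ i : ℤ, Y i →ₗ[R] Y (i + 1)),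
    (∀ i : ℤ, 0 ≤ i → Module.Injective R (Y i)) ∧
    (∀ i : ℤ, i < 0 → IsCInjective R C (Y i)) ∧
    (∀ i, Function.Exact (d i) (d (i + 1))) ∧
    (∀ (I : ModuleCat.{u} R), IsCInjective R C I →
      ∀ (i : ℤ) (g : I →ₗ[R] Y (i + 1)), (d (i + 1)).comp g = 0 →
        ∃ h : I →ₗ[R] Y i, (d i).comp h = g) ∧
    ∃ ι : N →ₗ[R] Y 0, Function.Injective ι ∧ Function.Exact ι (d 0)

/-- `N` is `G_C`-projective: the cokernel of the degree `0` differential of a complete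
`P_C P`-resolution. -/
def IsGCProjective (C : Type u) [AddCommGroup C] [Module R C]
    (N : Type u) [AddCommGroup N] [Module R N] : Prop :=
  ∃ (X : ℤ → ModuleCat.{u} R) (d : ∀ i : ℤ, X i →ₗ[R] X (i + 1)),
    (∀ i : ℤ, i ≤ 0 → Module.Projective R (X i)) ∧
    (∀ i : ℤ, 0 < i → IsCProjective R C (X i)) ∧
    (∀ i, Function.Exact (d i) (d (i + 1))) ∧
    (∀ (Q : ModuleCat.{u} R), IsCProjective R C Q →
      ∀ (i : ℤ) (g : X (i + 1) →ₗ[R] Q), g.comp (d i) = 0 →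
        ∃ h : X (i + 1 + 1) →ₗ[R] Q, h.comp (d (i + 1)) = g) ∧
    ∃ π : X 0 →ₗ[R] N, Function.Surjective π ∧ Function.Exact (d (-1)) π

/-- `N` is `G_C`-flat: the cokernel of the degree `0` differential of a complete
`F_C F`-resolution. -/
def IsGCFlat (C : Type u) [AddCommGroup C] [Module R C]
    (N : Type u) [AddCommGroup N] [Module R N] : Prop :=
  ∃ (Z : ℤ → ModuleCat.{u} R) (d : ∀ i : ℤ, Z i →ₗ[R] Z (i + 1)),
    (∀ i : ℤ, i ≤ 0 → Module.Flat R (Z i)) ∧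
    (∀ i : ℤ, 0 < i → IsCFlat R C (Z i)) ∧
    (∀ i, Function.Exact (d i) (d (i + 1))) ∧
    (∀ (J : ModuleCat.{u} R), IsCInjective R C J →
      ∀ i : ℤ, Function.Exact (LinearMap.rTensor (R := R) J (d i))
        (LinearMap.rTensor (R := R) J (d (i + 1)))) ∧
    ∃ π : Z 0 →ₗ[R] N, Function.Surjective π ∧ Function.Exact (d (-1)) π

/-- `G_C`-injective dimension `Gid_C M`. -/
noncomputable def GCinjDim (C : Type u) [AddCommGroup C] [Module R C]
    (M : Type u) [AddCommGroup M] [Module R M] : ℕ∞ :=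
  CoresDim R (fun N => IsGCInjective R C N) (ModuleCat.of R M)

/-- `G_C`-projective dimension `G_C-pd_R M`. -/
noncomputable def GCprojDim (C : Type u) [AddCommGroup C] [Module R C]
    (M : Type u) [AddCommGroup M] [Module R M] : ℕ∞ :=
  ResDim R (fun N => IsGCProjective R C N) (ModuleCat.of R M)

/-- `G_C`-flat dimension `G_C-fd_R M`. -/
noncomputable def GCflatDim (C : Type u) [AddCommGroup C] [Module R C]
    (M : Type u) [AddCommGroup M] [Module R M] : ℕ∞ :=
  ResDim R (fun N => IsGCFlat R C N) (ModuleCat.of R M)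

end Paper

open Paper IsLocalRing

section FileF1
open CategoryTheory Limits

section LC
variable {C D : Type*} [Category* C] [Category* D] [Abelian C] [Abelian D] [EnoughProjectives C]

noncomputable def lcSC {F' F F'' : C ⥤ D} [F'.Additive] [F.Additive] [F''.Additive]
    (α : F' ⟶ F) (β : F ⟶ F'') (w : α ≫ β = 0) (K : ChainComplex C ℕ) :
    ShortComplex (ChainComplex D ℕ) :=
  ShortComplex.mk ((NatTrans.mapHomologicalComplex α _).app K)
    ((NatTrans.mapHomologicalComplex β _).app K) (by
      ext i
      have := congrArg (fun t => NatTrans.app t (K.X i)) w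
      exact this)

theorem lcSC_shortExact {F' F F'' : C ⥤ D} [F'.Additive] [F.Additive] [F''.Additive]
    (α : F' ⟶ F) (β : F ⟶ F'') (w : α ≫ β = 0)
    (hex : ∀ (P : C) [Projective P],
      (ShortComplex.mk (α.app P) (β.app P)
        (by rw [← NatTrans.comp_app, w]; rfl)).ShortExact)
    (K : ChainComplex C ℕ) (hK : ∀ i, Projective (K.X i)) :
    (lcSC α β w K).ShortExact := by
  apply HomologicalComplex.shortExact_of_degreewise_shortExact
  intro i
  have := hK i
  exact hex (K.X i)

theorem exists_lcDelta {F' F F'' : C ⥤ D} [F'.Additive] [F.Additive] [F''.Additive]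
    (α : F' ⟶ F) (β : F ⟶ F'') (w : α ≫ β = 0)
    (hex : ∀ (P : C) [Projective P],
      (ShortComplex.mk (α.app P) (β.app P)
        (by rw [← NatTrans.comp_app, w]; rfl)).ShortExact) (n : ℕ) :
    ∃ δ : F''.leftDerived (n + 1) ⟶ F'.leftDerived n,
      ∀ X, IsZero ((F.leftDerived n).obj X) → IsZero ((F.leftDerived (n + 1)).obj X) →
        IsIso (δ.app X) := by
  have hSE := fun X : C => lcSC_shortExact α β w hex (ProjectiveResolution.of X).complex
      (ProjectiveResolution.of X).projective
  have rel : (ComplexShape.down ℕ).Rel (n + 1) n := by simp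
  let dl : ∀ X : C, (HomologicalComplex.homologyFunctor D _ (n + 1)).obj
        ((F''.mapHomologicalComplex _).obj (ProjectiveResolution.of X).complex) ⟶
      (HomologicalComplex.homologyFunctor D _ n).obj
        ((F'.mapHomologicalComplex _).obj (ProjectiveResolution.of X).complex) :=
    fun X => (hSE X).δ (n + 1) n rel
  have hdl : ∀ {X Y : C} (f : X ⟶ Y),
      (F''.mapHomologicalComplex _ ⋙ HomologicalComplex.homologyFunctor _ _ (n + 1)).map
        (ProjectiveResolution.lift f (ProjectiveResolution.of X) (ProjectiveResolution.of Y)) ≫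
        dl Y = dl X ≫ (F'.mapHomologicalComplex _ ⋙ HomologicalComplex.homologyFunctor _ _ n).map
        (ProjectiveResolution.lift f (ProjectiveResolution.of X) (ProjectiveResolution.of Y)) := by
    intro X Y f
    let φ := ProjectiveResolution.lift f (ProjectiveResolution.of X) (ProjectiveResolution.of Y)
    let Φ : lcSC α β w (ProjectiveResolution.of X).complex ⟶
        lcSC α β w (ProjectiveResolution.of Y).complex :=
      { τ₁ := (F'.mapHomologicalComplex _).map φ
        τ₂ := (F.mapHomologicalComplex _).map φ
        τ₃ := (F''.mapHomologicalComplex _).map φ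
        comm₁₂ := by
          simp [lcSC]
        comm₂₃ := by
          simp [lcSC] }
    exact (HomologicalComplex.HomologySequence.δ_naturality Φ (hSE X) (hSE Y) (n+1) n rel).symm
  let ap : ∀ X : C, (F''.leftDerived (n + 1)).obj X ⟶ (F'.leftDerived n).obj X := fun X =>
    ((ProjectiveResolution.of X).isoLeftDerivedObj F'' (n + 1)).hom ≫ dl X ≫
      ((ProjectiveResolution.of X).isoLeftDerivedObj F' n).inv
  refine ⟨{ app := ap, naturality := ?_ }, ?_⟩
  · intro X Y f
    have e1 := ProjectiveResolution.isoLeftDerivedObj_hom_naturality f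
      (ProjectiveResolution.of X) (ProjectiveResolution.of Y)
      (ProjectiveResolution.lift f _ _) (ProjectiveResolution.lift_commutes_zero f _ _) F'' (n + 1)
    have e2 := ProjectiveResolution.isoLeftDerivedObj_inv_naturality f
      (ProjectiveResolution.of X) (ProjectiveResolution.of Y)
      (ProjectiveResolution.lift f _ _) (ProjectiveResolution.lift_commutes_zero f _ _) F' n
    have e4 := hdl f
    dsimp only [ap]
    rw [Category.assoc, Category.assoc, e2, ← Category.assoc, e1, Category.assoc]
    congr 1
    rw [← Category.assoc, ← Category.assoc, e4]
  · intro X h0 h1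
    have : IsIso (dl X) := (hSE X).isIso_δ _ _ _
      (h1.of_iso ((ProjectiveResolution.of X).isoLeftDerivedObj F (n+1)).symm)
      (h0.of_iso ((ProjectiveResolution.of X).isoLeftDerivedObj F n).symm)
    dsimp [ap]
    infer_instance

theorem leftDerived_isZero_of_mul {F : C ⥤ D} [F.Additive] (α : F ⟶ F) (n : ℕ) (hα : IsIso α)
    (X : C) (f : ∀ Y : C, Y ⟶ Y) (hnat : ∀ {Y Z : C} (g : Y ⟶ Z), f Y ≫ g = g ≫ f Z)
    (hf : ∀ Y, F.map (f Y) = α.app Y)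
    (hX : f X = 0) : IsZero ((F.leftDerived n).obj X) := by
  let P := ProjectiveResolution.of X
  let g : P.complex ⟶ P.complex := { f := fun i => f _, comm' := fun i j _ => hnat _ }
  have e1 := Functor.leftDerived_map_eq F n (f X) (P := P) (Q := P) g (by
    ext
    simpa [g] using hnat (P.π.f 0))
  have e2 := ProjectiveResolution.leftDerived_app_eq α P n
  have e3 : (NatTrans.mapHomologicalComplex α _).app P.complex =
      (F.mapHomologicalComplex _).map g := by
    ext i
    simp [g, hf]
    rfl
  have e4 : (NatTrans.leftDerived α n).app X = (F.leftDerived n).map (f X) := by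
    rw [e1, e2, e3]; rfl
  have e5 : NatTrans.leftDerived α n ≫ NatTrans.leftDerived (inv α) n = 𝟙 _ := by
    rw [← NatTrans.leftDerived_comp, IsIso.hom_inv_id, NatTrans.leftDerived_id]
  have e7 := Functor.leftDerived_map_eq F n (0 : X ⟶ X) (P := P) (Q := P) 0 (by
    rw [Functor.map_zero, zero_comp, comp_zero])
  rw [show (F.mapHomologicalComplex (ComplexShape.down ℕ) ⋙
      HomologicalComplex.homologyFunctor D (ComplexShape.down ℕ) n).map
      (0 : P.complex ⟶ P.complex) = 0 from Functor.map_zero _ _ _, zero_comp, comp_zero] at e7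
  rw [hX, e7] at e4
  have e6 := congrArg (fun t => t.app X) e5
  rw [IsZero.iff_id_eq_zero]
  dsimp at e6
  rw [← e6, e4, zero_comp]
end LC
end FileF1

section FileF2
open CategoryTheory Limits Opposite

section LC2
variable {R : Type u} [CommRing R]

noncomputable abbrev yonR (Y : ModuleCat.{u} R) : ModuleCat.{u} R ⥤ (ModuleCat.{u} R)ᵒᵖ :=
  ((linearYoneda R (ModuleCat.{u} R)).obj Y).rightOp

noncomputable abbrev yonRmap {Y Z : ModuleCat.{u} R} (f : Y ⟶ Z) : yonR Z ⟶ yonR Y :=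
  NatTrans.rightOp ((linearYoneda R (ModuleCat.{u} R)).map f)

noncomputable abbrev lcDiag (J : Ideal R) (i : ℕ) (Y : ModuleCat.{u} R) :
    ℕᵒᵖᵒᵖ ⥤ ModuleCat.{u} R :=
  (localCohomology.ringModIdeals (localCohomology.idealPowersDiagram J)).op ⋙
    ((yonR Y).leftDerived i).leftOp

theorem lc_iso_colimit (J : Ideal R) (i : ℕ) (Y : ModuleCat.{u} R) :
    Nonempty ((localCohomology J i).obj Y ≅ colimit (lcDiag J i Y)) := by
  refine ⟨colimitObjIsoColimitCompEvaluation (localCohomology.diagram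
    (localCohomology.idealPowersDiagram J) i) Y⟩

theorem lc_shift (J : Ideal R) (i : ℕ) {A S B : ModuleCat.{u} R} (f : A →ₗ[R] S) (g : S →ₗ[R] B)
    (hf : Function.Injective f) (hg : Function.Surjective g) (hfg : Function.Exact f g)
    (x : R) (hx : x ∈ J) (hS : Function.Bijective (fun s : S => x • s)) :
    Nonempty ((localCohomology J (i + 1)).obj A ≅ (localCohomology J i).obj B) := by
  obtain ⟨e1⟩ := lc_iso_colimit J (i+1) A
  obtain ⟨e2⟩ := lc_iso_colimit J i B
  suffices h : Nonempty (lcDiag J i B ≅ lcDiag J (i+1) A) by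
    obtain ⟨h⟩ := h
    exact ⟨e1 ≪≫ (HasColimit.isoOfNatIso h).symm ≪≫ e2.symm⟩
  have w : yonRmap (ModuleCat.ofHom g) ≫ yonRmap (ModuleCat.ofHom f) = 0 := by
    ext P
    apply Quiver.Hom.unop_inj
    ext (q : P ⟶ A)
    exact ModuleCat.hom_ext (LinearMap.ext fun y => hfg.apply_apply_eq_zero (q.hom y))
  have hex : ∀ (P : ModuleCat.{u} R) [Projective P],
      (ShortComplex.mk ((yonRmap (ModuleCat.ofHom g)).app P) ((yonRmap (ModuleCat.ofHom f)).app P)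
        (by rw [← NatTrans.comp_app, w]; rfl)).ShortExact := by
    intro P _
    let T : ShortComplex (ModuleCat.{u} R) := ShortComplex.mk
      (((linearYoneda R (ModuleCat.{u} R)).map (ModuleCat.ofHom f)).app (op P))
      (((linearYoneda R (ModuleCat.{u} R)).map (ModuleCat.ofHom g)).app (op P)) (by
        ext (q : P ⟶ A)
        exact ModuleCat.hom_ext (LinearMap.ext fun y => hfg.apply_apply_eq_zero (q.hom y)))
    have hP : Module.Projective R P := (IsProjective.iff_projective P).mpr inferInstance
    have hT : T.ShortExact := by
      have hm : Mono T.f := by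
        rw [ModuleCat.mono_iff_injective]
        intro (q : P ⟶ A) (q' : P ⟶ A) (h : q ≫ ModuleCat.ofHom f = q' ≫ ModuleCat.ofHom f)
        refine ModuleCat.hom_ext (LinearMap.ext fun y => ?_)
        apply hf
        exact congrArg (fun t => t.hom y) h
      have he : Epi T.g := by
        rw [ModuleCat.epi_iff_surjective]
        intro (q : P ⟶ B)
        obtain ⟨h, hh⟩ := Module.projective_lifting_property g q.hom hg
        refine ⟨(ModuleCat.ofHom h : P ⟶ S), ?_⟩
        change ModuleCat.ofHom h ≫ ModuleCat.ofHom g = q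
        ext y
        exact congrArg (fun t => t y) hh
      refine ⟨?_⟩
      rw [ShortComplex.moduleCat_exact_iff]
      intro (q : P ⟶ S) (hq : q ≫ ModuleCat.ofHom g = 0)
      have hq' : ∀ y, g (q.hom y) = 0 := fun y => congrArg (fun t => t.hom y) hq
      let E := LinearEquiv.ofInjective f hf
      refine ⟨(ModuleCat.ofHom (E.symm.toLinearMap ∘ₗ (q.hom.codRestrict (LinearMap.range f)
        (fun y => (hfg _).1 (hq' y)))) : P ⟶ A), ?_⟩
      change _ ≫ ModuleCat.ofHom f = q
      ext y
      have := congrArg Subtype.val (E.apply_symm_apply ((q.hom.codRestrict (LinearMap.range f)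
        (fun y => (hfg _).1 (hq' y))) y))
      exact this
    exact hT.op
  obtain ⟨δ, hδ⟩ := exists_lcDelta _ _ w hex i
  have hz : ∀ (k t : ℕ), IsZero (((yonR S).leftDerived k).obj (ModuleCat.of R (R ⧸ J ^ t))) := by
    intro k t
    let m : S →ₗ[R] S := LinearMap.lsmul R S (x ^ t)
    have hm : Function.Bijective m := by
      have : ∀ t : ℕ, Function.Bijective (fun s : S => (x ^ t) • s) := by
        intro t
        induction t with
        | zero => simp only [pow_zero, one_smul]; exact Function.bijective_id
        | succ t ih =>
          have := hS.comp ih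
          convert this using 1
          ext s
          simp [pow_succ', mul_smul]
      exact this t
    have hmi : IsIso (ModuleCat.ofHom m) := by
      rw [ConcreteCategory.isIso_iff_bijective]; exact hm
    refine leftDerived_isZero_of_mul (yonRmap (ModuleCat.ofHom m)) k ?_ _
      (fun Y => ModuleCat.ofHom (LinearMap.lsmul R Y (x ^ t))) ?_ ?_ ?_
    · have : IsIso ((linearYoneda R (ModuleCat.{u} R)).map (ModuleCat.ofHom m)) := inferInstance
      refine ⟨yonRmap (inv (ModuleCat.ofHom m)), ?_, ?_⟩
      · ext P
        apply Quiver.Hom.unop_inj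
        ext (q : P ⟶ S) : 2
        change (q ≫ _) ≫ _ = q
        simp
      · ext P
        apply Quiver.Hom.unop_inj
        ext (q : P ⟶ S) : 2
        change (q ≫ _) ≫ _ = q
        simp
    · intro Y Z g
      ext y
      simp
    · intro Y
      apply Quiver.Hom.unop_inj
      ext (q : Y ⟶ S)
      exact ModuleCat.hom_ext (LinearMap.ext fun y => q.hom.map_smul (x ^ t) y)
    · refine ModuleCat.hom_ext (LinearMap.ext fun y => ?_)
      change x ^ t • (y : R ⧸ J ^ t) = 0
      obtain ⟨y, rfl⟩ := Ideal.Quotient.mk_surjective y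
      rw [← Ideal.Quotient.mk_eq_mk, ← Submodule.Quotient.mk_smul,
        Submodule.Quotient.mk_eq_zero]
      exact Ideal.mul_mem_right _ _ (Ideal.pow_mem_pow hx t)
  let T := Functor.whiskerLeft
    (localCohomology.ringModIdeals (localCohomology.idealPowersDiagram J)).op (NatTrans.leftOp δ)
  have hT : ∀ t, IsIso (T.app t) := by
    intro t
    have := hδ _ (hz i (unop (unop t))) (hz (i+1) (unop (unop t)))
    exact (inferInstance : IsIso (δ.app (ModuleCat.of R (R ⧸ J ^ (unop (unop t))))).unop)
  have : IsIso T := NatIso.isIso_of_isIso_app T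
  exact ⟨asIso T⟩
end LC2
end FileF2

section FileF3
open CategoryTheory Limits Opposite

section LC3
variable {R : Type u} [CommRing R]

theorem yonR_pres (D : ModuleCat.{u} R) : PreservesFiniteColimits (yonR D) := by
  have h1 : PreservesLimits ((linearYoneda R (ModuleCat.{u} R)).obj D ⋙ forget (ModuleCat.{u} R)) :=
    (inferInstance : PreservesLimits (yoneda.obj D))
  have : PreservesLimits ((linearYoneda R (ModuleCat.{u} R)).obj D) :=
    preservesLimits_of_reflects_of_preserves _ (forget (ModuleCat.{u} R))
  have : PreservesFiniteLimits ((linearYoneda R (ModuleCat.{u} R)).obj D) :=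
    PreservesLimits.preservesFiniteLimits _
  exact preservesFiniteColimits_rightOp _

theorem lc_zero (J : Ideal R) (D : ModuleCat.{u} R)
    (hD : ∀ d : D, ∃ t : ℕ, ∀ a ∈ J ^ t, a • d = 0) :
    Nonempty ((localCohomology J 0).obj D ≅ D) := by
  have := yonR_pres D
  obtain ⟨e1⟩ := lc_iso_colimit J 0 D
  let Q := (localCohomology.ringModIdeals (localCohomology.idealPowersDiagram J))
  let G := Q.op ⋙ (linearYoneda R (ModuleCat.{u} R)).obj D
  have e2 : lcDiag J 0 D ≅ G :=
    by
    let T : G ⟶ lcDiag J 0 D :=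
      Functor.whiskerLeft Q.op (NatTrans.leftOp (yonR D).leftDerivedZeroIsoSelf.hom)
    have hT : ∀ t, IsIso (T.app t) := by
      intro t
      exact (inferInstance : IsIso ((yonR D).leftDerivedZeroIsoSelf.hom.app (Q.obj (unop t))).unop)
    have : IsIso T := NatIso.isIso_of_isIso_app T
    exact (asIso T).symm
  have hfil : PreservesFilteredColimitsOfSize.{0, 0} (forget (ModuleCat.{u} R)) :=
    preservesFilteredColimitsOfSize_of_univLE.{u, u} _
  let c : Cocone G :=
    { pt := D
      ι := { app := fun t => ModuleCat.ofHom (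
               { toFun := fun (q : Q.obj (unop t) ⟶ D) => q.hom (Submodule.Quotient.mk (1 : R))
                 map_add' := fun q q' => rfl
                 map_smul' := fun r q => rfl })
             naturality := by
              intro s t f
              rfl } }
  have hb : IsIso (colimit.desc G c) := by
    rw [ConcreteCategory.isIso_iff_bijective]
    constructor
    · rw [injective_iff_map_eq_zero]
      intro a ha
      obtain ⟨t, q, rfl⟩ := Concrete.colimit_exists_rep G a
      have h2 : (c.ι.app t) q = 0 := by
        rw [← ha]
        rw [← colimit.ι_desc c t]
        rfl
      have h3 : q = 0 := by
        let q' : Q.obj (unop t) ⟶ D := q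
        have h4 : q'.hom (Submodule.Quotient.mk (1 : R)) = 0 := h2
        refine ModuleCat.hom_ext (LinearMap.ext fun y => ?_)
        obtain ⟨y, rfl⟩ := Submodule.Quotient.mk_surjective _ y
        have h5 : (Submodule.Quotient.mk y : R ⧸ (localCohomology.idealPowersDiagram J).obj (unop t)) =
          y • Submodule.Quotient.mk (1 : R) := by
          rw [← Submodule.Quotient.mk_smul]; simp
        rw [h5]
        refine (q'.hom.map_smul y _).trans ?_
        rw [h4, smul_zero]; rfl
      rw [h3, map_zero]
    · intro d
      obtain ⟨t, ht⟩ := hD d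
      let q : Q.obj (op t) ⟶ D := ModuleCat.ofHom ((J ^ t).liftQ (LinearMap.toSpanSingleton R D d) (by
        intro a ha
        exact ht a ha))
      refine ⟨colimit.ι G (op (op t)) q, ?_⟩
      have : (c.ι.app (op (op t))) q = d := by
        change (1 : R) • d = d
        simp
      rw [← colimit.ι_desc c (op (op t))] at this
      exact this
  exact ⟨e1 ≪≫ HasColimit.isoOfNatIso e2 ≪≫ asIso (colimit.desc G c)⟩
end LC3
end FileF3

section FileA1
open CategoryTheory IsLocalRing

structure SES {R : Type u} [CommRing R] {A B C : Type u} [AddCommGroup A] [Module R A]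
    [AddCommGroup B] [Module R B] [AddCommGroup C] [Module R C]
    (f : A →ₗ[R] B) (g : B →ₗ[R] C) : Prop where
  inj : Function.Injective f
  surj : Function.Surjective g
  ex : Function.Exact f g

def ExtV (R : Type u) [CommRing R] (A B : Type u) [AddCommGroup A] [Module R A]
    [AddCommGroup B] [Module R B] (i : ℕ) : Prop :=
  Subsingleton (Abelian.Ext (ModuleCat.of R A) (ModuleCat.of R B) i)

section A1
variable {R : Type u} [CommRing R] {A B C X Y : Type u} [AddCommGroup A] [Module R A]
    [AddCommGroup B] [Module R B] [AddCommGroup C] [Module R C]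
    [AddCommGroup X] [Module R X] [AddCommGroup Y] [Module R Y]
    {f : A →ₗ[R] B} {g : B →ₗ[R] C}

theorem SES.comp0 (h : SES f g) : g.comp f = 0 := by
  ext x; exact h.ex.apply_apply_eq_zero x

theorem SES.gf (h : SES f g) (x : A) : g (f x) = 0 := h.ex.apply_apply_eq_zero x

theorem SES.shortExact (h : SES f g) :
    (ModuleCat.shortComplexOfCompEqZero f g h.comp0).ShortExact :=
  ModuleCat.shortComplex_shortExact _ h.ex h.inj h.surj

theorem SES.of_ker (g : B →ₗ[R] C) (hg : Function.Surjective g) :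
    SES (LinearMap.ker g).subtype g :=
  ⟨Subtype.val_injective, hg, fun x => by simp⟩

theorem SES.of_range (f : A →ₗ[R] B) (hf : Function.Injective f) :
    SES f (LinearMap.range f).mkQ :=
  ⟨hf, Submodule.mkQ_surjective _, fun x => by simp⟩

theorem SES.of_sub (N : Submodule R B) : SES N.subtype N.mkQ :=
  ⟨Subtype.val_injective, Submodule.mkQ_surjective _, fun x => by simp⟩

theorem extV_iff {i : ℕ} : ExtV R A B i ↔
    ∀ x : Abelian.Ext (ModuleCat.of R A) (ModuleCat.of R B) i, x = 0 :=
  ⟨fun h x => @Subsingleton.elim _ h _ _, fun h => ⟨fun a b => by rw [h a, h b]⟩⟩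

theorem SES.cov2 (h : SES f g) {i : ℕ} (h1 : ExtV R X A i) (h3 : ExtV R X C i) : ExtV R X B i := by
  rw [extV_iff] at *
  intro x
  obtain ⟨y, hy⟩ := Abelian.Ext.covariant_sequence_exact₂ (ModuleCat.of R X) h.shortExact x (h3 _)
  rw [← hy, h1 y]; simp

theorem SES.cov1 (h : SES f g) {i : ℕ} (h3 : ExtV R X C i) (h2 : ExtV R X B (i+1)) :
    ExtV R X A (i+1) := by
  rw [extV_iff] at *
  intro x
  obtain ⟨y, hy⟩ := Abelian.Ext.covariant_sequence_exact₁ (ModuleCat.of R X) h.shortExact x (h2 _) rfl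
  rw [← hy, h3 y]; simp

theorem SES.cov3 (h : SES f g) {i : ℕ} (h2 : ExtV R X B i) (h1 : ExtV R X A (i+1)) :
    ExtV R X C i := by
  rw [extV_iff] at *
  intro x
  obtain ⟨y, hy⟩ := Abelian.Ext.covariant_sequence_exact₃ (ModuleCat.of R X) h.shortExact x rfl (h1 _)
  rw [← hy, h2 y]; simp

theorem SES.con2 (h : SES f g) {i : ℕ} (h1 : ExtV R A Y i) (h3 : ExtV R C Y i) : ExtV R B Y i := by
  rw [extV_iff] at *
  intro x
  obtain ⟨y, hy⟩ := Abelian.Ext.contravariant_sequence_exact₂ h.shortExact (ModuleCat.of R Y) x (h1 _)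
  rw [← hy, h3 y]; simp

theorem SES.con3 (h : SES f g) {i : ℕ} (h1 : ExtV R A Y i) (h2 : ExtV R B Y (i+1)) :
    ExtV R C Y (i+1) := by
  rw [extV_iff] at *
  intro x
  obtain ⟨y, hy⟩ := Abelian.Ext.contravariant_sequence_exact₃ h.shortExact (ModuleCat.of R Y) x (h2 _)
    (Nat.add_comm 1 i)
  rw [← hy, h1 y]; simp

theorem SES.con1 (h : SES f g) {i : ℕ} (h2 : ExtV R B Y i) (h3 : ExtV R C Y (i+1)) :
    ExtV R A Y i := by
  rw [extV_iff] at *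
  intro x
  obtain ⟨y, hy⟩ := Abelian.Ext.contravariant_sequence_exact₁ h.shortExact (ModuleCat.of R Y) x
    (Nat.add_comm 1 i) (h3 _)
  rw [← hy, h2 y]; simp

theorem SES.lift (h : SES f g) (h1 : ExtV R X A 1) (φ : X →ₗ[R] C) :
    ∃ ψ : X →ₗ[R] B, g.comp ψ = φ := by
  rw [extV_iff] at h1
  obtain ⟨y, hy⟩ := Abelian.Ext.covariant_sequence_exact₃ (ModuleCat.of R X) h.shortExact
    (Abelian.Ext.mk₀ (ModuleCat.ofHom φ)) (zero_add 1) (h1 _)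
  obtain ⟨y, rfl⟩ := Abelian.Ext.homEquiv₀.symm.surjective y
  rw [Abelian.Ext.homEquiv₀_symm_apply, Abelian.Ext.mk₀_comp_mk₀] at hy
  have := Abelian.Ext.homEquiv₀.symm.injective hy
  exact ⟨y.hom, congrArg ModuleCat.Hom.hom this⟩

theorem SES.ext (h : SES f g) (h1 : ExtV R C Y 1) (φ : A →ₗ[R] Y) :
    ∃ ψ : B →ₗ[R] Y, ψ.comp f = φ := by
  rw [extV_iff] at h1
  obtain ⟨y, hy⟩ := Abelian.Ext.contravariant_sequence_exact₁ h.shortExact (ModuleCat.of R Y)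
    (Abelian.Ext.mk₀ (ModuleCat.ofHom φ)) (add_zero 1) (h1 _)
  obtain ⟨y, rfl⟩ := Abelian.Ext.homEquiv₀.symm.surjective y
  rw [Abelian.Ext.homEquiv₀_symm_apply, Abelian.Ext.mk₀_comp_mk₀] at hy
  have := Abelian.Ext.homEquiv₀.symm.injective hy
  exact ⟨y.hom, congrArg ModuleCat.Hom.hom this⟩

theorem SES.of_lift (h : SES f g) (h2 : ExtV R X B 1)
    (hl : ∀ φ : X →ₗ[R] C, ∃ ψ : X →ₗ[R] B, g.comp ψ = φ) : ExtV R X A 1 := by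
  rw [extV_iff] at *
  intro x
  obtain ⟨y, hy⟩ := Abelian.Ext.covariant_sequence_exact₁ (ModuleCat.of R X) h.shortExact x (h2 _)
    (zero_add 1)
  obtain ⟨y, rfl⟩ := Abelian.Ext.homEquiv₀.symm.surjective y
  obtain ⟨ψ, hψ⟩ := hl y.hom
  have : y = ModuleCat.ofHom ψ ≫ (ModuleCat.shortComplexOfCompEqZero f g h.comp0).g :=
    ModuleCat.hom_ext hψ.symm
  rw [← hy, Abelian.Ext.homEquiv₀_symm_apply, this, ← Abelian.Ext.mk₀_comp_mk₀,
    Abelian.Ext.comp_assoc (a₁₂ := 0) (a₂₃ := 1) (h₁₂ := by rfl) (h₂₃ := by rfl) (h := by rfl),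
    ShortComplex.ShortExact.comp_extClass]
  simp

theorem SES.of_ext (h : SES f g) (h2 : ExtV R B Y 1)
    (hl : ∀ φ : A →ₗ[R] Y, ∃ ψ : B →ₗ[R] Y, ψ.comp f = φ) : ExtV R C Y 1 := by
  rw [extV_iff] at *
  intro x
  obtain ⟨y, hy⟩ := Abelian.Ext.contravariant_sequence_exact₃ h.shortExact (ModuleCat.of R Y) x (h2 _)
    (add_zero 1)
  obtain ⟨y, rfl⟩ := Abelian.Ext.homEquiv₀.symm.surjective y
  obtain ⟨ψ, hψ⟩ := hl y.hom
  have : y = (ModuleCat.shortComplexOfCompEqZero f g h.comp0).f ≫ ModuleCat.ofHom ψ :=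
    ModuleCat.hom_ext hψ.symm
  rw [← hy, Abelian.Ext.homEquiv₀_symm_apply, this, ← Abelian.Ext.mk₀_comp_mk₀,
    ← Abelian.Ext.comp_assoc (a₁₂ := 1) (a₂₃ := 0) (h₁₂ := by rfl) (h₂₃ := by rfl) (h := by rfl),
    ShortComplex.ShortExact.extClass_comp]
  simp

theorem SES.of_equiv (e : A ≃ₗ[R] B) : SES (e : A →ₗ[R] B) (0 : B →ₗ[R] PUnit.{u+1}) :=
  ⟨e.injective, fun _ => ⟨0, rfl⟩, fun y => by simp⟩

theorem extV_proj (h : Module.Projective R A) (i : ℕ) : ExtV R A B (i+1) := by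
  rw [extV_iff]; intro x
  have := (IsProjective.iff_projective (R := R) A).1 h
  exact Abelian.Ext.eq_zero_of_projective x

theorem extV_inj (h : Module.Injective R B) (i : ℕ) : ExtV R A B (i+1) := by
  rw [extV_iff]; intro x
  have := (Module.injective_iff_injective_object (R := R) B).1 h
  exact Abelian.Ext.eq_zero_of_injective x

theorem extV_of_subsingleton_left [Subsingleton A] (i : ℕ) : ExtV R A B i := by
  rw [extV_iff]; intro x
  have : Limits.IsZero (ModuleCat.of R A) := ModuleCat.isZero_of_subsingleton _
  rw [← Abelian.Ext.mk₀_id_comp x, this.eq_of_src (𝟙 _) 0]; simp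

theorem extV_of_subsingleton_right [Subsingleton B] (i : ℕ) : ExtV R A B i := by
  rw [extV_iff]; intro x
  have : Limits.IsZero (ModuleCat.of R B) := ModuleCat.isZero_of_subsingleton _
  rw [← Abelian.Ext.comp_mk₀_id x, this.eq_of_src (𝟙 _) 0]; simp

theorem ExtV.congr_left {i : ℕ} (h : ExtV R A Y i) (e : A ≃ₗ[R] B) : ExtV R B Y i :=
  (SES.of_equiv e).con2 h (extV_of_subsingleton_left i)

theorem ExtV.congr_right {i : ℕ} (h : ExtV R X A i) (e : A ≃ₗ[R] B) : ExtV R X B i :=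
  (SES.of_equiv e).cov2 h (extV_of_subsingleton_right i)

theorem SES.prod : SES (LinearMap.inl R A B) (LinearMap.snd R A B) :=
  ⟨LinearMap.inl_injective, LinearMap.snd_surjective, fun x => by
    simp [Prod.ext_iff, eq_comm]⟩
end A1
end FileA1

section FileB1
open CategoryTheory IsLocalRing Paper

structure Resolving (R : Type u) [CommRing R] (P : ModuleCat.{u} R → Prop) : Prop where
  iso : ∀ {A B : Type u} [AddCommGroup A] [Module R A] [AddCommGroup B] [Module R B],
    (A ≃ₗ[R] B) → P (.of R A) → P (.of R B)
  proj : ∀ (A : Type u) [AddCommGroup A] [Module R A], Module.Projective R A → P (.of R A)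
  extn : ∀ {A B C : Type u} [AddCommGroup A] [Module R A] [AddCommGroup B] [Module R B]
    [AddCommGroup C] [Module R C] {f : A →ₗ[R] B} {g : B →ₗ[R] C}, SES f g →
    P (.of R A) → P (.of R C) → P (.of R B)
  kere : ∀ {A B C : Type u} [AddCommGroup A] [Module R A] [AddCommGroup B] [Module R B]
    [AddCommGroup C] [Module R C] {f : A →ₗ[R] B} {g : B →ₗ[R] C}, SES f g →
    P (.of R B) → P (.of R C) → P (.of R A)

def IsoClosed (R : Type u) [CommRing R] (P : ModuleCat.{u} R → Prop) : Prop :=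
  ∀ {A B : Type u} [AddCommGroup A] [Module R A] [AddCommGroup B] [Module R B],
    (A ≃ₗ[R] B) → P (.of R A) → P (.of R B)

section B1
variable {R : Type u} [CommRing R] {P P' : ModuleCat.{u} R → Prop}

theorem Paper.ResDimLE.succ {n : ℕ} {M : ModuleCat.{u} R} (h : ResDimLE R P n M) :
    ResDimLE R P (n+1) M := Or.inl h

theorem Paper.ResDimLE.mono {n m : ℕ} (hnm : n ≤ m) {M : ModuleCat.{u} R} (h : ResDimLE R P n M) :
    ResDimLE R P m M := by
  induction hnm with
  | refl => exact h
  | step _ ih => exact ih.succ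

theorem Paper.ResDimLE.mono_class (hP : ∀ M, P M → P' M) {n : ℕ} {M : ModuleCat.{u} R}
    (h : ResDimLE R P n M) : ResDimLE R P' n M := by
  induction n generalizing M with
  | zero => exact hP _ h
  | succ n ih =>
    rcases h with h | ⟨X, f, hX, hf, hk⟩
    · exact (ih h).succ
    · exact Or.inr ⟨X, f, hP _ hX, hf, ih hk⟩

variable {A B C Q K : Type u} [AddCommGroup A] [Module R A]
    [AddCommGroup B] [Module R B] [AddCommGroup C] [Module R C]
    [AddCommGroup Q] [Module R Q] [AddCommGroup K] [Module R K]

theorem Paper.ResDimLE.iso (hP : IsoClosed R P) {n : ℕ} (e : A ≃ₗ[R] B)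
    (h : ResDimLE R P n (.of R A)) : ResDimLE R P n (.of R B) := by
  induction n generalizing A B with
  | zero => exact hP e h
  | succ n ih =>
    rcases h with h | ⟨X, f, hX, hf, hk⟩
    · exact (ih e h).succ
    · refine Or.inr ⟨X, e.toLinearMap.comp f, hX, e.surjective.comp hf, ?_⟩
      refine ih (LinearEquiv.ofEq _ _ ?_) hk
      ext x; simp

/-- The submodule iso: the left term of an SES is the kernel. -/
noncomputable def SES.kerEquiv {f : A →ₗ[R] B} {g : B →ₗ[R] C} (h : SES f g) :
    A ≃ₗ[R] LinearMap.ker g :=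
  LinearEquiv.ofBijective (f.codRestrict _ fun x => h.gf x)
    ⟨fun x y hxy => h.inj (congrArg Subtype.val hxy), fun y => by
      obtain ⟨x, hx⟩ := (h.ex y.1).1 y.2
      exact ⟨x, Subtype.ext hx⟩⟩

noncomputable def SES.quotEquiv {f : A →ₗ[R] B} {g : B →ₗ[R] C} (h : SES f g) :
    (B ⧸ LinearMap.range f) ≃ₗ[R] C :=
  (Submodule.quotEquivOfEq _ _ (by ext x; exact (h.ex x).symm)).trans
    (g.quotKerEquivOfSurjective h.surj)

theorem Paper.ResDimLE.cons (hP : IsoClosed R P) {n : ℕ} {f : A →ₗ[R] B} {g : B →ₗ[R] C} (h : SES f g)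
    (hB : P (.of R B)) (hA : ResDimLE R P n (.of R A)) : ResDimLE R P (n+1) (.of R C) :=
  Or.inr ⟨.of R B, g, hB, h.surj, hA.iso hP h.kerEquiv⟩

theorem Paper.ResDimLE.exists_ses {n : ℕ} (h : ResDimLE R P (n+1) (.of R C)) :
    ResDimLE R P n (.of R C) ∨ ∃ (A B : ModuleCat.{u} R) (f : A →ₗ[R] B) (g : B →ₗ[R] C),
      SES f g ∧ P B ∧ ResDimLE R P n A := by
  rcases h with h | ⟨X, f, hX, hf, hk⟩
  · exact Or.inl h
  · exact Or.inr ⟨.of R (LinearMap.ker f), X, (LinearMap.ker f).subtype, f, SES.of_ker f hf, hX, hk⟩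

theorem SES.trans_equiv_left {f : A →ₗ[R] B} {g : B →ₗ[R] C} (h : SES f g) (e : K ≃ₗ[R] A) :
    SES (f.comp e.toLinearMap) g :=
  ⟨h.inj.comp e.injective, h.surj, fun x => by
    rw [h.ex x]
    exact ⟨fun ⟨y, hy⟩ => ⟨e.symm y, by simpa using hy⟩, fun ⟨y, hy⟩ => ⟨e y, hy⟩⟩⟩

theorem SES.trans_equiv_right {f : A →ₗ[R] B} {g : B →ₗ[R] C} (h : SES f g) (e : C ≃ₗ[R] K) :
    SES f (e.toLinearMap.comp g) :=
  ⟨h.inj, e.surjective.comp h.surj, fun x => by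
    rw [← h.ex x]; simp⟩

theorem SES.trans_equiv_mid {f : A →ₗ[R] B} {g : B →ₗ[R] C} (h : SES f g) (e : B ≃ₗ[R] K) :
    SES (e.toLinearMap.comp f) (g.comp e.symm.toLinearMap) :=
  ⟨e.injective.comp h.inj, h.surj.comp e.symm.surjective, fun x => by
    have := h.ex (e.symm x)
    simp only [LinearMap.comp_apply, LinearEquiv.coe_coe]
    rw [this]
    simp only [Set.mem_range, LinearMap.comp_apply, LinearEquiv.coe_coe]
    constructor
    · rintro ⟨y, hy⟩; exact ⟨y, by rw [hy]; simp⟩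
    · rintro ⟨y, hy⟩; exact ⟨y, by rw [← hy]; simp⟩⟩

/-- Given `A → B → C` SES and `W → B` surjective, SES `ker (W→C) → W → C` and
`ker(W → B) → ker (W→C) → A`. -/
theorem SES.pull {W : Type u} [AddCommGroup W] [Module R W]
    {f : A →ₗ[R] B} {g : B →ₗ[R] C} (h : SES f g) (w : W →ₗ[R] B) (hw : Function.Surjective w) :
    ∃ (p : LinearMap.ker (g.comp w) →ₗ[R] A) (q : LinearMap.ker w →ₗ[R] LinearMap.ker (g.comp w)),
      SES q p ∧ (∀ z, f (p z) = w z.1) ∧ ∀ z, (q z).1 = z.1 := by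
  have hmem : ∀ z : LinearMap.ker (g.comp w), w z.1 ∈ LinearMap.ker g := fun z => z.2
  let p : LinearMap.ker (g.comp w) →ₗ[R] A :=
    h.kerEquiv.symm.toLinearMap.comp ((w.comp (Submodule.subtype _)).codRestrict _ hmem)
  have hp : ∀ z, f (p z) = w z.1 := by
    intro z
    have : h.kerEquiv (p z) = ⟨w z.1, z.2⟩ := by
      change h.kerEquiv (h.kerEquiv.symm _) = _
      rw [LinearEquiv.apply_symm_apply]; rfl
    exact congrArg Subtype.val this
  refine ⟨p, Submodule.inclusion fun x hx => ?_, ⟨Submodule.inclusion_injective _, ?_, ?_⟩, hp,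
    fun _ => rfl⟩
  · simp only [LinearMap.mem_ker, LinearMap.comp_apply] at hx ⊢; simp [hx]
  · intro a
    obtain ⟨b, hb⟩ := hw (f a)
    exact ⟨⟨b, by simp [hb, h.gf]⟩, h.inj (by rw [hp, hb])⟩
  · intro z
    constructor
    · intro hz
      have := hp z
      rw [hz, map_zero] at this
      exact ⟨⟨z.1, this.symm⟩, rfl⟩
    · rintro ⟨y, rfl⟩
      apply h.inj
      refine (hp _).trans ?_
      exact (LinearMap.mem_ker.1 y.2).trans (map_zero f).symm

theorem res_ker_P (hP : Resolving R P) {n : ℕ} {f : A →ₗ[R] B} {g : B →ₗ[R] C} (h : SES f g)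
    (hB : ResDimLE R P n (.of R B)) (hC : P (.of R C)) : ResDimLE R P n (.of R A) := by
  induction n with
  | zero => exact hP.kere h hB hC
  | succ n ih =>
    rcases hB with hB | ⟨X, w, hX, hw, hk⟩
    · exact Or.inl (ih hB)
    · obtain ⟨p, q, hpq, -, -⟩ := h.pull w hw
      refine ResDimLE.cons hP.iso hpq (hP.kere (SES.of_ker (g.comp w) (h.surj.comp hw)) hX hC) hk

theorem res_prod (hP : Resolving R P) {n : ℕ} (hA : ResDimLE R P n (.of R A)) (hQ : P (.of R Q)) :
    ResDimLE R P n (.of R (A × Q)) := by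
  induction n generalizing A with
  | zero => exact hP.extn SES.prod hA hQ
  | succ n ih =>
    rcases Paper.ResDimLE.exists_ses hA with h | ⟨K, X, f, g, hfg, hX, hk⟩
    · exact (ih h).succ
    · have : SES ((LinearMap.inl R X Q).comp f) (g.prodMap (LinearMap.id : Q →ₗ[R] Q)) := by
        refine ⟨LinearMap.inl_injective.comp hfg.inj, ?_, ?_⟩
        · exact Function.Surjective.prodMap hfg.surj Function.surjective_id
        · rintro ⟨x, q⟩
          have := hfg.ex x
          simp only [Set.mem_range] at this
          simp [Prod.ext_iff, this, eq_comm (a := (0 : Q))]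
      exact ResDimLE.cons hP.iso this (hP.extn SES.prod hX hQ) hk

theorem SES.split_proj {f : A →ₗ[R] B} {g : B →ₗ[R] C} (h : SES f g) (hC : Module.Projective R C) :
    Nonempty ((A × C) ≃ₗ[R] B) := by
  obtain ⟨s, hs⟩ := Module.projective_lifting_property g LinearMap.id h.surj
  have hs' : ∀ c, g (s c) = c := fun c => LinearMap.congr_fun hs c
  refine ⟨LinearEquiv.ofBijective (f.coprod s) ⟨?_, ?_⟩⟩
  · rw [injective_iff_map_eq_zero]
    rintro ⟨a, c⟩ hac
    simp only [LinearMap.coprod_apply] at hac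
    have h2 := congrArg g hac
    simp only [map_add, h.gf, hs', zero_add, map_zero] at h2
    subst h2
    simp only [map_zero, add_zero] at hac
    have := (injective_iff_map_eq_zero f).1 h.inj a hac
    subst this; rfl
  · intro b
    obtain ⟨a, ha⟩ := (h.ex (b - s (g b))).1 (by simp [hs'])
    exact ⟨(a, g b), by simp [ha]⟩

theorem SES.pull1 {f : A →ₗ[R] B} {g : B →ₗ[R] C} (h : SES f g) (t : Q →ₗ[R] C) :
    ∃ (Z : ModuleCat.{u} R) (a : A →ₗ[R] Z) (b : Z →ₗ[R] Q) (d : Z →ₗ[R] B), SES a b ∧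
      d.comp a = f ∧ g.comp d = t.comp b ∧ (∀ x q, g x = t q → ∃ z, d z = x ∧ b z = q) ∧
      ∀ z, d z = 0 → b z = 0 → z = 0 := by
  let D : B × Q →ₗ[R] C := g.comp (LinearMap.fst R B Q) - t.comp (LinearMap.snd R B Q)
  have hD : ∀ z : LinearMap.ker D, g z.1.1 = t z.1.2 := fun z => sub_eq_zero.1 z.2
  refine ⟨.of R (LinearMap.ker D), ((LinearMap.inl R B Q).comp f).codRestrict _ ?_,
    (LinearMap.snd R B Q).comp (Submodule.subtype _), (LinearMap.fst R B Q).comp (Submodule.subtype _),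
    ⟨?_, ?_, ?_⟩, ?_, ?_, ?_, ?_⟩
  · intro x; simp [D, h.gf]
  · intro x y hxy
    exact h.inj (congrArg (fun z : LinearMap.ker D => z.1.1) hxy)
  · intro q
    obtain ⟨b, hb⟩ := h.surj (t q)
    exact ⟨⟨(b, q), by simp [D, hb]⟩, rfl⟩
  · rintro ⟨⟨b, q⟩, hz⟩
    constructor
    · intro hq
      change q = 0 at hq
      subst hq
      have : g b = 0 := by simpa [D] using hz
      obtain ⟨a, ha⟩ := (h.ex b).1 this
      exact ⟨a, Subtype.ext (Prod.ext ha rfl)⟩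
    · rintro ⟨a, ha⟩
      exact (congrArg (fun z : LinearMap.ker D => z.1.2) ha).symm
  · rfl
  · ext z; exact hD z
  · intro x q hxq
    exact ⟨⟨(x, q), by simp [D, hxq]⟩, rfl, rfl⟩
  · intro z h1 h2
    exact Subtype.ext (Prod.ext h1 h2)

theorem SES.push1 {f : A →ₗ[R] B} {g : B →ₗ[R] C} (h : SES f g) (t : A →ₗ[R] Q) :
    ∃ (Z : ModuleCat.{u} R) (c : Q →ₗ[R] Z) (d : Z →ₗ[R] C) (a : B →ₗ[R] Z), SES c d ∧
      a.comp f = c.comp t ∧ d.comp a = g ∧ (∀ z, ∃ x q, z = a x + c q) ∧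
      ∀ x q, a x + c q = 0 → ∃ y, x = f y ∧ q = - t y := by
  let r : A →ₗ[R] B × Q := f.prod (-t)
  let d : ((B × Q) ⧸ LinearMap.range r) →ₗ[R] C :=
    (LinearMap.range r).liftQ (g.comp (LinearMap.fst R B Q)) (by
      rintro _ ⟨x, rfl⟩; simp [r, h.gf])
  have key : ∀ x q, (LinearMap.range r).mkQ (x, q) = 0 → ∃ y, x = f y ∧ q = - t y := by
    intro x q hxq
    rw [Submodule.mkQ_apply, Submodule.Quotient.mk_eq_zero] at hxq
    obtain ⟨y, hy⟩ := hxq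
    exact ⟨y, (congrArg Prod.fst hy).symm, (congrArg Prod.snd hy).symm⟩
  refine ⟨.of R ((B × Q) ⧸ LinearMap.range r), (LinearMap.range r).mkQ.comp (LinearMap.inr R B Q), d,
    (LinearMap.range r).mkQ.comp (LinearMap.inl R B Q), ⟨?_, ?_, ?_⟩, ?_, ?_, ?_, ?_⟩
  · rw [injective_iff_map_eq_zero]
    intro q hq
    obtain ⟨y, h1, h2⟩ := key 0 q hq
    have : y = 0 := h.inj (by rw [← h1, map_zero])
    rw [h2, this]; simp
  · intro c
    obtain ⟨b, hb⟩ := h.surj c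
    exact ⟨(LinearMap.range r).mkQ (b, 0), hb⟩
  · intro z
    obtain ⟨⟨b, q⟩, rfl⟩ := (LinearMap.range r).mkQ_surjective z
    constructor
    · intro hz
      obtain ⟨a, ha⟩ := (h.ex b).1 hz
      refine ⟨q + t a, ?_⟩
      change (LinearMap.range r).mkQ (0, q + t a) = (LinearMap.range r).mkQ (b, q)
      rw [← sub_eq_zero, ← map_sub, Submodule.mkQ_apply, Submodule.Quotient.mk_eq_zero]
      exact ⟨-a, by simp [r, ha]⟩
    · rintro ⟨y, hy⟩
      rw [← hy]
      change g 0 = 0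
      simp
  · ext x
    change (LinearMap.range r).mkQ (f x, 0) = (LinearMap.range r).mkQ (0, t x)
    rw [← sub_eq_zero, ← map_sub, Submodule.mkQ_apply, Submodule.Quotient.mk_eq_zero]
    exact ⟨x, by simp [r]⟩
  · ext x; rfl
  · intro z
    obtain ⟨⟨b, q⟩, rfl⟩ := (LinearMap.range r).mkQ_surjective z
    refine ⟨b, q, ?_⟩
    simp only [LinearMap.comp_apply, ← map_add]; simp
  · intro x q hxq
    apply key
    simp only [LinearMap.comp_apply, ← map_add] at hxq
    simpa using hxq

theorem SES.pull2 {f : A →ₗ[R] B} {g : B →ₗ[R] C} (h : SES f g) {f' : K →ₗ[R] Q} {t : Q →ₗ[R] C}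
    (h' : SES f' t) :
    ∃ (Z : ModuleCat.{u} R) (a : A →ₗ[R] Z) (b : Z →ₗ[R] Q) (c : K →ₗ[R] Z) (d : Z →ₗ[R] B),
      SES a b ∧ SES c d ∧ d.comp a = f ∧ b.comp c = f' ∧ g.comp d = t.comp b := by
  obtain ⟨Z, a, b, d, hab, hda, hgd, hex, hun⟩ := h.pull1 t
  have h0 : ∀ k, ∃ z, d z = 0 ∧ b z = f' k := fun k => hex 0 (f' k) (by simp [h'.gf])
  choose s hs1 hs2 using h0
  let c : K →ₗ[R] Z :=
    { toFun := s
      map_add' := fun x y => by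
        rw [← sub_eq_zero]; apply hun <;> simp [hs1, hs2]
      map_smul' := fun r y => by
        rw [← sub_eq_zero]; apply hun <;> simp [hs1, hs2] }
  refine ⟨Z, a, b, c, d, hab, ⟨?_, ?_, ?_⟩, hda, LinearMap.ext hs2, hgd⟩
  · intro x y hxy
    exact h'.inj (by rw [← hs2, ← hs2]; exact congrArg b hxy)
  · intro x
    obtain ⟨q, hq⟩ := h'.surj (g x)
    obtain ⟨z, hz, -⟩ := hex x q hq.symm
    exact ⟨z, hz⟩
  · intro z
    constructor
    · intro hz
      have : t (b z) = 0 := by rw [← LinearMap.comp_apply, ← hgd]; simp [hz]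
      obtain ⟨k, hk⟩ := (h'.ex _).1 this
      refine ⟨k, sub_eq_zero.1 (hun _ ?_ ?_)⟩
      · rw [map_sub, hz]; exact (sub_zero _).trans (hs1 k)
      · rw [map_sub, ← hk]; exact sub_eq_zero.2 (hs2 k)
    · rintro ⟨k, rfl⟩; exact hs1 k

theorem SES.push2 {f : A →ₗ[R] B} {g : B →ₗ[R] C} (h : SES f g) {t : A →ₗ[R] Q} {t' : Q →ₗ[R] K}
    (h' : SES t t') :
    ∃ (Z : ModuleCat.{u} R) (c : Q →ₗ[R] Z) (d : Z →ₗ[R] C) (a : B →ₗ[R] Z) (b : Z →ₗ[R] K),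
      SES c d ∧ SES a b ∧ a.comp f = c.comp t ∧ d.comp a = g ∧ b.comp c = t' := by
  obtain ⟨Z, c, d, a, hcd, haf, hda, hex, hun⟩ := h.push1 t
  have hcd' := fun q => hcd.gf q
  choose sx sq hs using hex
  have hb : ∀ z x q, z = a x + c q → t' (sq z) = t' q := by
    intro z x q hz
    obtain ⟨y, h1, h2⟩ := hun (x - sx z) (q - sq z) (by
      have := hs z; rw [hz] at this
      rw [map_sub, map_sub]
      rw [← hz] at this
      have e : a x + c q = a (sx z) + c (sq z) := by rw [← hz]; exact this
      rw [← sub_eq_zero] at e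
      rw [← e]; abel)
    have := congrArg t' h2
    simp only [map_sub, map_neg, h'.gf, neg_zero] at this
    exact (sub_eq_zero.1 this).symm
  let b : Z →ₗ[R] K :=
    { toFun := fun z => t' (sq z)
      map_add' := fun x y => by
        rw [hb (x+y) (sx x + sx y) (sq x + sq y), map_add]
        nth_rw 1 [hs x, hs y]; simp only [map_add]; abel
      map_smul' := fun r y => by
        rw [hb (r • y) (r • sx y) (r • sq y), map_smul]; rfl
        nth_rw 1 [hs y]; simp only [map_smul, smul_add] }
  have hbac : ∀ x q, b (a x + c q) = t' q := fun x q => hb _ x q rfl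
  refine ⟨Z, c, d, a, b, hcd, ⟨?_, ?_, ?_⟩, haf, hda, ?_⟩
  · rw [injective_iff_map_eq_zero]
    intro x hx
    obtain ⟨y, h1, h2⟩ := hun x 0 (by simp [hx])
    have : y = 0 := h'.inj (by rw [map_zero, ← neg_eq_zero, ← h2])
    rw [h1, this, map_zero]
  · intro k
    obtain ⟨q, rfl⟩ := h'.surj k
    exact ⟨c q, by simpa using hbac 0 q⟩
  · intro z
    constructor
    · intro hz
      obtain ⟨y, hy⟩ := (h'.ex _).1 hz
      refine ⟨sx z + f y, ?_⟩
      conv_rhs => rw [hs z, ← hy]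
      rw [map_add]
      congr 1
      exact LinearMap.congr_fun haf y
    · rintro ⟨x, rfl⟩
      simpa using hbac x 0
  · ext q; simpa using hbac 0 q

theorem res_syz (hP : Resolving R P) {n : ℕ} {f : K →ₗ[R] Q} {g : Q →ₗ[R] A} (h : SES f g)
    (hQ : Module.Projective R Q) (hA : ResDimLE R P (n+1) (.of R A)) :
    ResDimLE R P n (.of R K) := by
  induction n with
  | zero =>
    rcases Paper.ResDimLE.exists_ses hA with hA | ⟨Y, X, i, w, hfg, hX, hk⟩
    · exact hP.kere h (hP.proj _ hQ) hA
    · obtain ⟨Z, a, b, c, d, hab, hcd, -⟩ := hfg.pull2 h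
      obtain ⟨e⟩ := hab.split_proj hQ
      exact res_ker_P hP hcd ((res_prod hP hk (hP.proj _ hQ)).iso hP.iso e) hX
  | succ n ih =>
    rcases Paper.ResDimLE.exists_ses hA with hA | ⟨Y, X, i, w, hfg, hX, hk⟩
    · exact (ih hA).succ
    · obtain ⟨Z, a, b, c, d, hab, hcd, -⟩ := hfg.pull2 h
      obtain ⟨e⟩ := hab.split_proj hQ
      exact res_ker_P hP hcd ((res_prod hP hk (hP.proj _ hQ)).iso hP.iso e) hX

theorem SES.horseshoe {W V : Type u} [AddCommGroup W] [Module R W] [AddCommGroup V] [Module R V]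
    {f : A →ₗ[R] B} {g : B →ₗ[R] C} (h : SES f g)
    (p : W →ₗ[R] A) (hp : Function.Surjective p) (q : V →ₗ[R] C) (hq : Function.Surjective q)
    (hV : Module.Projective R V) :
    ∃ (r : W × V →ₗ[R] B) (a : LinearMap.ker p →ₗ[R] LinearMap.ker r)
      (b : LinearMap.ker r →ₗ[R] LinearMap.ker q), Function.Surjective r ∧ SES a b := by
  obtain ⟨s, hs⟩ := Module.projective_lifting_property g q h.surj
  have hs' : ∀ c, g (s c) = q c := fun c => LinearMap.congr_fun hs c
  let r : W × V →ₗ[R] B := (f.comp p).coprod s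
  have hr : ∀ w v, r (w, v) = f (p w) + s v := fun w v => by simp [r]
  refine ⟨r, ((LinearMap.inl R W V).comp (Submodule.subtype _)).codRestrict _ ?_,
    ((LinearMap.snd R W V).comp (Submodule.subtype _)).codRestrict _ ?_, ?_, ⟨?_, ?_, ?_⟩⟩
  · rintro ⟨w, hw⟩
    simp [r, LinearMap.mem_ker.1 hw]
  · rintro ⟨⟨w, v⟩, hwv⟩
    rw [LinearMap.mem_ker, hr] at hwv
    have := congrArg g hwv
    simpa [h.gf, hs'] using this
  · intro b
    obtain ⟨v, hv⟩ := hq (g b)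
    obtain ⟨a, ha⟩ := (h.ex (b - s v)).1 (by simp [hs', hv])
    obtain ⟨w, rfl⟩ := hp a
    exact ⟨(w, v), by simp [hr, ha]⟩
  · intro x y hxy
    exact Subtype.ext (congrArg (fun z : LinearMap.ker r => z.1.1) hxy)
  · rintro ⟨v, hv⟩
    have : g (s v) = 0 := by rw [hs']; exact hv
    obtain ⟨a, ha⟩ := (h.ex _).1 this
    obtain ⟨w, rfl⟩ := hp a
    exact ⟨⟨(-w, v), by simp [r, ha]⟩, rfl⟩
  · rintro ⟨⟨w, v⟩, hwv⟩
    rw [LinearMap.mem_ker, hr] at hwv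
    constructor
    · intro hz
      have hv : v = 0 := congrArg Subtype.val hz
      subst hv
      refine ⟨⟨w, ?_⟩, rfl⟩
      apply h.inj
      simpa using hwv
    · rintro ⟨y, hy⟩
      have := congrArg (fun z : LinearMap.ker r => z.1.2) hy
      exact Subtype.ext this.symm

theorem exists_free_cover (A : Type u) [AddCommGroup A] [Module R A] :
    ∃ p : (A →₀ R) →ₗ[R] A, Function.Surjective p :=
  ⟨Finsupp.linearCombination R id, Finsupp.linearCombination_id_surjective R A⟩

theorem res_ker (hP : Resolving R P) {n : ℕ} {f : A →ₗ[R] B} {g : B →ₗ[R] C} (h : SES f g)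
    (hB : ResDimLE R P n (.of R B)) (hC : ResDimLE R P n (.of R C)) :
    ResDimLE R P n (.of R A) := by
  induction n generalizing A B C with
  | zero => exact hP.kere h hB hC
  | succ n ih =>
    obtain ⟨p, hp⟩ := exists_free_cover (R := R) A
    obtain ⟨q, hq⟩ := exists_free_cover (R := R) C
    obtain ⟨r, a, b, hr, hab⟩ := h.horseshoe p hp q hq inferInstance
    have h1 := res_syz hP (SES.of_ker q hq) inferInstance hC
    have h2 := res_syz hP (SES.of_ker r hr) inferInstance hB
    exact ResDimLE.cons hP.iso (SES.of_ker p hp) (hP.proj _ inferInstance) (ih hab h2 h1)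
end B1
end FileB1

section FileC1
open CategoryTheory IsLocalRing Paper

def GPs (R : Type u) [CommRing R] (S : ModuleCat.{u} R → Prop) : Prop :=
  ∀ G : ModuleCat.{u} R, S G →
    (∀ Q : ModuleCat.{u} R, Module.Projective R Q → ∀ i, ExtV R G Q (i+1)) ∧
    ∃ (P G' : ModuleCat.{u} R) (f : G →ₗ[R] P) (g : P →ₗ[R] G'),
      Module.Projective R P ∧ SES f g ∧ S G'

def GPc (R : Type u) [CommRing R] (N : ModuleCat.{u} R) : Prop := ∃ S, GPs R S ∧ S N

def GIs (R : Type u) [CommRing R] (S : ModuleCat.{u} R → Prop) : Prop :=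
  ∀ G : ModuleCat.{u} R, S G →
    (∀ I : ModuleCat.{u} R, Module.Injective R I → ∀ i, ExtV R I G (i+1)) ∧
    ∃ (E G' : ModuleCat.{u} R) (f : G' →ₗ[R] E) (g : E →ₗ[R] G),
      Module.Injective R E ∧ SES f g ∧ S G'

def GIc (R : Type u) [CommRing R] (N : ModuleCat.{u} R) : Prop := ∃ S, GIs R S ∧ S N

section C1
variable {R : Type u} [CommRing R] {A B C Q K : Type u} [AddCommGroup A] [Module R A]
    [AddCommGroup B] [Module R B] [AddCommGroup C] [Module R C]
    [AddCommGroup Q] [Module R Q] [AddCommGroup K] [Module R K]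

theorem gpc_gps : GPs R (GPc R) := by
  rintro G ⟨S, hS, hG⟩
  obtain ⟨h1, P, G', f, g, h2, h3, h4⟩ := hS G hG
  exact ⟨h1, P, G', f, g, h2, h3, S, hS, h4⟩

theorem GPc.intro {f : A →ₗ[R] B} {g : B →ₗ[R] C} (h : SES f g)
    (hA : ∀ Q : ModuleCat.{u} R, Module.Projective R Q → ∀ i, ExtV R A Q (i+1))
    (hB : Module.Projective R B) (hC : GPc R (.of R C)) : GPc R (.of R A) := by
  refine ⟨fun G => GPc R G ∨ G = .of R A, ?_, Or.inr rfl⟩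
  rintro G (hG | rfl)
  · obtain ⟨h1, P, G', f, g, h2, h3, h4⟩ := gpc_gps G hG
    exact ⟨h1, P, G', f, g, h2, h3, Or.inl h4⟩
  · exact ⟨hA, .of R B, .of R C, f, g, hB, h, Or.inl hC⟩

theorem gic_gis : GIs R (GIc R) := by
  rintro G ⟨S, hS, hG⟩
  obtain ⟨h1, P, G', f, g, h2, h3, h4⟩ := hS G hG
  exact ⟨h1, P, G', f, g, h2, h3, S, hS, h4⟩

theorem GIc.intro {f : A →ₗ[R] B} {g : B →ₗ[R] C} (h : SES f g)
    (hA : ∀ Q : ModuleCat.{u} R, Module.Injective R Q → ∀ i, ExtV R Q C (i+1))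
    (hB : Module.Injective R B) (hC : GIc R (.of R A)) : GIc R (.of R C) := by
  refine ⟨fun G => GIc R G ∨ G = .of R C, ?_, Or.inr rfl⟩
  rintro G (hG | rfl)
  · obtain ⟨h1, P, G', f, g, h2, h3, h4⟩ := gic_gis G hG
    exact ⟨h1, P, G', f, g, h2, h3, Or.inl h4⟩
  · exact ⟨hA, .of R B, .of R A, f, g, hB, h, Or.inl hC⟩

theorem gpc_iso (e : A ≃ₗ[R] B) (h : GPc R (.of R A)) : GPc R (.of R B) := by
  obtain ⟨h1, P, G', f, g, h2, h3, h4⟩ := gpc_gps _ h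
  exact GPc.intro (h3.trans_equiv_left e.symm) (fun Q hQ i => (h1 Q hQ i).congr_left e) h2 h4

theorem gic_iso (e : A ≃ₗ[R] B) (h : GIc R (.of R A)) : GIc R (.of R B) := by
  obtain ⟨h1, P, G', f, g, h2, h3, h4⟩ := gic_gis _ h
  exact GIc.intro (h3.trans_equiv_right e) (fun Q hQ i => (h1 Q hQ i).congr_right e) h2 h4

theorem gpc_proj (A : Type u) [AddCommGroup A] [Module R A] (h : Module.Projective R A) :
    GPc R (.of R A) :=
  ⟨fun G => Module.Projective R G, fun G hG => ⟨fun Q _ i => extV_proj hG i,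
    G, .of R PUnit, LinearMap.id, 0, hG, SES.of_equiv (LinearEquiv.refl R G), inferInstance⟩, h⟩

theorem SES.of_equiv' (e : A ≃ₗ[R] B) : SES (0 : PUnit.{u+1} →ₗ[R] A) (e : A →ₗ[R] B) :=
  ⟨fun _ _ _ => rfl, e.surjective, fun y => by
    simp [eq_comm (a := (0 : A))]⟩

theorem injective_punit : Module.Injective R PUnit.{u+1} :=
  ⟨fun _ _ _ _ _ _ _ _ _ => ⟨0, fun _ => rfl⟩⟩

theorem gic_inj (A : Type u) [AddCommGroup A] [Module R A] (h : Module.Injective R A) :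
    GIc R (.of R A) :=
  ⟨fun G => Module.Injective R G, fun G hG => ⟨fun Q _ i => extV_inj hG i,
    G, .of R PUnit, 0, LinearMap.id, hG, SES.of_equiv' (LinearEquiv.refl R G), injective_punit⟩, h⟩

theorem SES.horseshoe' {W V : Type u} [AddCommGroup W] [Module R W] [AddCommGroup V] [Module R V]
    {f : A →ₗ[R] B} {g : B →ₗ[R] C} (h : SES f g)
    (p : W →ₗ[R] A) (hp : Function.Surjective p) (q : V →ₗ[R] C) (hq : Function.Surjective q)
    (s : V →ₗ[R] B) (hs : g.comp s = q) :
    ∃ (r : W × V →ₗ[R] B) (a : LinearMap.ker p →ₗ[R] LinearMap.ker r)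
      (b : LinearMap.ker r →ₗ[R] LinearMap.ker q), Function.Surjective r ∧ SES a b := by
  have hs' : ∀ c, g (s c) = q c := fun c => LinearMap.congr_fun hs c
  let r : W × V →ₗ[R] B := (f.comp p).coprod s
  have hr : ∀ w v, r (w, v) = f (p w) + s v := fun w v => by simp [r]
  refine ⟨r, ((LinearMap.inl R W V).comp (Submodule.subtype _)).codRestrict _ ?_,
    ((LinearMap.snd R W V).comp (Submodule.subtype _)).codRestrict _ ?_, ?_, ⟨?_, ?_, ?_⟩⟩
  · rintro ⟨w, hw⟩
    simp [r, LinearMap.mem_ker.1 hw]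
  · rintro ⟨⟨w, v⟩, hwv⟩
    rw [LinearMap.mem_ker, hr] at hwv
    have := congrArg g hwv
    simpa [h.gf, hs'] using this
  · intro b
    obtain ⟨v, hv⟩ := hq (g b)
    obtain ⟨a, ha⟩ := (h.ex (b - s v)).1 (by simp [hs', hv])
    obtain ⟨w, rfl⟩ := hp a
    exact ⟨(w, v), by simp [hr, ha]⟩
  · intro x y hxy
    exact Subtype.ext (congrArg (fun z : LinearMap.ker r => z.1.1) hxy)
  · rintro ⟨v, hv⟩
    have : g (s v) = 0 := by rw [hs']; exact hv
    obtain ⟨a, ha⟩ := (h.ex _).1 this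
    obtain ⟨w, rfl⟩ := hp a
    exact ⟨⟨(-w, v), by simp [r, ha]⟩, rfl⟩
  · rintro ⟨⟨w, v⟩, hwv⟩
    rw [LinearMap.mem_ker, hr] at hwv
    constructor
    · intro hz
      have hv : v = 0 := congrArg Subtype.val hz
      subst hv
      refine ⟨⟨w, ?_⟩, rfl⟩
      apply h.inj
      simpa using hwv
    · rintro ⟨y, hy⟩
      have := congrArg (fun z : LinearMap.ker r => z.1.2) hy
      exact Subtype.ext this.symm

theorem SES.cohorseshoe {W V : Type u} [AddCommGroup W] [Module R W] [AddCommGroup V] [Module R V]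
    {f : A →ₗ[R] B} {g : B →ₗ[R] C} (h : SES f g)
    (p : A →ₗ[R] W) (hp : Function.Injective p) (q : C →ₗ[R] V) (hq : Function.Injective q)
    (s : B →ₗ[R] W) (hs : s.comp f = p) :
    ∃ (r : B →ₗ[R] W × V) (a : (W ⧸ LinearMap.range p) →ₗ[R] ((W × V) ⧸ LinearMap.range r))
      (b : ((W × V) ⧸ LinearMap.range r) →ₗ[R] (V ⧸ LinearMap.range q)),
      Function.Injective r ∧ SES a b := by
  have hs' : ∀ c, s (f c) = p c := fun c => LinearMap.congr_fun hs c
  let r : B →ₗ[R] W × V := s.prod (q.comp g)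
  have hr : ∀ b, r b = (s b, q (g b)) := fun b => rfl
  refine ⟨r, (LinearMap.range p).mapQ _ (LinearMap.inl R W V) ?_,
    (LinearMap.range r).mapQ _ (LinearMap.snd R W V) ?_, ?_, ⟨?_, ?_, ?_⟩⟩
  · rintro _ ⟨a, rfl⟩
    exact ⟨f a, by simp [hr, hs', h.gf]⟩
  · rintro _ ⟨b, rfl⟩
    exact ⟨g b, rfl⟩
  · rw [injective_iff_map_eq_zero]
    intro b hb
    rw [hr, Prod.mk_eq_zero] at hb
    have : g b = 0 := hq (by simp [hb.2])
    obtain ⟨a, rfl⟩ := (h.ex b).1 this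
    have : a = 0 := hp (by rw [← hs', hb.1, map_zero])
    rw [this, map_zero]
  · rw [injective_iff_map_eq_zero]
    intro z hz
    obtain ⟨w, rfl⟩ := Submodule.mkQ_surjective _ z
    rw [Submodule.mkQ_apply, Submodule.mapQ_apply, Submodule.Quotient.mk_eq_zero] at hz
    obtain ⟨b, hb⟩ := hz
    rw [hr] at hb
    have h2 : q (g b) = 0 := congrArg Prod.snd hb
    have h1 : s b = w := congrArg Prod.fst hb
    have : g b = 0 := hq (by simp [h2])
    obtain ⟨a, rfl⟩ := (h.ex b).1 this
    rw [Submodule.mkQ_apply, Submodule.Quotient.mk_eq_zero]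
    exact ⟨a, by rw [← hs', h1]⟩
  · intro z
    obtain ⟨v, rfl⟩ := Submodule.mkQ_surjective _ z
    exact ⟨Submodule.Quotient.mk (0, v), rfl⟩
  · intro z
    obtain ⟨⟨w, v⟩, rfl⟩ := Submodule.mkQ_surjective _ z
    constructor
    · intro hz
      rw [Submodule.mkQ_apply, Submodule.mapQ_apply, Submodule.Quotient.mk_eq_zero] at hz
      obtain ⟨c, hc⟩ := hz
      obtain ⟨b, rfl⟩ := h.surj c
      refine ⟨Submodule.Quotient.mk (w - s b), ?_⟩
      rw [Submodule.mapQ_apply, Submodule.mkQ_apply, ← sub_eq_zero, ← Submodule.Quotient.mk_sub,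
        Submodule.Quotient.mk_eq_zero]
      refine ⟨-b, ?_⟩
      have hc : q (g b) = v := hc
      rw [hr]; simp [hc]
    · rintro ⟨y, hy⟩
      obtain ⟨w', rfl⟩ := Submodule.mkQ_surjective _ y
      rw [← hy]
      rw [Submodule.mkQ_apply, Submodule.mapQ_apply, Submodule.mapQ_apply]
      simp

theorem gpc_extn {f : A →ₗ[R] B} {g : B →ₗ[R] C} (h : SES f g)
    (hA : GPc R (.of R A)) (hC : GPc R (.of R C)) : GPc R (.of R B) := by
  refine ⟨fun B => ∃ (A C : ModuleCat.{u} R) (f : A →ₗ[R] B) (g : B →ₗ[R] C), SES f g ∧ GPc R A ∧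
    GPc R C, ?_, .of R A, .of R C, f, g, h, hA, hC⟩
  rintro B ⟨A, C, f, g, h, hA, hC⟩
  obtain ⟨a1, PA, A', iA, pA, aP, aS, aG⟩ := gpc_gps _ hA
  obtain ⟨c1, PC, C', iC, pC, cP, cS, cG⟩ := gpc_gps _ hC
  refine ⟨fun Q hQ i => h.con2 (a1 Q hQ i) (c1 Q hQ i), ?_⟩
  obtain ⟨s, hs⟩ := h.ext (c1 PA aP 0) iA
  obtain ⟨r, a, b, hr, hab⟩ := h.cohorseshoe iA aS.inj iC cS.inj s hs
  refine ⟨.of R (PA × PC), .of R _, r, (LinearMap.range r).mkQ, inferInstance, SES.of_range r hr,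
    .of R _, .of R _, a, b, hab, gpc_iso aS.quotEquiv.symm aG, gpc_iso cS.quotEquiv.symm cG⟩

theorem injective_prod (hA : Module.Injective R A) (hB : Module.Injective R B) :
    Module.Injective R (A × B) := by
  refine ⟨fun X Y _ _ _ _ f hf g => ?_⟩
  obtain ⟨a, ha⟩ := hA.out f hf ((LinearMap.fst R A B).comp g)
  obtain ⟨b, hb⟩ := hB.out f hf ((LinearMap.snd R A B).comp g)
  exact ⟨a.prod b, fun x => Prod.ext (ha x) (hb x)⟩

theorem gic_extn {f : A →ₗ[R] B} {g : B →ₗ[R] C} (h : SES f g)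
    (hA : GIc R (.of R A)) (hC : GIc R (.of R C)) : GIc R (.of R B) := by
  refine ⟨fun B => ∃ (A C : ModuleCat.{u} R) (f : A →ₗ[R] B) (g : B →ₗ[R] C), SES f g ∧ GIc R A ∧
    GIc R C, ?_, .of R A, .of R C, f, g, h, hA, hC⟩
  rintro B ⟨A, C, f, g, h, hA, hC⟩
  obtain ⟨a1, PA, A', iA, pA, aP, aS, aG⟩ := gic_gis _ hA
  obtain ⟨c1, PC, C', iC, pC, cP, cS, cG⟩ := gic_gis _ hC
  refine ⟨fun Q hQ i => h.cov2 (a1 Q hQ i) (c1 Q hQ i), ?_⟩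
  obtain ⟨s, hs⟩ := h.lift (a1 PC cP 0) pC
  obtain ⟨r, a, b, hr, hab⟩ := h.horseshoe' pA aS.surj pC cS.surj s hs
  refine ⟨.of R (PA × PC), .of R _, (LinearMap.ker r).subtype, r, injective_prod aP cP,
    SES.of_ker r hr, .of R _, .of R _, a, b, hab, gic_iso aS.kerEquiv aG, gic_iso cS.kerEquiv cG⟩

theorem gpc_kere {f : A →ₗ[R] B} {g : B →ₗ[R] C} (h : SES f g)
    (hB : GPc R (.of R B)) (hC : GPc R (.of R C)) : GPc R (.of R A) := by
  obtain ⟨b1, PB, B', iB, pB, bP, bS, bG⟩ := gpc_gps _ hB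
  obtain ⟨c1, -⟩ := gpc_gps _ hC
  obtain ⟨Z, c, d, a, hcd, haf, hda, hex, hun⟩ := bS.push1 g
  have hZ : GPc R Z := gpc_extn hcd hC bG
  refine GPc.intro (f := iB.comp f) (g := a) ⟨bS.inj.comp h.inj, ?_, ?_⟩
    (fun Q hQ i => h.con1 (b1 Q hQ i) (c1 Q hQ (i+1))) bP hZ
  · intro z
    obtain ⟨x, q, rfl⟩ := hex z
    obtain ⟨b, rfl⟩ := h.surj q
    refine ⟨x + iB b, ?_⟩
    rw [map_add]; congr 1; exact LinearMap.congr_fun haf b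
  · intro x
    constructor
    · intro hx
      obtain ⟨y, h1, h2⟩ := hun x 0 (by simp [hx])
      obtain ⟨w, rfl⟩ := (h.ex y).1 (by rw [← neg_eq_zero, ← h2])
      exact ⟨w, h1.symm⟩
    · rintro ⟨y, rfl⟩
      have := LinearMap.congr_fun haf (f y)
      simp only [LinearMap.comp_apply, h.gf, map_zero] at this ⊢
      exact this

theorem gic_coke {f : A →ₗ[R] B} {g : B →ₗ[R] C} (h : SES f g)
    (hA : GIc R (.of R A)) (hB : GIc R (.of R B)) : GIc R (.of R C) := by
  obtain ⟨b1, PB, B', iB, pB, bP, bS, bG⟩ := gic_gis _ hB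
  obtain ⟨a1, -⟩ := gic_gis _ hA
  obtain ⟨p, q, hpq, -, -⟩ := h.pull pB bS.surj
  have hZ := gic_extn hpq (gic_iso bS.kerEquiv bG) hA
  exact GIc.intro (SES.of_ker (g.comp pB) (h.surj.comp bS.surj))
    (fun Q hQ i => h.cov3 (b1 Q hQ i) (a1 Q hQ (i+1))) bP hZ

theorem gpc_resolving : Resolving R (GPc R) := ⟨gpc_iso, gpc_proj, gpc_extn, gpc_kere⟩

theorem SES.split_retr {c : A →ₗ[R] B} {d : B →ₗ[R] C} (h : SES c d) (ρ : B →ₗ[R] A)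
    (hρ : ρ.comp c = LinearMap.id) : ∃ σ : C →ₗ[R] B, SES σ ρ := by
  have hρ' : ∀ a, ρ (c a) = a := fun a => LinearMap.congr_fun hρ a
  have hb : ∀ x y, d x = d y → x - c (ρ x) = y - c (ρ y) := by
    intro x y hxy
    obtain ⟨a, ha⟩ := (h.ex (x - y)).1 (by simp [hxy])
    have hx : x = y + c a := by rw [ha]; abel
    rw [hx]; simp only [map_add, hρ']; abel
  choose s hs using h.surj
  let σ : C →ₗ[R] B :=
    { toFun := fun x => s x - c (ρ (s x))
      map_add' := fun x y => by
        rw [hb (s (x+y)) (s x + s y) (by simp [hs])]; simp only [map_add]; abel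
      map_smul' := fun r y => by
        rw [hb (s (r • y)) (r • s y) (by simp [hs])]; simp [smul_sub] }
  have hσ : ∀ b, σ (d b) = b - c (ρ b) := fun b => hb _ _ (hs _)
  have hdσ : ∀ x, d (σ x) = x := fun x => by
    obtain ⟨b, rfl⟩ := h.surj x
    rw [hσ, map_sub, h.gf, sub_zero]
  refine ⟨σ, ⟨fun x y hxy => by rw [← hdσ x, ← hdσ y, hxy], fun a => ⟨c a, hρ' a⟩, ?_⟩⟩
  intro b
  constructor
  · intro hb
    exact ⟨d b, by rw [hσ, hb]; simp⟩
  · rintro ⟨x, rfl⟩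
    obtain ⟨b, rfl⟩ := h.surj x
    rw [hσ, map_sub, hρ', sub_self]

theorem SES.split_sect {c : A →ₗ[R] B} {d : B →ₗ[R] C} (h : SES c d) (σ : C →ₗ[R] B)
    (hσ : d.comp σ = LinearMap.id) : ∃ ρ : B →ₗ[R] A, SES σ ρ ∧ ρ.comp c = LinearMap.id := by
  have hσ' : ∀ a, d (σ a) = a := fun a => LinearMap.congr_fun hσ a
  have : ∀ b, ∃ a, c a = b - σ (d b) := fun b => (h.ex _).1 (by simp [hσ'])
  choose r hr using this
  let ρ : B →ₗ[R] A :=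
    { toFun := r
      map_add' := fun x y => h.inj (by simp only [hr, map_add]; abel)
      map_smul' := fun t y => h.inj (by simp [hr, smul_sub]) }
  refine ⟨ρ, ⟨fun x y hxy => by rw [← hσ' x, ← hσ' y, hxy], fun a => ⟨c a, h.inj ?_⟩, ?_⟩, ?_⟩
  · exact (hr _).trans (by simp [h.gf])
  · intro b
    constructor
    · intro hb
      have := hr b
      rw [show r b = 0 from hb, map_zero] at this
      exact ⟨d b, (sub_eq_zero.1 this.symm).symm⟩
    · rintro ⟨x, rfl⟩
      apply h.inj
      refine (hr _).trans ?_
      simp [hσ']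
  · ext a
    apply h.inj
    exact (hr _).trans (by simp [h.gf])

/-- Gorenstein projective modules belong to `GPc`. -/
theorem gpc_of_isGorensteinProjective (h : IsGorensteinProjective R A) : GPc R (.of R A) := by
  obtain ⟨X, d, hX, hex, hQ, π, hπ, hπe⟩ := h
  have ses : ∀ j, SES (LinearMap.range (d j)).subtype (d (j+1)).rangeRestrict := fun j =>
    ⟨Subtype.val_injective, LinearMap.surjective_rangeRestrict _, fun x => by
      rw [← LinearMap.mem_ker, LinearMap.ker_rangeRestrict, LinearMap.mem_ker, hex j x]
      simp⟩
  have hext : ∀ Q : ModuleCat.{u} R, Module.Projective R Q → ∀ i j,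
      ExtV R (LinearMap.range (d j)) Q (i+1) := by
    intro Q hQ' i
    induction i with
    | zero =>
      intro j
      obtain ⟨k, rfl⟩ : ∃ k, j = k + 1 + 1 := ⟨j - 1 - 1, by ring⟩
      refine (ses (k+1)).of_ext (extV_proj (hX _) 0) fun φ => ?_
      obtain ⟨h, hh⟩ := hQ Q hQ' k (φ.comp (d (k+1)).rangeRestrict) (by
        ext x
        have : (d (k+1)).rangeRestrict (d k x) = 0 :=
          Subtype.ext ((hex k).apply_apply_eq_zero x)
        simp [this])
      refine ⟨h, ?_⟩
      ext ⟨_, x, rfl⟩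
      exact LinearMap.congr_fun hh x
    | succ i ih =>
      intro j
      obtain ⟨k, rfl⟩ : ∃ k, j = k + 1 := ⟨j - 1, by ring⟩
      exact (ses k).con3 (ih k) (extV_proj (hX _) _)
  have main : GPc R (.of R (LinearMap.range (d 0))) := by
    refine ⟨fun G => ∃ j, G = .of R (LinearMap.range (d j)), ?_, 0, rfl⟩
    rintro G ⟨j, rfl⟩
    exact ⟨fun Q hQ' i => hext Q hQ' i j, X (j+1), .of R _, _, _, hX _, ses j, j+1, rfl⟩
  have hex0 : Function.Exact (d (-1)) (d 0) := hex (-1)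
  have hk : LinearMap.ker (d 0) = LinearMap.ker π := by
    ext x
    rw [LinearMap.mem_ker, LinearMap.mem_ker, hex0 x]
    exact (hπe x).symm
  exact gpc_iso (((d 0).quotKerEquivRange.symm.trans (Submodule.quotEquivOfEq _ _ hk)).trans
    (π.quotKerEquivOfSurjective hπ)) main
end C1
end FileC1

section FileA2
open CategoryTheory IsLocalRing Paper TensorProduct
section A2
variable {R : Type u} [CommRing R] {A B C : Type u} [AddCommGroup A] [Module R A]
    [AddCommGroup B] [Module R B] [AddCommGroup C] [Module R C]

noncomputable def tev (R : Type u) [CommRing R] (A B : Type u) [AddCommGroup A] [Module R A]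
    [AddCommGroup B] [Module R B] : A ⊗[R] CharacterModule B →ₗ[R] CharacterModule (A →ₗ[R] B) :=
  TensorProduct.lift (LinearMap.mk₂ R
    (fun (a : A) (c : CharacterModule B) =>
      (CharacterModule.dual (LinearMap.applyₗ a : (A →ₗ[R] B) →ₗ[R] B) c))
    (fun a a' c => by
      refine DFunLike.ext _ _ fun h => ?_
      change c (h (a + a')) = c (h a) + c (h a'); rw [map_add, map_add])
    (fun r a c => by
      refine DFunLike.ext _ _ fun h => ?_
      change c (h (r • a)) = c ((r • h) a); simp)
    (fun a c c' => map_add _ _ _)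
    (fun r a c => map_smul _ _ _))

theorem tev_tmul (a : A) (c : CharacterModule B) (h : A →ₗ[R] B) : tev R A B (a ⊗ₜ c) h = c (h a) :=
  rfl

theorem tev_nat (f : A →ₗ[R] C) (t : A ⊗[R] CharacterModule B) :
    tev R C B (f.rTensor _ t) = CharacterModule.dual (LinearMap.lcomp R B f) (tev R A B t) := by
  induction t with
  | zero => rw [map_zero, map_zero, map_zero, map_zero]
  | add x y hx hy => simp only [map_add, hx, hy]
  | tmul a c => rfl

theorem tev_free (n : ℕ) : Function.Bijective (tev R (Fin n → R) B) := by
  constructor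
  · have hall : ∀ t : (Fin n → R) ⊗[R] CharacterModule B, ∃ c : Fin n → CharacterModule B,
        t = ∑ i, (Pi.single i (1 : R) : Fin n → R) ⊗ₜ c i := by
      intro t
      induction t with
      | zero => exact ⟨0, by simp⟩
      | add x y hx hy =>
        obtain ⟨c, rfl⟩ := hx
        obtain ⟨c', rfl⟩ := hy
        exact ⟨c + c', by simp [tmul_add, Finset.sum_add_distrib]⟩
      | tmul a c =>
        refine ⟨fun i => a i • c, ?_⟩
        conv_lhs => rw [pi_eq_sum_univ' a, sum_tmul]
        refine Finset.sum_congr rfl fun i _ => ?_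
        rw [← smul_tmul]
    rw [injective_iff_map_eq_zero]
    intro t ht
    obtain ⟨c, rfl⟩ := hall t
    have : ∀ i, c i = 0 := by
      intro i
      refine DFunLike.ext _ _ fun b => ?_
      have h1 := DFunLike.congr_fun ht ((LinearMap.toSpanSingleton R B b).comp (LinearMap.proj i))
      rw [map_sum] at h1
      have h2 : ∀ (s : Finset (Fin n)) (F : Fin n → CharacterModule ((Fin n → R) →ₗ[R] B)) x,
        (∑ i ∈ s, F i) x = ∑ i ∈ s, F i x := fun s F x => by
          exact map_sum (AddMonoidHom.eval x) F s
      rw [h2] at h1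
      simp only [tev_tmul] at h1
      rw [Finset.sum_eq_single i] at h1
      · simp only [LinearMap.comp_apply, LinearMap.proj_apply, Pi.single_eq_same,
          LinearMap.toSpanSingleton_apply, one_smul] at h1
        exact h1
      · intro j _ hj
        simp [hj.symm]
      · simp
    simp [this]
  · intro ψ
    let co : Fin n → B →ₗ[R] ((Fin n → R) →ₗ[R] B) := fun i =>
      { toFun := fun b => (LinearMap.toSpanSingleton R B b).comp (LinearMap.proj i)
        map_add' := fun x y => by ext; simp
        map_smul' := fun r y => by
          refine LinearMap.ext fun v => ?_
          change v i • (r • y) = r • (v i • y); exact smul_comm _ _ _ }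
    refine ⟨∑ i, (Pi.single i (1 : R) : Fin n → R) ⊗ₜ CharacterModule.dual (co i) ψ, ?_⟩
    refine DFunLike.ext _ _ fun h => ?_
    rw [map_sum]
    have h2 : ∀ (s : Finset (Fin n)) (F : Fin n → CharacterModule ((Fin n → R) →ₗ[R] B)) x,
        (∑ i ∈ s, F i) x = ∑ i ∈ s, F i x := fun s F x => by
          exact map_sum (AddMonoidHom.eval x) F s
    rw [h2]
    simp only [tev_tmul]
    change ∑ i, ψ (co i (h (Pi.single i 1))) = ψ h
    rw [← map_sum]
    congr 1
    refine LinearMap.ext fun v => ?_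
    rw [LinearMap.sum_apply]
    conv_rhs => rw [pi_eq_sum_univ' v, map_sum]
    simp [co]

theorem dual_exact {f : A →ₗ[R] B} {g : B →ₗ[R] C} (h : Function.Exact f g) :
    Function.Exact (CharacterModule.dual g) (CharacterModule.dual f) := by
  intro c
  constructor
  · intro hc
    have hc' : ∀ a, c (f a) = 0 := fun a => DFunLike.congr_fun hc a
    -- factor through range of g
    have hle : LinearMap.ker g.toAddMonoidHom.toIntLinearMap ≤
        LinearMap.ker (AddMonoidHom.toIntLinearMap c) := by
      intro b hb
      obtain ⟨a, rfl⟩ := (h b).1 hb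
      exact hc' a
    let c1 : CharacterModule (LinearMap.range g) :=
      ((Submodule.liftQ _ (AddMonoidHom.toIntLinearMap c) hle).comp
        (g.toAddMonoidHom.toIntLinearMap.quotKerEquivRange.symm.toLinearMap)).toAddMonoidHom
    have hc1 : ∀ b, c1 ⟨g b, b, rfl⟩ = c b := by
      intro b
      change (Submodule.liftQ _ (AddMonoidHom.toIntLinearMap c) hle)
        (g.toAddMonoidHom.toIntLinearMap.quotKerEquivRange.symm ⟨g b, b, rfl⟩) = c b
      have : g.toAddMonoidHom.toIntLinearMap.quotKerEquivRange.symm ⟨g b, b, rfl⟩ =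
          Submodule.Quotient.mk b := by
        rw [LinearEquiv.symm_apply_eq]; rfl
      rw [this]; rfl
    obtain ⟨e, he⟩ := CharacterModule.dual_surjective_of_injective (LinearMap.range g).subtype
      Subtype.val_injective c1
    refine ⟨e, DFunLike.ext _ _ fun b => ?_⟩
    rw [← hc1, ← he]; rfl
  · rintro ⟨e, rfl⟩
    refine DFunLike.ext _ _ fun a => ?_
    change e (g (f a)) = 0
    rw [h.apply_apply_eq_zero]; exact map_zero e

theorem SES.dual {f : A →ₗ[R] B} {g : B →ₗ[R] C} (h : SES f g) :
    SES (CharacterModule.dual g) (CharacterModule.dual f) :=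
  ⟨CharacterModule.dual_injective_of_surjective g h.surj,
    CharacterModule.dual_surjective_of_injective f h.inj, dual_exact h.ex⟩

theorem tev_bij [IsNoetherianRing R] [Module.Finite R A] : Function.Bijective (tev R A B) := by
  obtain ⟨n, g, hg⟩ := Module.Finite.exists_fin' R A
  obtain ⟨m, f0, hf0⟩ := Module.Finite.exists_fin' R (LinearMap.ker g)
  let f : (Fin m → R) →ₗ[R] (Fin n → R) := (LinearMap.ker g).subtype.comp f0
  have hfg : Function.Exact f g := fun x => by
    constructor
    · intro hx
      obtain ⟨y, hy⟩ := hf0 ⟨x, hx⟩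
      exact ⟨y, by simp [f, hy]⟩
    · rintro ⟨y, rfl⟩
      exact (f0 y).2
  have hom_ex : Function.Exact (LinearMap.lcomp R B g) (LinearMap.lcomp R B f) := by
    intro φ
    constructor
    · intro hφ
      have h0 : ∀ y, φ (f y) = 0 := fun y => LinearMap.congr_fun hφ y
      have : LinearMap.ker g ≤ LinearMap.ker φ := by
        intro x hx
        obtain ⟨y, rfl⟩ := (hfg x).1 hx
        exact h0 y
      refine ⟨((LinearMap.ker g).liftQ φ this).comp (g.quotKerEquivOfSurjective hg).symm.toLinearMap, ?_⟩
      refine LinearMap.ext fun x => ?_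
      change ((LinearMap.ker g).liftQ φ this) ((g.quotKerEquivOfSurjective hg).symm (g x)) = φ x
      have : (g.quotKerEquivOfSurjective hg).symm (g x) = Submodule.Quotient.mk x := by
        rw [LinearEquiv.symm_apply_eq]; rfl
      rw [this]; rfl
    · rintro ⟨ψ, rfl⟩
      refine LinearMap.ext fun y => ?_
      change ψ (g (f y)) = 0
      rw [hfg.apply_apply_eq_zero, map_zero]
  have hom_inj : Function.Injective (LinearMap.lcomp R B g) := by
    intro φ ψ h
    refine LinearMap.ext fun a => ?_
    obtain ⟨x, rfl⟩ := hg a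
    exact LinearMap.congr_fun h x
  constructor
  · rw [injective_iff_map_eq_zero]
    intro t ht
    obtain ⟨t, rfl⟩ := LinearMap.rTensor_surjective (CharacterModule B) hg t
    rw [tev_nat] at ht
    obtain ⟨s, hs⟩ := (dual_exact hom_ex _).1 ht
    obtain ⟨s, rfl⟩ := (tev_free m).2 s
    rw [← tev_nat] at hs
    have := (tev_free n).1 hs
    rw [← this, ← LinearMap.comp_apply, ← LinearMap.rTensor_comp]
    have : g.comp f = 0 := by ext; simp [hfg.apply_apply_eq_zero]
    rw [this]; simp
  · intro y
    obtain ⟨z, rfl⟩ := CharacterModule.dual_surjective_of_injective _ hom_inj y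
    obtain ⟨s, rfl⟩ := (tev_free n).2 z
    exact ⟨g.rTensor _ s, tev_nat _ _⟩

theorem flat_dual_of_injective [IsNoetherianRing R] (h : Module.Injective R A) :
    Module.Flat R (CharacterModule A) := by
  rw [Module.Flat.iff_rTensor_injective]
  intro I hI
  rw [injective_iff_map_eq_zero]
  intro t ht
  have h1 := tev_nat (B := A) I.subtype t
  rw [ht, map_zero] at h1
  have hs : Function.Surjective (LinearMap.lcomp R A I.subtype) := by
    intro φ
    obtain ⟨ψ, hψ⟩ := h.out I.subtype Subtype.val_injective φ
    exact ⟨ψ, LinearMap.ext hψ⟩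
  have h2 := CharacterModule.dual_injective_of_surjective _ hs (h1.symm.trans (map_zero _).symm)
  exact (injective_iff_map_eq_zero _).1 (tev_bij (A := I) (B := A)).1 t h2
end A2
end FileA2

section FileC2
open CategoryTheory IsLocalRing Paper TensorProduct

def GDc (R : Type u) [CommRing R] (N : ModuleCat.{u} R) : Prop :=
  GIc R (.of R (CharacterModule N))

section C2
variable {R : Type u} [CommRing R] {A B C Q K I : Type u} [AddCommGroup A] [Module R A]
    [AddCommGroup B] [Module R B] [AddCommGroup C] [Module R C]
    [AddCommGroup Q] [Module R Q] [AddCommGroup K] [Module R K] [AddCommGroup I] [Module R I]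

theorem gdc_resolving : Resolving R (GDc R) where
  iso e h := gic_iso (CharacterModule.congr e) h
  proj A _ _ h := gic_inj _ (Module.Flat.iff_characterModule_injective.1 inferInstance)
  extn h hA hC := gic_extn h.dual hC hA
  kere h hB hC := gic_coke h.dual hC hB

def cflip (φ : I →ₗ[R] CharacterModule A) : A →ₗ[R] CharacterModule I where
  toFun a := (AddMonoidHom.eval a).comp φ.toAddMonoidHom
  map_add' a b := DFunLike.ext _ _ fun i => map_add (φ i) a b
  map_smul' r a := DFunLike.ext _ _ fun i => by
    change φ i (r • a) = φ (r • i) a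
    rw [φ.map_smul r i]; rfl

theorem cflip_apply (φ : I →ₗ[R] CharacterModule A) (a : A) (i : I) : cflip φ a i = φ i a := rfl

theorem lift_dual_iff (f : A →ₗ[R] B) :
    (∀ φ : I →ₗ[R] CharacterModule A, ∃ ψ : I →ₗ[R] CharacterModule B,
      (CharacterModule.dual f).comp ψ = φ) ↔
    (∀ φ : A →ₗ[R] CharacterModule I, ∃ ψ : B →ₗ[R] CharacterModule I, ψ.comp f = φ) := by
  constructor
  · intro h φ
    obtain ⟨ψ, hψ⟩ := h (cflip φ)
    refine ⟨cflip ψ, LinearMap.ext fun a => DFunLike.ext _ _ fun i => ?_⟩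
    exact DFunLike.congr_fun (LinearMap.congr_fun hψ i) a
  · intro h φ
    obtain ⟨ψ, hψ⟩ := h (cflip φ)
    refine ⟨cflip ψ, LinearMap.ext fun a => DFunLike.ext _ _ fun i => ?_⟩
    exact DFunLike.congr_fun (LinearMap.congr_fun hψ i) a

theorem rT_iff (f : A →ₗ[R] B) : Function.Injective (f.rTensor I) ↔
    (∀ φ : A →ₗ[R] CharacterModule I, ∃ ψ : B →ₗ[R] CharacterModule I, ψ.comp f = φ) := by
  rw [rTensor_injective_iff_lcomp_surjective]; rfl

theorem gdc_of_isGorensteinFlat (h : IsGorensteinFlat R A) : GDc R (.of R A) := by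
  obtain ⟨X, d, hX, hex, hQ, π, hπ, hπe⟩ := h
  have ses : ∀ j, SES (LinearMap.range (d j)).subtype (d (j+1)).rangeRestrict := fun j =>
    ⟨Subtype.val_injective, LinearMap.surjective_rangeRestrict _, fun x => by
      rw [← LinearMap.mem_ker, LinearMap.ker_rangeRestrict, LinearMap.mem_ker, hex j x]
      simp⟩
  have hinj : ∀ j, Module.Injective R (CharacterModule (X j)) := fun j =>
    have := hX j
    Module.Flat.iff_characterModule_injective.1 inferInstance
  have hext : ∀ I : ModuleCat.{u} R, Module.Injective R I → ∀ i j,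
      ExtV R I (CharacterModule (LinearMap.range (d j))) (i+1) := by
    intro I hI i
    induction i with
    | zero =>
      intro j
      obtain ⟨k, rfl⟩ : ∃ k, j = k + 1 + 1 := ⟨j - 1 - 1, by ring⟩
      refine (ses (k+1)).dual.of_lift (extV_inj (hinj _) 0) ?_
      rw [lift_dual_iff, ← rT_iff, injective_iff_map_eq_zero]
      intro t ht
      obtain ⟨s, rfl⟩ := LinearMap.rTensor_surjective I
        (LinearMap.surjective_rangeRestrict (d (k+1))) t
      rw [← LinearMap.comp_apply, ← LinearMap.rTensor_comp] at ht
      obtain ⟨r, rfl⟩ := (hQ I hI k s).1 ht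
      rw [← LinearMap.comp_apply, ← LinearMap.rTensor_comp]
      have : (d (k+1)).rangeRestrict.comp (d k) = 0 :=
        LinearMap.ext fun x => Subtype.ext ((hex k).apply_apply_eq_zero x)
      rw [this]; simp
    | succ i ih =>
      intro j
      obtain ⟨k, rfl⟩ : ∃ k, j = k + 1 := ⟨j - 1, by ring⟩
      exact (ses k).dual.cov1 (ih k) (extV_inj (hinj _) _)
  have main : GIc R (.of R (CharacterModule (LinearMap.range (d 0)))) := by
    refine ⟨fun G => ∃ j, G = .of R (CharacterModule (LinearMap.range (d j))), ?_, 0, rfl⟩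
    rintro G ⟨j, rfl⟩
    exact ⟨fun Q hQ' i => hext Q hQ' i j, .of R (CharacterModule (X (j+1))),
      .of R (CharacterModule (LinearMap.range (d (j+1)))), _, _, hinj _,
      (ses j).dual, j+1, rfl⟩
  have hex0 : Function.Exact (d (-1)) (d 0) := hex (-1)
  have hk : LinearMap.ker (d 0) = LinearMap.ker π := by
    ext x
    rw [LinearMap.mem_ker, LinearMap.mem_ker, hex0 x]
    exact (hπe x).symm
  exact gdc_resolving.iso (((d 0).quotKerEquivRange.symm.trans (Submodule.quotEquivOfEq _ _ hk)).trans
    (π.quotKerEquivOfSurjective hπ)) main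
end C2
end FileC2

section FileG1
open CategoryTheory IsLocalRing Paper TensorProduct

/-- Finitely generated totally reflexive modules, in coinductive form. -/
def Gc (R : Type u) [CommRing R] (N : ModuleCat.{u} R) : Prop :=
  Module.Finite R N ∧ GPc R N

section G1
variable {R : Type u} [CommRing R] {A B C Q K I L F : Type u} [AddCommGroup A] [Module R A]
    [AddCommGroup B] [Module R B] [AddCommGroup C] [Module R C]
    [AddCommGroup Q] [Module R Q] [AddCommGroup K] [Module R K] [AddCommGroup I] [Module R I]
    [AddCommGroup L] [Module R L] [AddCommGroup F] [Module R F]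

theorem extV_pi {n : ℕ} {f : A →ₗ[R] B} {g : B →ₗ[R] C} (h : SES f g) (h1 : ExtV R C R 1)
    (φ : A →ₗ[R] (Fin n →₀ R)) : ∃ ψ : B →ₗ[R] (Fin n →₀ R), ψ.comp f = φ := by
  choose ψ hψ using fun i : Fin n => h.ext h1 ((Finsupp.lapply i).comp φ)
  refine ⟨(Finsupp.linearEquivFunOnFinite R R (Fin n)).symm.toLinearMap.comp (LinearMap.pi ψ), ?_⟩
  refine LinearMap.ext fun a => Finsupp.ext fun i => ?_
  exact LinearMap.congr_fun (hψ i) a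

/-- Extension of maps to flat modules. -/
theorem ext_flat [IsNoetherianRing R] [Module.Finite R A] {f : A →ₗ[R] B} {g : B →ₗ[R] C}
    (h : SES f g) (h1 : ExtV R C R 1) (hQ : Module.Flat R Q)
    (φ : A →ₗ[R] Q) : ∃ ψ : B →ₗ[R] Q, ψ.comp f = φ := by
  have : Module.FinitePresentation R A := Module.finitePresentation_of_finite R A
  obtain ⟨k, h2, h3, rfl⟩ := Module.Flat.exists_factorization_of_finitePresentation φ
  obtain ⟨ψ, rfl⟩ := extV_pi h h1 h2
  exact ⟨h3.comp ψ, rfl⟩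

theorem fg_cover [IsNoetherianRing R] (A : Type u) [AddCommGroup A] [Module R A] [Module.Finite R A] :
    ∃ (n : ℕ) (K : ModuleCat.{u} R) (f : K →ₗ[R] (Fin n → R)) (g : (Fin n → R) →ₗ[R] A),
      Module.Finite R K ∧ SES f g := by
  obtain ⟨n, g, hg⟩ := Module.Finite.exists_fin' R A
  exact ⟨n, .of R (LinearMap.ker g), _, g, inferInstanceAs (Module.Finite R (LinearMap.ker g)),
    SES.of_ker g hg⟩

theorem extV_fg_proj [IsNoetherianRing R] (hQ : Module.Projective R Q) (i : ℕ) :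
    ∀ (A : Type u) [AddCommGroup A] [Module R A] [Module.Finite R A]
      (_ : ∀ i, ExtV R A R (i+1)), ExtV R A Q (i+1) := by
  induction i with
  | zero =>
    intro A _ _ _ h
    obtain ⟨n, K, f, g, hK, hs⟩ := fg_cover (R := R) A
    exact hs.of_ext (extV_proj inferInstance _) fun φ => ext_flat hs (h 0) inferInstance φ
  | succ i ih =>
    intro A _ _ _ h
    obtain ⟨n, K, f, g, hK, hs⟩ := fg_cover (R := R) A
    exact hs.con3 (ih K fun i => hs.con1 (extV_proj inferInstance _) (h (i+1)))
      (extV_proj inferInstance _)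

theorem SES.finite_right {f : A →ₗ[R] B} {g : B →ₗ[R] C} (h : SES f g) [Module.Finite R B] :
    Module.Finite R C := Module.Finite.of_surjective g h.surj

theorem SES.finite_left [IsNoetherianRing R] {f : A →ₗ[R] B} {g : B →ₗ[R] C} (h : SES f g)
    [Module.Finite R B] : Module.Finite R A := Module.Finite.of_injective f h.inj

/-- Left approximation by a finite free module. -/
theorem approx [IsNoetherianRing R] (L : Type u) [AddCommGroup L] [Module R L] [Module.Finite R L] :
    ∃ (n : ℕ) (ι : L →ₗ[R] (Fin n → R)), ∀ φ : L →ₗ[R] R, ∃ ψ : (Fin n → R) →ₗ[R] R,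
      ψ.comp ι = φ := by
  obtain ⟨n, g, hg⟩ := Module.Finite.exists_fin' R (L →ₗ[R] R)
  refine ⟨n, LinearMap.pi fun i => g (Pi.single i 1), fun φ => ?_⟩
  obtain ⟨c, rfl⟩ := hg φ
  refine ⟨∑ i, c i • LinearMap.proj i, ?_⟩
  refine LinearMap.ext fun x => ?_
  conv_rhs => rw [pi_eq_sum_univ' c, map_sum]
  simp only [map_smul]
  simp

theorem approx_flat [IsNoetherianRing R] [Module.Finite R L] {n : ℕ} {ι : L →ₗ[R] (Fin n → R)}
    (h : ∀ φ : L →ₗ[R] R, ∃ ψ : (Fin n → R) →ₗ[R] R, ψ.comp ι = φ) (hQ : Module.Flat R Q)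
    (φ : L →ₗ[R] Q) : ∃ ψ : (Fin n → R) →ₗ[R] Q, ψ.comp ι = φ := by
  have : Module.FinitePresentation R L := Module.finitePresentation_of_finite R L
  obtain ⟨k, h2, h3, rfl⟩ := Module.Flat.exists_factorization_of_finitePresentation φ
  choose ψ hψ using fun i => h ((Finsupp.lapply i).comp h2)
  refine ⟨h3.comp ((Finsupp.linearEquivFunOnFinite R R (Fin k)).symm.toLinearMap.comp
    (LinearMap.pi ψ)), ?_⟩
  refine LinearMap.ext fun a => congrArg h3 (Finsupp.ext fun i => ?_)
  exact LinearMap.congr_fun (hψ i) a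

/-- Coinduction principle for `Gc`. -/
theorem gc_coind [IsNoetherianRing R] (S : ModuleCat.{u} R → Prop)
    (hS : ∀ L, S L → Module.Finite R L ∧ (∀ i, ExtV R L R (i+1)) ∧
      ∃ (n : ℕ) (C : ModuleCat.{u} R) (f : L →ₗ[R] (Fin n → R)) (g : (Fin n → R) →ₗ[R] C),
        SES f g ∧ S C) {L : ModuleCat.{u} R} (hL : S L) : Gc R L := by
  refine ⟨(hS L hL).1, S, fun G hG => ?_, hL⟩
  obtain ⟨h1, h2, n, C, f, g, h3, h4⟩ := hS G hG
  refine ⟨fun Q hQ i => extV_fg_proj hQ i G h2, .of R (Fin n → R), C, f, g, ?_, h3, h4⟩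
  exact inferInstanceAs (Module.Projective R (Fin n → R))

theorem gc_step [IsNoetherianRing R] (hL : Gc R (.of R L)) :
    ∃ (n : ℕ) (C : ModuleCat.{u} R) (f : L →ₗ[R] (Fin n → R)) (g : (Fin n → R) →ₗ[R] C),
        SES f g ∧ Gc R C := by
  obtain ⟨hfin, hG⟩ := hL
  replace hfin : Module.Finite R L := hfin
  obtain ⟨h1, P, L', s, t, hP, hst, hL'⟩ := gpc_gps _ hG
  obtain ⟨n, ι, hι⟩ := approx (R := R) L
  have hinj : Function.Injective ι := by
    obtain ⟨ψ, hψ⟩ := approx_flat hι (inferInstance : Module.Flat R P) s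
    intro x y hxy
    apply hst.inj
    change s x = s y
    rw [← hψ]; simp [hxy]
  have hs := SES.of_range ι hinj
  refine ⟨n, .of R ((Fin n → R) ⧸ LinearMap.range ι), ι, _, hs,
    inferInstanceAs (Module.Finite R ((Fin n → R) ⧸ LinearMap.range ι)), ?_⟩
  have hE : ExtV R ((Fin n → R) ⧸ LinearMap.range ι) P 1 :=
    hs.of_ext (extV_proj inferInstance _) fun φ => approx_flat hι inferInstance φ
  obtain ⟨Z, c, d, a, b, hcd, hab, -, -, -⟩ := SES.push2 (C := L') hst hs
  -- hcd : F → Z → L', hab : P → Z → coker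
  have hZ : GPc R Z := gpc_extn (C := L') hcd (gpc_proj _ inferInstance) hL'
  obtain ⟨ρ, hρ⟩ := hab.ext hE LinearMap.id
  obtain ⟨σ, hσ⟩ := hab.split_retr ρ hρ
  exact gpc_kere hσ hZ (gpc_proj _ hP)

theorem gc_extR (hL : Gc R (.of R L)) (i : ℕ) : ExtV R L R (i+1) :=
  (gpc_gps _ hL.2).1 (.of R R) (inferInstanceAs (Module.Projective R R)) i

theorem gc_of_gdc [IsNoetherianRing R] [hf : Module.Finite R L] (hL : GDc R (.of R L)) :
    Gc R (.of R L) := by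
  refine gc_coind (fun N => Module.Finite R N ∧ GDc R N) ?_ ⟨hf, hL⟩
  rintro L ⟨hfin, hG⟩
  refine ⟨hfin, ?_, ?_⟩
  · intro i
    clear hf hL
    induction i generalizing L with
    | zero =>
      obtain ⟨n, K, f, g, hK, hs⟩ := fg_cover (R := R) L
      refine hs.of_ext (extV_proj inferInstance _) ?_
      suffices h : Function.Surjective (LinearMap.lcomp R R f) from h
      rw [← CharacterModule.dual_injective_iff_surjective]
      have hI : Module.Injective R (CharacterModule R) :=
        Module.Flat.iff_characterModule_injective.1 inferInstance
      obtain ⟨h1, -⟩ := gic_gis _ hG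
      have hinj : Function.Injective (f.rTensor (CharacterModule R)) := by
        rw [rT_iff, ← lift_dual_iff]
        exact hs.dual.lift (h1 (.of R (CharacterModule R)) hI 0)
      intro x y hxy
      obtain ⟨x, rfl⟩ := tev_bij.2 x
      obtain ⟨y, rfl⟩ := tev_bij.2 y
      rw [← tev_nat, ← tev_nat] at hxy
      rw [hinj (tev_bij.1 hxy)]
    | succ i ih =>
      obtain ⟨n, K, f, g, hK, hs⟩ := fg_cover (R := R) L
      refine hs.con3 (ih K hK ?_) (extV_proj inferInstance _)
      exact gdc_resolving.kere hs (gdc_resolving.proj _ inferInstance) hG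
  · obtain ⟨h1, E, L', s, t, hE, hst, hL'⟩ := gic_gis _ hG
    obtain ⟨n, ι, hι⟩ := approx (R := R) L
    have hlift : ∀ I : ModuleCat.{u} R, Module.Injective R I →
        ∀ φ : I →ₗ[R] CharacterModule L, ∃ ψ : I →ₗ[R] CharacterModule (Fin n → R),
          (CharacterModule.dual ι).comp ψ = φ := fun I hI => by
      rw [lift_dual_iff]
      exact fun φ => approx_flat hι (flat_dual_of_injective hI) φ
    have hinj : Function.Injective ι := by
      obtain ⟨ψ, hψ⟩ := hlift E hE t
      rw [← CharacterModule.dual_surjective_iff_injective]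
      intro c
      obtain ⟨e, he⟩ := hst.surj c
      refine ⟨ψ e, ?_⟩
      have := LinearMap.congr_fun hψ e
      exact this.trans he
    have hs := SES.of_range ι hinj
    refine ⟨n, .of R ((Fin n → R) ⧸ LinearMap.range ι), ι, _, hs,
      inferInstanceAs (Module.Finite R ((Fin n → R) ⧸ LinearMap.range ι)), ?_⟩
    have hF : Module.Injective R (CharacterModule (Fin n → R)) :=
        Module.Flat.iff_characterModule_injective.1 inferInstance
    have hE1 : ExtV R E (CharacterModule ((Fin n → R) ⧸ LinearMap.range ι)) 1 :=
      hs.dual.of_lift (extV_inj hF _) (hlift E hE)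
    obtain ⟨Z, a, b, c, d, hab, hcd, -, -, -⟩ := SES.pull2 hs.dual hst
    -- hab : C^∨ → Z → E,  hcd : L' → Z → F^∨
    have hZ : GIc R Z := gic_extn (A := L') hcd hL' (gic_inj _ hF)
    obtain ⟨σ, hσ⟩ := hab.lift hE1 LinearMap.id
    obtain ⟨ρ, hρ, -⟩ := hab.split_sect σ hσ
    exact gic_coke hρ (gic_inj _ hE) hZ

theorem gc_iso : IsoClosed R (Gc R) := fun e h =>
  ⟨have : Module.Finite R _ := h.1; Module.Finite.equiv e, gpc_iso e h.2⟩

theorem gc_ker [IsNoetherianRing R] {f : A →ₗ[R] B} {g : B →ₗ[R] C} (h : SES f g)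
    (hB : Gc R (.of R B)) (hC : Gc R (.of R C)) : Gc R (.of R A) :=
  ⟨have : Module.Finite R B := hB.1; h.finite_left, gpc_kere h hB.2 hC.2⟩

theorem gc_free (n : ℕ) : Gc R (.of R (Fin n → R)) :=
  ⟨inferInstanceAs (Module.Finite R (Fin n → R)), gpc_proj _ inferInstance⟩

theorem gc_coker [IsNoetherianRing R] {n : ℕ} {f : K →ₗ[R] (Fin n → R)} {g : (Fin n → R) →ₗ[R] L}
    (h : SES f g) (hK : Gc R (.of R K)) (hL : ∀ i, ExtV R L R (i+1)) : Gc R (.of R L) := by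
  have : Module.Finite R L := h.finite_right
  refine ⟨this, ?_⟩
  obtain ⟨m, C, s, t, hst, hC⟩ := gc_step hK
  obtain ⟨Z, c, d, a, b, hcd, hab, -, -, -⟩ := SES.push2 (C := C) hst h
  have hZ : GPc R Z := gpc_extn (C := C) hcd (gpc_proj _ inferInstance) hC.2
  obtain ⟨ρ, hρ⟩ := hab.ext (extV_fg_proj inferInstance 0 L hL) LinearMap.id
  obtain ⟨σ, hσ⟩ := hab.split_retr ρ hρ
  exact gpc_kere hσ hZ (gpc_proj _ inferInstance)

/-- From a resolution with respect to a resolving class to a finite free one. -/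
theorem res_gc [IsNoetherianRing R] {P : ModuleCat.{u} R → Prop} (hP : Resolving R P)
    (hPG : ∀ (L : Type u) [AddCommGroup L] [Module R L] [Module.Finite R L], P (.of R L) → Gc R (.of R L))
    (e : ℕ) : ∀ (L : Type u) [AddCommGroup L] [Module R L] [Module.Finite R L],
      ResDimLE R P e (.of R L) → ResDimLE R (Gc R) e (.of R L) := by
  induction e with
  | zero => intro L _ _ _ h; exact hPG L h
  | succ e ih =>
    intro L _ _ _ h
    obtain ⟨n, K, f, g, hK, hs⟩ := fg_cover (R := R) L
    exact Paper.ResDimLE.cons gc_iso (A := K) hs (gc_free n) (ih K (res_syz (K := K) hP hs inferInstance h))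

theorem gc_of_gpc [Module.Finite R L] (h : GPc R (.of R L)) : Gc R (.of R L) :=
  ⟨inferInstanceAs (Module.Finite R L), h⟩
end G1
end FileG1

section FileG2
open CategoryTheory IsLocalRing Paper TensorProduct

def Bic {R : Type u} [CommRing R] (r : ModuleCat.{u} R → ModuleCat.{u} R → Prop)
    (N : ModuleCat.{u} R) : Prop :=
  ∃ S : ModuleCat.{u} R → Prop,
    (∀ G, S G → (∃ B, r G B ∧ S B) ∧ (∃ A, r A G ∧ S A)) ∧ S N

def rP (R : Type u) [CommRing R] (A B : ModuleCat.{u} R) : Prop :=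
  ∃ (F : ModuleCat.{u} R) (f : A →ₗ[R] F) (g : F →ₗ[R] B), Module.Projective R F ∧ SES f g ∧
    ∀ Q : ModuleCat.{u} R, Module.Projective R Q → ∀ φ : A →ₗ[R] Q, ∃ ψ : F →ₗ[R] Q, ψ.comp f = φ

def rF (R : Type u) [CommRing R] (A B : ModuleCat.{u} R) : Prop :=
  ∃ (F : ModuleCat.{u} R) (f : A →ₗ[R] F) (g : F →ₗ[R] B), Module.Flat R F ∧ SES f g ∧
    ∀ I : ModuleCat.{u} R, Module.Injective R I → Function.Injective (f.rTensor I)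

section G2
variable {R : Type u} [CommRing R]

theorem Bic.chain {r : ModuleCat.{u} R → ModuleCat.{u} R → Prop} {N : ModuleCat.{u} R}
    (h : Bic r N) : ∃ T : ℤ → ModuleCat.{u} R, T 1 = N ∧ ∀ i, r (T i) (T (i+1)) := by
  obtain ⟨S, hS, hN⟩ := h
  choose a ha haS using fun G : {G // S G} => (hS G.1 G.2).1
  choose b hb hbS using fun G : {G // S G} => (hS G.1 G.2).2
  let ra : ℕ → {G // S G} := fun n => Nat.rec ⟨N, hN⟩ (fun _ G => ⟨a G, haS G⟩) n
  let rb : ℕ → {G // S G} := fun n => Nat.rec ⟨N, hN⟩ (fun _ G => ⟨b G, hbS G⟩) n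
  let T : ℤ → ModuleCat.{u} R := fun i => match i with
    | Int.ofNat n => (ra n).1
    | Int.negSucc n => (rb (n+1)).1
  have hT : ∀ i, r (T i) (T (i+1)) := by
    intro i
    match i with
    | Int.ofNat n => exact ha (ra n)
    | Int.negSucc 0 => exact hb (rb 0)
    | Int.negSucc (n+1) =>
      have : Int.negSucc (n+1) + 1 = Int.negSucc n := by omega
      rw [this]
      exact hb (rb (n+1))
  refine ⟨fun i => T (i - 1), rfl, fun i => ?_⟩
  have : i + 1 - 1 = (i - 1) + 1 := by ring
  change r (T (i-1)) (T (i + 1 - 1))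
  rw [this]
  exact hT _

theorem chain_exact {T F : ℤ → ModuleCat.{u} R} {f : ∀ i, T i →ₗ[R] F i}
    {g : ∀ i, F i →ₗ[R] T (i+1)} (h : ∀ i, SES (f i) (g i)) (i : ℤ) :
    Function.Exact ((f (i+1)).comp (g i)) ((f (i+1+1)).comp (g (i+1))) := by
  intro x
  constructor
  · intro hx
    have h1 : g (i+1) x = 0 := (h (i+1+1)).inj (hx.trans (map_zero _).symm)
    obtain ⟨y, rfl⟩ := ((h (i+1)).ex x).1 h1
    obtain ⟨z, rfl⟩ := (h i).surj y
    exact ⟨z, rfl⟩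
  · rintro ⟨z, rfl⟩
    change f (i+1+1) (g (i+1) (f (i+1) (g i z))) = 0
    rw [(h (i+1)).gf, map_zero]

theorem chain_pi {T F : ℤ → ModuleCat.{u} R} {f : ∀ i, T i →ₗ[R] F i}
    {g : ∀ i, F i →ₗ[R] T (i+1)} (h : ∀ i, SES (f i) (g i)) (i : ℤ) :
    Function.Exact ((f (i+1)).comp (g i)) (g (i+1)) := by
  intro x
  constructor
  · intro h1
    obtain ⟨y, rfl⟩ := ((h (i+1)).ex x).1 h1
    obtain ⟨z, rfl⟩ := (h i).surj y
    exact ⟨z, rfl⟩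
  · rintro ⟨z, rfl⟩
    exact (h (i+1)).gf _

theorem Bic.isGorensteinProjective {N : ModuleCat.{u} R} (h : Bic (rP R) N) :
    IsGorensteinProjective R N := by
  obtain ⟨T, rfl, hT⟩ := h.chain
  choose F f g hF hs hQ using hT
  refine ⟨F, fun i => (f (i+1)).comp (g i), hF, chain_exact hs, ?_, g 0, (hs 0).surj, chain_pi hs (-1)⟩
  intro Q hQ' i φ hφ
  have hφ' : ∀ x, φ (f (i+1) x) = 0 := fun x => by
    obtain ⟨z, rfl⟩ := (hs i).surj x
    exact LinearMap.congr_fun hφ z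
  obtain ⟨φ', hφ'⟩ : ∃ φ' : T (i+1+1) →ₗ[R] Q, φ'.comp (g (i+1)) = φ := by
    have hle : LinearMap.ker (g (i+1)) ≤ LinearMap.ker φ := by
      intro x hx
      obtain ⟨y, rfl⟩ := ((hs (i+1)).ex x).1 hx
      exact hφ' y
    refine ⟨((LinearMap.ker (g (i+1))).liftQ φ hle).comp
      ((g (i+1)).quotKerEquivOfSurjective (hs (i+1)).surj).symm.toLinearMap, ?_⟩
    refine LinearMap.ext fun x => ?_
    change ((LinearMap.ker (g (i+1))).liftQ φ hle)
      (((g (i+1)).quotKerEquivOfSurjective (hs (i+1)).surj).symm (g (i+1) x)) = φ x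
    have : ((g (i+1)).quotKerEquivOfSurjective (hs (i+1)).surj).symm (g (i+1) x) =
        Submodule.Quotient.mk x := by
      rw [LinearEquiv.symm_apply_eq]; rfl
    rw [this]; rfl
  obtain ⟨ψ, hψ⟩ := hQ _ Q hQ' φ'
  refine ⟨ψ, ?_⟩
  rw [← LinearMap.comp_assoc, hψ, hφ']

theorem Bic.isGorensteinFlat {N : ModuleCat.{u} R} (h : Bic (rF R) N) :
    IsGorensteinFlat R N := by
  obtain ⟨T, rfl, hT⟩ := h.chain
  choose F f g hF hs hQ using hT
  refine ⟨F, fun i => (f (i+1)).comp (g i), hF, chain_exact hs, ?_, g 0, (hs 0).surj, chain_pi hs (-1)⟩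
  intro I hI i x
  constructor
  · intro hx
    rw [LinearMap.rTensor_comp] at hx
    have h1 : (g (i+1)).rTensor I x = 0 := hQ _ I hI (hx.trans (map_zero _).symm)
    obtain ⟨y, rfl⟩ := (rTensor_exact I (hs (i+1)).ex (hs (i+1)).surj x).1 h1
    obtain ⟨z, rfl⟩ := LinearMap.rTensor_surjective I (hs i).surj y
    exact ⟨z, by rw [LinearMap.rTensor_comp]; rfl⟩
  · rintro ⟨z, rfl⟩
    rw [← LinearMap.comp_apply, ← LinearMap.rTensor_comp]
    have : ((f (i+1+1)).comp (g (i+1))).comp ((f (i+1)).comp (g i)) = 0 :=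
      LinearMap.ext fun z => (chain_exact hs i).apply_apply_eq_zero z
    rw [this]; simp

theorem gc_rP [IsNoetherianRing R] {A B : ModuleCat.{u} R} {n : ℕ} {f : A →ₗ[R] (Fin n → R)}
    {g : (Fin n → R) →ₗ[R] B} (h : SES f g) (hA : Gc R A) (hB : Gc R B) : rP R A B := by
  have := hA.1
  refine ⟨.of R (Fin n → R), f, g, inferInstanceAs (Module.Projective R (Fin n → R)), h, ?_⟩
  intro Q hQ φ
  exact ext_flat h (gc_extR hB 0) inferInstance φ

theorem gc_rF [IsNoetherianRing R] {A B : ModuleCat.{u} R} {n : ℕ} {f : A →ₗ[R] (Fin n → R)}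
    {g : (Fin n → R) →ₗ[R] B} (h : SES f g) (hA : Gc R A) (hB : Gc R B) : rF R A B := by
  have := hA.1
  refine ⟨.of R (Fin n → R), f, g, inferInstanceAs (Module.Flat R (Fin n → R)), h, ?_⟩
  intro I hI
  rw [rT_iff]
  intro φ
  exact ext_flat h (gc_extR hB 0) (flat_dual_of_injective hI) φ

theorem gc_bic [IsNoetherianRing R] (r : ModuleCat.{u} R → ModuleCat.{u} R → Prop)
    (hr : ∀ {A B : ModuleCat.{u} R} {n : ℕ} {f : A →ₗ[R] (Fin n → R)}
      {g : (Fin n → R) →ₗ[R] B}, SES f g → Gc R A → Gc R B → r A B)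
    {N : ModuleCat.{u} R} (h : Gc R N) : Bic r N := by
  refine ⟨Gc R, fun G hG => ⟨?_, ?_⟩, h⟩
  · obtain ⟨n, C, f, g, hs, hC⟩ := gc_step hG
    exact ⟨C, hr hs hG hC, hC⟩
  · have := hG.1
    obtain ⟨n, K, f, g, hK, hs⟩ := fg_cover (R := R) G
    have hK' : Gc R K := gc_ker (A := K) hs (gc_free n) hG
    exact ⟨K, hr hs hK' hG, hK'⟩

theorem gc_isGP [IsNoetherianRing R] {N : ModuleCat.{u} R} (h : Gc R N) :
    IsGorensteinProjective R N := (gc_bic (rP R) gc_rP h).isGorensteinProjective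

theorem gc_bicF [IsNoetherianRing R] {N : ModuleCat.{u} R} (h : Gc R N) :
    Bic (rF R) N := gc_bic (rF R) gc_rF h
end G2
end FileG2

section FileG3
open CategoryTheory IsLocalRing Paper TensorProduct

section G3
variable {R : Type u} [CommRing R] {A B C Q K I L F N M Y : Type u} [AddCommGroup A] [Module R A]
    [AddCommGroup B] [Module R B] [AddCommGroup C] [Module R C]
    [AddCommGroup Q] [Module R Q] [AddCommGroup K] [Module R K] [AddCommGroup I] [Module R I]
    [AddCommGroup L] [Module R L] [AddCommGroup F] [Module R F] [AddCommGroup N] [Module R N]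
    [AddCommGroup M] [Module R M] [AddCommGroup Y] [Module R Y]

theorem SES.exists_desc {f : A →ₗ[R] B} {g : B →ₗ[R] C} (h : SES f g) (φ : B →ₗ[R] Y)
    (hφ : ∀ a, φ (f a) = 0) : ∃ ψ : C →ₗ[R] Y, ψ.comp g = φ := by
  have hle : LinearMap.ker g ≤ LinearMap.ker φ := by
    intro x hx
    obtain ⟨y, rfl⟩ := (h.ex x).1 hx
    exact hφ y
  refine ⟨((LinearMap.ker g).liftQ φ hle).comp
    (g.quotKerEquivOfSurjective h.surj).symm.toLinearMap, ?_⟩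
  refine LinearMap.ext fun x => ?_
  change ((LinearMap.ker g).liftQ φ hle) ((g.quotKerEquivOfSurjective h.surj).symm (g x)) = φ x
  have : (g.quotKerEquivOfSurjective h.surj).symm (g x) = Submodule.Quotient.mk x := by
    rw [LinearEquiv.symm_apply_eq]; rfl
  rw [this]; rfl

theorem SES.hom {f : A →ₗ[R] B} {g : B →ₗ[R] C} (h : SES f g) (h1 : ExtV R C Y 1) :
    SES (LinearMap.lcomp R Y g) (LinearMap.lcomp R Y f) := by
  refine ⟨fun φ ψ hh => LinearMap.ext fun c => ?_, fun φ => h.ext h1 φ, fun φ => ⟨fun hφ => ?_, ?_⟩⟩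
  · obtain ⟨b, rfl⟩ := h.surj c
    exact LinearMap.congr_fun hh b
  · exact h.exists_desc φ fun a => LinearMap.congr_fun hφ a
  · rintro ⟨ψ, rfl⟩
    refine LinearMap.ext fun a => ?_
    change ψ (g (f a)) = 0
    rw [h.gf, map_zero]

/-- Evaluation into the bidual. -/
def ev (R : Type u) [CommRing R] (L : Type u) [AddCommGroup L] [Module R L] :
    L →ₗ[R] ((L →ₗ[R] R) →ₗ[R] R) := LinearMap.applyₗ

theorem ev_apply (x : L) (φ : L →ₗ[R] R) : ev R L x φ = φ x := rfl

theorem ev_inj_of {n : ℕ} {f : L →ₗ[R] (Fin n → R)} (hf : Function.Injective f) :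
    Function.Injective (ev R L) := by
  rw [injective_iff_map_eq_zero]
  intro x hx
  apply hf
  rw [map_zero]
  ext i
  exact LinearMap.congr_fun hx ((LinearMap.proj i).comp f)

theorem ev_inj_free {n : ℕ} : Function.Injective (ev R (Fin n → R)) :=
  ev_inj_of (f := LinearMap.id) Function.injective_id

theorem ev_surj_free {n : ℕ} : Function.Surjective (ev R (Fin n → R)) := by
  intro Ψ
  refine ⟨fun i => Ψ (LinearMap.proj i), LinearMap.ext fun φ => ?_⟩
  rw [ev_apply, pi_eq_sum_univ' (fun i => Ψ (LinearMap.proj i)), map_sum]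
  have : φ = ∑ i, φ (Pi.single i 1) • LinearMap.proj i := by
    refine LinearMap.ext fun v => ?_
    conv_lhs => rw [pi_eq_sum_univ' v, map_sum]
    simp [mul_comm]
  conv_rhs => rw [this, map_sum]
  refine Finset.sum_congr rfl fun i _ => ?_
  simp [mul_comm]

theorem gc_ev_inj [IsNoetherianRing R] (h : Gc R (.of R L)) : Function.Injective (ev R L) := by
  obtain ⟨n, C, f, g, hs, hC⟩ := gc_step h
  exact ev_inj_of hs.inj

theorem gc_ev_surj [IsNoetherianRing R] (h : Gc R (.of R L)) : Function.Surjective (ev R L) := by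
  obtain ⟨n, C, f, g, hs, hC⟩ := gc_step h
  have hh := hs.hom (gc_extR hC 0)
  intro Ψ
  obtain ⟨y, hy⟩ := ev_surj_free (Ψ.comp (LinearMap.lcomp R R f))
  have hy' : ∀ φ : (Fin n → R) →ₗ[R] R, φ y = Ψ (φ.comp f) := fun φ => LinearMap.congr_fun hy φ
  have hgy : g y = 0 := by
    apply gc_ev_inj hC
    rw [map_zero]
    refine LinearMap.ext fun c => ?_
    change (c.comp g) y = 0
    rw [hy', LinearMap.comp_assoc, hs.comp0]
    simp
  obtain ⟨l, rfl⟩ := (hs.ex y).1 hgy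
  refine ⟨l, LinearMap.ext fun φ => ?_⟩
  obtain ⟨φ, rfl⟩ := hh.surj φ
  exact hy' φ

theorem gc_ext_dual [IsNoetherianRing R] (i : ℕ) : ∀ (L : Type u) [AddCommGroup L] [Module R L],
    Gc R (.of R L) → ExtV R (L →ₗ[R] R) R (i+1) := by
  have hfree : ∀ (n i : ℕ), ExtV R ((Fin n → R) →ₗ[R] R) R (i+1) := fun n i =>
    extV_proj inferInstance i
  induction i with
  | zero =>
    intro L _ _ h
    obtain ⟨n, C, f, g, hs, hC⟩ := gc_step h
    refine (hs.hom (gc_extR hC 0)).of_ext (hfree n 0) fun φ => ?_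
    obtain ⟨c, rfl⟩ := gc_ev_surj hC φ
    obtain ⟨y, rfl⟩ := hs.surj c
    exact ⟨ev R _ y, rfl⟩
  | succ i ih =>
    intro L _ _ h
    obtain ⟨n, C, f, g, hs, hC⟩ := gc_step h
    exact (hs.hom (gc_extR hC 0)).con3 (ih C hC) (hfree n _)
end G3
end FileG3

section FileG4
open CategoryTheory IsLocalRing Paper TensorProduct

section G4
variable {R : Type u} [CommRing R] {A B C Q K I L F N M Y : Type u} [AddCommGroup A] [Module R A]
    [AddCommGroup B] [Module R B] [AddCommGroup C] [Module R C]
    [AddCommGroup Q] [Module R Q] [AddCommGroup K] [Module R K] [AddCommGroup I] [Module R I]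
    [AddCommGroup L] [Module R L] [AddCommGroup F] [Module R F] [AddCommGroup N] [Module R N]
    [AddCommGroup M] [Module R M] [AddCommGroup Y] [Module R Y]

noncomputable def freeDualEquiv (R : Type u) [CommRing R] (n : ℕ) :
    ((Fin n → R) →ₗ[R] R) ≃ₗ[R] (Fin n → R) :=
  (Module.piEquiv (Fin n) R R).symm

theorem finite_dual [IsNoetherianRing R] (K : Type u) [AddCommGroup K] [Module R K]
    [Module.Finite R K] : Module.Finite R (K →ₗ[R] R) := inferInstance

/-- Totally reflexive modules are in `Gc`. -/
theorem gc_of_tr [IsNoetherianRing R] [Module.Finite R L] (h1 : Function.Bijective (ev R L))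
    (h2 : ∀ i, ExtV R L R (i+1)) (h3 : ∀ i, ExtV R (L →ₗ[R] R) R (i+1)) : Gc R (.of R L) := by
  refine gc_coind (fun L => Module.Finite R L ∧ (∀ i, ExtV R L R (i+1)) ∧
    ∃ L' : ModuleCat.{u} R, Module.Finite R L' ∧ Nonempty (L ≃ₗ[R] (L' →ₗ[R] R)) ∧
      Function.Bijective (ev R L') ∧ ∀ i, ExtV R L' R (i+1)) ?_
    ⟨inferInstanceAs (Module.Finite R L), h2, .of R (L →ₗ[R] R),
      inferInstanceAs (Module.Finite R (L →ₗ[R] R)), ⟨LinearEquiv.ofBijective (ev R L) h1⟩, ?_, h3⟩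
  · rintro L ⟨hf, hE, L', hf', ⟨e⟩, hev, hE'⟩
    refine ⟨hf, hE, ?_⟩
    obtain ⟨n, K, f, g, hK, hs⟩ := fg_cover (R := R) L'
    have hh := hs.hom (hE' 0)
    have hh2 := (hh.trans_equiv_left e).trans_equiv_mid (freeDualEquiv R n)
    refine ⟨n, .of R (K →ₗ[R] R), _, _, hh2, finite_dual K, ?_,
      K, hK, ⟨LinearEquiv.refl R _⟩, ⟨ev_inj_of hs.inj, ?_⟩,
      fun i => hs.con1 (extV_proj inferInstance _) (hE' (i+1))⟩
    · intro i
      cases i with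
      | zero =>
        refine hh.of_ext (extV_proj inferInstance _) fun φ => ?_
        obtain ⟨c, rfl⟩ := hev.2 φ
        obtain ⟨y, rfl⟩ := hs.surj c
        exact ⟨ev R _ y, rfl⟩
      | succ i => exact hh2.con3 (hE i) (extV_proj inferInstance _)
    · intro Ψ
      obtain ⟨y, hy⟩ := ev_surj_free (Ψ.comp (LinearMap.lcomp R R f))
      have hy' : ∀ φ : (Fin n → R) →ₗ[R] R, φ y = Ψ (φ.comp f) := fun φ => LinearMap.congr_fun hy φ
      have hgy : g y = 0 := by
        apply hev.1
        rw [map_zero]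
        refine LinearMap.ext fun c => ?_
        change (c.comp g) y = 0
        rw [hy', LinearMap.comp_assoc, hs.comp0]
        simp
      obtain ⟨l, rfl⟩ := (hs.ex y).1 hgy
      refine ⟨l, LinearMap.ext fun φ => ?_⟩
      obtain ⟨φ, rfl⟩ := hh.surj φ
      exact hy' φ
  · constructor
    · intro φ ψ h
      refine LinearMap.ext fun x => ?_
      exact LinearMap.congr_fun h (ev R L x)
    · intro Ψ
      refine ⟨Ψ.comp (ev R L), LinearMap.ext fun Θ => ?_⟩
      obtain ⟨x, rfl⟩ := h1.2 Θ
      rfl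

theorem nak [IsLocalRing R] [Module.Finite R M] {x : R} (hx : x ∈ maximalIdeal R)
    (S : Submodule R M) (h : ∀ m : M, ∃ n ∈ S, ∃ m' : M, m = n + x • m') : S = ⊤ := by
  rw [eq_top_iff]
  refine Submodule.le_of_le_smul_of_le_jacobson_bot (I := maximalIdeal R) Module.Finite.fg_top
    (IsLocalRing.maximalIdeal_le_jacobson ⊥) ?_
  intro m _
  obtain ⟨n, hn, m', rfl⟩ := h m
  exact Submodule.add_mem_sup hn (Submodule.smul_mem_smul hx trivial)

theorem nak0 [IsLocalRing R] [Module.Finite R M] {x : R} (hx : x ∈ maximalIdeal R)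
    (h : ∀ m : M, ∃ m' : M, m = x • m') : Subsingleton M := by
  have := nak (M := M) hx ⊥ fun m => ⟨0, Submodule.zero_mem _, by simpa using h m⟩
  rw [subsingleton_iff_forall_eq 0]
  intro m
  rw [← Submodule.mem_bot R, this]; trivial

theorem ext_nak [IsNoetherianRing R] [IsLocalRing R] [Module.Finite R A] {x : R}
    (hx : x ∈ maximalIdeal R) (a : A →ₗ[R] B) (b : B →ₗ[R] A) (hab : b.comp a = x • LinearMap.id)
    (i : ℕ)
    (ha : ∀ e : Abelian.Ext (ModuleCat.of R A) (ModuleCat.of R R) i,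
      ∃ e' : Abelian.Ext (ModuleCat.of R B) (ModuleCat.of R R) i,
        (Abelian.Ext.mk₀ (ModuleCat.ofHom a)).comp e' (zero_add i) = e)
    (hb : ∀ e : Abelian.Ext (ModuleCat.of R B) (ModuleCat.of R R) i,
      ∃ e' : Abelian.Ext (ModuleCat.of R A) (ModuleCat.of R R) i,
        (Abelian.Ext.mk₀ (ModuleCat.ofHom b)).comp e' (zero_add i) = e) : ExtV R A R i := by
  have : Module.Finite R (ModuleCat.of R A) := inferInstanceAs (Module.Finite R A)
  have : Module.Finite R (ModuleCat.of R R) := inferInstanceAs (Module.Finite R R)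
  refine nak0 (R := R) hx fun e => ?_
  obtain ⟨e, rfl⟩ := ha e
  obtain ⟨e, rfl⟩ := hb e
  refine ⟨e, ?_⟩
  rw [← Abelian.Ext.comp_assoc (a₁₂ := 0) (a₂₃ := i) (h₁₂ := by rfl) (h₂₃ := by simp) (h := by simp),
    Abelian.Ext.mk₀_comp_mk₀, ← ModuleCat.ofHom_comp, hab,
    show ModuleCat.ofHom (x • (LinearMap.id : A →ₗ[R] A)) = x • 𝟙 (ModuleCat.of R A) from rfl,
    Abelian.Ext.mk₀_smul, Abelian.Ext.smul_comp]
  congr 1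
  exact Abelian.Ext.mk₀_id_comp e

theorem SES.ext_surj1 {f : A →ₗ[R] B} {g : B →ₗ[R] C} (h : SES f g) {i : ℕ}
    (h1 : ExtV R C Y (i+1)) (e : Abelian.Ext (ModuleCat.of R A) (ModuleCat.of R Y) i) :
    ∃ e' : Abelian.Ext (ModuleCat.of R B) (ModuleCat.of R Y) i,
        (Abelian.Ext.mk₀ (ModuleCat.ofHom f)).comp e' (zero_add i) = e := by
  rw [extV_iff] at h1
  exact Abelian.Ext.contravariant_sequence_exact₁ h.shortExact (ModuleCat.of R Y) e (add_comm 1 i) (h1 _)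

theorem SES.ext_surj2 {f : A →ₗ[R] B} {g : B →ₗ[R] C} (h : SES f g) {i : ℕ}
    (h1 : ExtV R A Y i) (e : Abelian.Ext (ModuleCat.of R B) (ModuleCat.of R Y) i) :
    ∃ e' : Abelian.Ext (ModuleCat.of R C) (ModuleCat.of R Y) i,
        (Abelian.Ext.mk₀ (ModuleCat.ofHom g)).comp e' (zero_add i) = e := by
  rw [extV_iff] at h1
  exact Abelian.Ext.contravariant_sequence_exact₂ h.shortExact (ModuleCat.of R Y) e (h1 _)

theorem ext_surj_split {a : A →ₗ[R] B} {c : B →ₗ[R] A} (h : c.comp a = LinearMap.id) {i : ℕ}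
    (e : Abelian.Ext (ModuleCat.of R A) (ModuleCat.of R Y) i) :
    ∃ e' : Abelian.Ext (ModuleCat.of R B) (ModuleCat.of R Y) i,
        (Abelian.Ext.mk₀ (ModuleCat.ofHom a)).comp e' (zero_add i) = e := by
  refine ⟨(Abelian.Ext.mk₀ (ModuleCat.ofHom c)).comp e (zero_add i), ?_⟩
  rw [← Abelian.Ext.comp_assoc (a₁₂ := 0) (a₂₃ := i) (h₁₂ := by rfl) (h₂₃ := by simp) (h := by simp),
    Abelian.Ext.mk₀_comp_mk₀, ← ModuleCat.ofHom_comp, h]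
  exact Abelian.Ext.mk₀_id_comp e
end G4
end FileG4

section FileG5
open CategoryTheory IsLocalRing Paper TensorProduct

section G5
variable {R : Type u} [CommRing R] {A B C Q K I L F N M Y : Type u} [AddCommGroup A] [Module R A]
    [AddCommGroup B] [Module R B] [AddCommGroup C] [Module R C]
    [AddCommGroup Q] [Module R Q] [AddCommGroup K] [Module R K] [AddCommGroup I] [Module R I]
    [AddCommGroup L] [Module R L] [AddCommGroup F] [Module R F] [AddCommGroup N] [Module R N]
    [AddCommGroup M] [Module R M] [AddCommGroup Y] [Module R Y]

theorem SES.prod' : SES (LinearMap.inr R A B) (LinearMap.fst R A B) :=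
  ⟨LinearMap.inr_injective, LinearMap.fst_surjective, fun ⟨a, b⟩ => ⟨fun h => ⟨b, Prod.ext h.symm rfl⟩,
    by rintro ⟨c, hc⟩; exact (congrArg Prod.fst hc).symm⟩⟩

theorem shape_gc [IsNoetherianRing R] [IsLocalRing R] [Module.Finite R K] {m : ℕ} {x : R}
    (hx : x ∈ maximalIdeal R) {f : K →ₗ[R] K × (Fin m → R)} {g : K × (Fin m → R) →ₗ[R] N}
    (h : SES f g) (hf : ∀ k, (f k).1 = x • k) (hN : Gc R (.of R N)) : Gc R (.of R K) := by
  have hfst : (LinearMap.fst R K (Fin m → R)).comp f = x • LinearMap.id :=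
    LinearMap.ext hf
  have hd := h.hom (gc_extR hN 0)
  refine gc_of_tr ⟨?_, ?_⟩ (fun i => ?_) (fun i => ?_)
  · rw [← LinearMap.ker_eq_bot]
    have hs : Subsingleton (LinearMap.ker (ev R K)) := by
      refine nak0 (R := R) hx ?_
      rintro ⟨k, hk⟩
      have hk' : ∀ φ : K →ₗ[R] R, φ k = 0 := fun φ => LinearMap.congr_fun hk φ
      have h0 : g (k, 0) = 0 := by
        apply gc_ev_inj hN
        rw [map_zero]
        refine LinearMap.ext fun c => ?_
        exact hk' ((c.comp g).comp (LinearMap.inl R K (Fin m → R)))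
      obtain ⟨k', hk2⟩ := (h.ex _).1 h0
      refine ⟨⟨k', LinearMap.ext fun φ => ?_⟩, Subtype.ext ?_⟩
      · obtain ⟨ψ, rfl⟩ := hd.surj φ
        change ψ (f k') = 0
        rw [hk2]
        exact hk' (ψ.comp (LinearMap.inl R K (Fin m → R)))
      · change k = x • k'
        rw [← hf, hk2]
    rw [Submodule.eq_bot_iff]
    intro k hk
    exact congrArg Subtype.val (Subsingleton.elim (⟨k, hk⟩ : LinearMap.ker (ev R K)) 0)
  · have := finite_dual (R := R) K
    have := finite_dual (R := R) (K →ₗ[R] R)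
    rw [← LinearMap.range_eq_top]
    refine nak hx _ fun Ψ => ?_
    obtain ⟨y, hy⟩ := gc_ev_surj hN
      ((Ψ.comp (LinearMap.lcomp R R (LinearMap.inl R K (Fin m → R)))).comp (LinearMap.lcomp R R g))
    obtain ⟨⟨k, z⟩, rfl⟩ := h.surj y
    obtain ⟨Θ, hΘ⟩ := hd.exists_desc
      (Ψ.comp (LinearMap.lcomp R R (LinearMap.inl R K (Fin m → R))) - ev R _ (k, z)) (by
        intro c
        have := LinearMap.congr_fun hy c
        rw [LinearMap.sub_apply, sub_eq_zero]
        exact this.symm)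
    refine ⟨ev R K k, ⟨k, rfl⟩, Θ, LinearMap.ext fun φ => ?_⟩
    have h3 := LinearMap.congr_fun hΘ (φ.comp (LinearMap.fst R K (Fin m → R)))
    have h4 : (LinearMap.lcomp R R f) (φ.comp (LinearMap.fst R K (Fin m → R))) = x • φ := by
      refine LinearMap.ext fun k => ?_
      change φ (f k).1 = x • φ k
      rw [hf, map_smul]
    rw [LinearMap.comp_apply, h4, map_smul] at h3
    change x • Θ φ = Ψ φ - φ k at h3
    change Ψ φ = φ k + x • Θ φ
    rw [h3]; ring
  · refine ext_nak hx f (LinearMap.fst R K (Fin m → R)) hfst (i+1) (h.ext_surj1 (gc_extR hN _))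
      (SES.prod'.ext_surj2 (extV_proj inferInstance _))
  · have := finite_dual (R := R) K
    refine ext_nak hx (LinearMap.lcomp R R (LinearMap.fst R K (Fin m → R))) (LinearMap.lcomp R R f)
      ?_ (i+1) (ext_surj_split (c := LinearMap.lcomp R R (LinearMap.inl R K (Fin m → R))) ?_)
      (hd.ext_surj2 (gc_ext_dual i N hN))
    · refine LinearMap.ext fun φ => LinearMap.ext fun k => ?_
      change φ (f k).1 = x • φ k
      rw [hf, map_smul]
    · rfl

theorem shape_syz {P : Type u} [AddCommGroup P] [Module R P] {x : R}
    {f : K →ₗ[R] K × F} {g : K × F →ₗ[R] N}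
    (h : SES f g) (hf : ∀ k, (f k).1 = x • k) {K' : Type u} [AddCommGroup K'] [Module R K']
    {s : K' →ₗ[R] P} {p : P →ₗ[R] K} (hs : SES s p) :
    ∃ (N' : ModuleCat.{u} R) (a : N' →ₗ[R] P × F) (f' : K' →ₗ[R] K' × P) (g' : K' × P →ₗ[R] N'),
      SES a (g.comp (p.prodMap LinearMap.id)) ∧ SES f' g' ∧ ∀ k, (f' k).1 = x • k := by
  have hp : Function.Surjective (g.comp (p.prodMap (LinearMap.id : F →ₗ[R] F))) := by
    intro n
    obtain ⟨⟨k, y⟩, rfl⟩ := h.surj n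
    obtain ⟨q, rfl⟩ := hs.surj k
    exact ⟨(q, y), rfl⟩
  have hfk : ∀ k, f k = (x • k, (f k).2) := fun k => Prod.ext (hf k) rfl
  let f' : K' →ₗ[R] K' × P := (x • LinearMap.id).prod (-s)
  let g0 : K' × P →ₗ[R] P × F :=
    (s.comp (LinearMap.fst R K' P) + x • LinearMap.snd R K' P).prod
      (((LinearMap.snd R K F).comp f).comp (p.comp (LinearMap.snd R K' P)))
  have hg0 : ∀ k q, g0 (k, q) = (s k + x • q, (f (p q)).2) := fun k q => rfl
  let g' : K' × P →ₗ[R] LinearMap.ker (g.comp (p.prodMap (LinearMap.id : F →ₗ[R] F))) :=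
    g0.codRestrict _ (by
      rintro ⟨k, q⟩
      rw [hg0, LinearMap.mem_ker]
      change g (p (s k + x • q), (f (p q)).2) = 0
      rw [map_add, hs.gf, zero_add, map_smul, ← hfk, h.gf])
  refine ⟨.of R _, _, f', g', SES.of_ker _ hp, ⟨?_, ?_, ?_⟩, fun k => rfl⟩
  · intro k k' hkk
    have := congrArg Prod.snd hkk
    exact hs.inj (neg_injective this)
  · rintro ⟨⟨a, y⟩, hay⟩
    obtain ⟨k0, hk0⟩ := (h.ex _).1 hay
    obtain ⟨p0, rfl⟩ := hs.surj k0
    have hk0' : f (p p0) = (p a, y) := hk0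
    have h1 : x • p p0 = p a := by rw [← hf, hk0']
    obtain ⟨k', hk'⟩ := (hs.ex (a - x • p0)).1 (by rw [map_sub, map_smul, h1, sub_self])
    refine ⟨(k', p0), Subtype.ext ?_⟩
    change g0 (k', p0) = (a, y)
    rw [hg0, hk', hk0']; simp
  · rintro ⟨k', p0⟩
    constructor
    · intro hh
      have hh' : (s k' + x • p0, (f (p p0)).2) = (0 : P × F) := congrArg Subtype.val hh
      have e1 : s k' + x • p0 = 0 := congrArg Prod.fst hh'
      have e2 : (f (p p0)).2 = 0 := congrArg Prod.snd hh'
      have e3 : x • p p0 = 0 := by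
        have := congrArg p e1
        rwa [map_add, hs.gf, zero_add, map_smul, map_zero] at this
      have e4 : p p0 = 0 := by
        apply h.inj
        rw [hfk, e3, e2, map_zero]; rfl
      obtain ⟨k2, rfl⟩ := (hs.ex _).1 e4
      refine ⟨-k2, Prod.ext (hs.inj ?_) ?_⟩
      · change s (x • -k2) = s k'
        rw [eq_neg_of_add_eq_zero_left e1]; simp
      · change - s (-k2) = s k2
        simp
    · rintro ⟨k2, hk2⟩
      rw [← hk2]
      refine Subtype.ext ?_
      change (s (x • k2) + x • (- s k2), (f (p (- s k2))).2) = (0 : P × F)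
      rw [map_neg, hs.gf]; simp

theorem shape_res [IsNoetherianRing R] [IsLocalRing R] {x : R} (hx : x ∈ maximalIdeal R) (e : ℕ) :
    ∀ (K N : Type u) [AddCommGroup K] [Module R K] [AddCommGroup N] [Module R N] [Module.Finite R K]
      (m : ℕ) (f : K →ₗ[R] K × (Fin m → R)) (g : K × (Fin m → R) →ₗ[R] N),
      SES f g → (∀ k, (f k).1 = x • k) → ResDimLE R (GPc R) e (.of R N) →
      ResDimLE R (GPc R) e (.of R K) := by
  induction e with
  | zero =>
    intro K N _ _ _ _ _ m f g h hf hN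
    have : Module.Finite R N := h.finite_right
    exact (shape_gc hx h hf (gc_of_gpc hN)).2
  | succ e ih =>
    intro K N _ _ _ _ _ m f g h hf hN
    obtain ⟨n, K', s, p, hK', hs⟩ := fg_cover (R := R) K
    obtain ⟨N', a, f', g', ha, h', hf'⟩ := shape_syz h hf hs
    have hN' := res_syz (K := N') gpc_resolving ha inferInstance hN
    exact Paper.ResDimLE.cons gpc_iso (A := K') hs (gpc_proj _ inferInstance)
      (ih K' N' n f' g' h' hf' hN')

theorem res_ext (hQ : Module.Projective R Q) (e : ℕ) : ∀ (L : Type u) [AddCommGroup L] [Module R L],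
    ResDimLE R (GPc R) e (.of R L) → ∀ j, ExtV R L Q (j+e+1) := by
  induction e with
  | zero => intro L _ _ h j; exact (gpc_gps _ h).1 (.of R Q) hQ j
  | succ e ih =>
    intro L _ _ h j
    rcases Paper.ResDimLE.exists_ses h with h | ⟨A, B, f, g, hs, hB, hA⟩
    · have := ih L h (j+1)
      rwa [show j + (e+1) + 1 = j + 1 + e + 1 by ring]
    · exact hs.con3 (ih A hA j) ((gpc_gps _ hB).1 (.of R Q) hQ (j+e+1))

theorem res_drop [IsNoetherianRing R] (e : ℕ) : ∀ (L : Type u) [AddCommGroup L] [Module R L]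
    [Module.Finite R L], ResDimLE R (GPc R) (e+1) (.of R L) → (∀ j, ExtV R L R (j+e+1)) →
    ResDimLE R (GPc R) e (.of R L) := by
  induction e with
  | zero =>
    intro L _ _ _ h hE
    obtain ⟨n, K, f, g, hK, hs⟩ := fg_cover (R := R) L
    have hK' : GPc R K := res_syz (K := K) gpc_resolving hs inferInstance h
    exact (gc_coker hs (gc_of_gpc hK') hE).2
  | succ e ih =>
    intro L _ _ _ h hE
    obtain ⟨n, K, f, g, hK, hs⟩ := fg_cover (R := R) L
    have hK' := res_syz (K := K) gpc_resolving hs inferInstance h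
    exact Paper.ResDimLE.cons gpc_iso (A := K) hs (gpc_proj _ inferInstance)
      (ih K hK' fun j => hs.con1 (extV_proj inferInstance _) (hE j))

/-- Change along a regular element. -/
theorem res_regular [IsNoetherianRing R] [IsLocalRing R] [Module.Finite R M] [Nontrivial M] {x : R}
    (hx : x ∈ maximalIdeal R) {g : M →ₗ[R] N} (h : SES (x • LinearMap.id : M →ₗ[R] M) g) {e : ℕ}
    (hN : ResDimLE R (GPc R) e (.of R N)) : ∃ e', e = e' + 1 ∧ ResDimLE R (GPc R) e' (.of R M) := by
  have hfN : Module.Finite R N := h.finite_right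
  let f' : M →ₗ[R] M × (Fin 0 → R) := (x • LinearMap.id).prod 0
  have h' : SES f' (g.comp (LinearMap.fst R M (Fin 0 → R))) := by
    refine ⟨fun a b hab => h.inj (congrArg Prod.fst hab), h.surj.comp LinearMap.fst_surjective, ?_⟩
    rintro ⟨a, b⟩
    refine (h.ex a).trans ⟨?_, ?_⟩
    · rintro ⟨c, rfl⟩
      exact ⟨c, Prod.ext rfl (Subsingleton.elim _ _)⟩
    · rintro ⟨c, hc⟩
      exact ⟨c, congrArg Prod.fst hc⟩
  have hM := shape_res hx e M N 0 f' _ h' (fun k => rfl) hN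
  cases e with
  | zero =>
    exfalso
    have hd := h.hom (gc_extR (gc_of_gpc (L := N) hN) 0)
    have := finite_dual (R := R) M
    have hz : Subsingleton (M →ₗ[R] R) := nak0 (R := R) hx fun φ => by
      obtain ⟨ψ, rfl⟩ := hd.surj φ
      exact ⟨ψ, LinearMap.ext fun m => map_smul ψ x m⟩
    have hinj := gc_ev_inj (gc_of_gpc (L := M) hM)
    obtain ⟨a, b, hab⟩ := exists_pair_ne M
    exact hab (hinj (LinearMap.ext fun φ => by rw [Subsingleton.elim φ 0]; simp))
  | succ e =>
    refine ⟨e, rfl, res_drop e M hM fun j => ?_⟩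
    have hE : ExtV R N R (j + e + 1 + 1) := res_ext inferInstance (e+1) N hN j
    exact ext_nak hx (x • LinearMap.id) LinearMap.id rfl _ (h.ext_surj1 hE)
      (ext_surj_split (c := LinearMap.id) rfl)
end G5
end FileG5

section FileH1
open CategoryTheory IsLocalRing Paper TensorProduct

section H1
variable {R : Type u} [CommRing R] {A B C Q K X L F N M Y S : Type u} [AddCommGroup A] [Module R A]
    [AddCommGroup B] [Module R B] [AddCommGroup C] [Module R C]
    [AddCommGroup Q] [Module R Q] [AddCommGroup K] [Module R K] [AddCommGroup X] [Module R X]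
    [AddCommGroup L] [Module R L] [AddCommGroup F] [Module R F] [AddCommGroup N] [Module R N]
    [AddCommGroup M] [Module R M] [AddCommGroup Y] [Module R Y] [AddCommGroup S] [Module R S]

theorem SES.tensor (S : Type u) [AddCommGroup S] [Module R S] [Module.Flat R S]
    {f : A →ₗ[R] B} {g : B →ₗ[R] C} (h : SES f g) : SES (f.lTensor S) (g.lTensor S) :=
  ⟨Module.Flat.lTensor_preserves_injective_linearMap f h.inj, LinearMap.lTensor_surjective S h.surj,
    lTensor_exact S h.ex h.surj⟩

theorem flat_prod (hA : Module.Flat R A) (hB : Module.Flat R B) : Module.Flat R (A × B) := by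
  rw [Module.Flat.iff_lTensor_preserves_injective_linearMap]
  intro N N' _ _ _ _ h hh
  have key : ((TensorProduct.prodLeft R R A B N').toLinearMap.comp (h.lTensor (A × B))) =
      (LinearMap.prodMap (h.lTensor A) (h.lTensor B)).comp
        (TensorProduct.prodLeft R R A B N).toLinearMap :=
    TensorProduct.ext' fun ⟨a, b⟩ n => by simp
  have h4 : Function.Injective ((TensorProduct.prodLeft R R A B N').toLinearMap.comp
      (h.lTensor (A × B))) := by
    rw [key]
    exact ((Module.Flat.lTensor_preserves_injective_linearMap h hh).prodMap
      (Module.Flat.lTensor_preserves_injective_linearMap h hh)).comp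
        (TensorProduct.prodLeft R R A B N).injective
  intro x y hxy
  exact h4 (congrArg (TensorProduct.prodLeft R R A B N') hxy)

theorem bicF_iso : IsoClosed R (Bic (rF R)) := by
  intro A B _ _ _ _ e h
  obtain ⟨S, hS, hA⟩ := h
  refine ⟨fun G => ∃ G' : ModuleCat.{u} R, S G' ∧ Nonempty (G ≃ₗ[R] G'), ?_, .of R A, hA, ⟨e.symm⟩⟩
  rintro G ⟨G', hG, ⟨e⟩⟩
  obtain ⟨⟨B, ⟨F, f, g, hF, hs, hI⟩, hB⟩, ⟨A, ⟨F', f', g', hF', hs', hI'⟩, hA⟩⟩ := hS G' hG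
  refine ⟨⟨B, ⟨F, f.comp e.toLinearMap, g, hF, hs.trans_equiv_left e, fun I hi => ?_⟩,
      B, hB, ⟨LinearEquiv.refl R B⟩⟩,
    ⟨A, ⟨F', f', e.symm.toLinearMap.comp g', hF', hs'.trans_equiv_right e.symm, hI'⟩,
      A, hA, ⟨LinearEquiv.refl R A⟩⟩⟩
  rw [LinearMap.rTensor_comp]
  exact (hI I hi).comp (e.rTensor I).injective

theorem rF_prod {A B A' B' : ModuleCat.{u} R} (h : rF R A B) (h' : rF R A' B') :
    rF R (.of R (A × A')) (.of R (B × B')) := by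
  obtain ⟨F, f, g, hF, hs, hI⟩ := h
  obtain ⟨F', f', g', hF', hs', hI'⟩ := h'
  refine ⟨.of R (F × F'), LinearMap.prodMap f f', LinearMap.prodMap g g',
    flat_prod hF hF', ⟨?_, ?_, ?_⟩, fun I hi => ?_⟩
  · exact hs.inj.prodMap hs'.inj
  · exact hs.surj.prodMap hs'.surj
  · rintro ⟨x, y⟩
    constructor
    · intro hxy
      obtain ⟨a, rfl⟩ := (hs.ex x).1 (congrArg Prod.fst hxy)
      obtain ⟨b, rfl⟩ := (hs'.ex y).1 (congrArg Prod.snd hxy)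
      exact ⟨(a, b), rfl⟩
    · rintro ⟨⟨a, b⟩, hab⟩
      rw [← hab]
      exact Prod.ext (hs.gf a) (hs'.gf b)
  · rw [rT_iff]
    intro φ
    obtain ⟨ψ, hψ⟩ := (rT_iff f).1 (hI I hi) (φ.comp (LinearMap.inl R A A'))
    obtain ⟨ψ', hψ'⟩ := (rT_iff f').1 (hI' I hi) (φ.comp (LinearMap.inr R A A'))
    refine ⟨ψ.coprod ψ', LinearMap.ext ?_⟩
    rintro ⟨a, b⟩
    have h1 : ψ (f a) = φ (a, 0) := LinearMap.congr_fun hψ a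
    have h2 : ψ' (f' b) = φ (0, b) := LinearMap.congr_fun hψ' b
    change ψ (f a) + ψ' (f' b) = φ (a, b)
    rw [h1, h2]
    exact (map_add φ (a, 0) (0, b)).symm.trans (by simp)

theorem rF_tensor (S : Type u) [AddCommGroup S] [Module R S] [Module.Flat R S]
    {A B : ModuleCat.{u} R} (h : rF R A B) :
    rF R (.of R (S ⊗[R] A)) (.of R (S ⊗[R] B)) := by
  obtain ⟨F, f, g, hF, hs, hI⟩ := h
  refine ⟨.of R (S ⊗[R] F), f.lTensor S, g.lTensor S,
    inferInstanceAs (Module.Flat R (S ⊗[R] F)), hs.tensor S, fun I hi => ?_⟩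
  have h1 := Module.Flat.lTensor_preserves_injective_linearMap (M := S) _ (hI I hi)
  have h2 := LinearMap.lTensor_rTensor_comp_assoc (P := S) (Q := I) (x := f)
  have h3 : (TensorProduct.assoc R S F I).toLinearMap.comp ((f.lTensor S).rTensor I) =
      (LinearMap.lTensor S (f.rTensor I)).comp (TensorProduct.assoc R S A I).toLinearMap := by
    rw [h2]
  have h4 : Function.Injective ((TensorProduct.assoc R S F I).toLinearMap.comp ((f.lTensor S).rTensor I)) := by
    rw [h3]; exact h1.comp (TensorProduct.assoc R S A I).injective
  exact Function.Injective.of_comp h4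

theorem bicF_prod (hA : Bic (rF R) (.of R A)) (hB : Bic (rF R) (.of R B)) :
    Bic (rF R) (.of R (A × B)) := by
  obtain ⟨S, hS, hA⟩ := hA
  obtain ⟨T, hT, hB⟩ := hB
  refine ⟨fun G => ∃ X Y : ModuleCat.{u} R, S X ∧ T Y ∧ G = .of R (X × Y), ?_, _, _, hA, hB, rfl⟩
  rintro _ ⟨X, Y, hX, hY, rfl⟩
  obtain ⟨⟨B, hr, hB⟩, ⟨A, hrA, hA⟩⟩ := hS X hX
  obtain ⟨⟨B', hr', hB'⟩, ⟨A', hrA', hA'⟩⟩ := hT Y hY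
  exact ⟨⟨_, rF_prod hr hr', _, _, hB, hB', rfl⟩, ⟨_, rF_prod hrA hrA', _, _, hA, hA', rfl⟩⟩

theorem bicF_tensor (S : Type u) [AddCommGroup S] [Module R S] [Module.Flat R S]
    (hA : Bic (rF R) (.of R A)) : Bic (rF R) (.of R (S ⊗[R] A)) := by
  obtain ⟨T, hT, hA⟩ := hA
  refine ⟨fun G => ∃ X : ModuleCat.{u} R, T X ∧ G = .of R (S ⊗[R] X), ?_, _, hA, rfl⟩
  rintro _ ⟨X, hX, rfl⟩
  obtain ⟨⟨B, hr, hB⟩, ⟨A, hrA, hA⟩⟩ := hT X hX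
  exact ⟨⟨_, rF_tensor S hr, _, hB, rfl⟩, ⟨_, rF_tensor S hrA, _, hA, rfl⟩⟩

/-- `k ↦ s ⊗ k`. -/
theorem res_cone [Module.Flat R S] (s : S) {a : ℕ} (hK : ResDimLE R (Bic (rF R)) a (.of R K))
    (hX : Bic (rF R) (.of R X)) (φ : K →ₗ[R] X) {g : X × (S ⊗[R] K) →ₗ[R] C}
    (h : SES (φ.prod (TensorProduct.mk R S K s)) g) :
    ResDimLE R (Bic (rF R)) (a+1) (.of R C) := by
  induction a generalizing K X C with
  | zero => exact Paper.ResDimLE.cons bicF_iso h (bicF_prod hX (bicF_tensor S hK)) hK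
  | succ a ih =>
    rcases Paper.ResDimLE.exists_ses hK with hK | ⟨K', X', i, p, hs, hX', hK'⟩
    · exact (ih hK hX φ h).succ
    have ht := hs.tensor S
    let q : X × (S ⊗[R] X') →ₗ[R] C := g.comp (LinearMap.prodMap LinearMap.id (p.lTensor S))
    have hq : Function.Surjective q := h.surj.comp (Function.surjective_id.prodMap ht.surj)
    let j : X' × (S ⊗[R] K') →ₗ[R] X × (S ⊗[R] X') :=
      LinearMap.prod ((φ.comp p).comp (LinearMap.fst R X' (S ⊗[R] K')))
        (LinearMap.coprod (TensorProduct.mk R S X' s) (- i.lTensor S))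
    have hj : ∀ z w, j (z, w) = (φ (p z), s ⊗ₜ z - i.lTensor S w) := fun z w => by
      refine Prod.ext rfl ?_
      change s ⊗ₜ z + -(i.lTensor S w) = _
      rw [sub_eq_add_neg]
    have hjq : ∀ t, q (j t) = 0 := by
      rintro ⟨z, w⟩
      rw [hj]
      change g (φ (p z), p.lTensor S (s ⊗ₜ z - i.lTensor S w)) = 0
      rw [map_sub, ht.gf, sub_zero, LinearMap.lTensor_tmul]
      exact h.gf (p z)
    let r : X' × (S ⊗[R] K') →ₗ[R] LinearMap.ker q := j.codRestrict _ hjq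
    have hr : SES (i.prod (TensorProduct.mk R S K' s)) r := by
      refine ⟨fun a b hab => hs.inj (congrArg Prod.fst hab), ?_, ?_⟩
      · rintro ⟨⟨x, z⟩, hxz⟩
        obtain ⟨k, hk⟩ := (h.ex _).1 (show g (x, p.lTensor S z) = 0 from hxz)
        obtain ⟨x', rfl⟩ := hs.surj k
        have h1 : φ (p x') = x := congrArg Prod.fst hk
        have h2 : s ⊗ₜ p x' = p.lTensor S z := congrArg Prod.snd hk
        obtain ⟨w, hw⟩ := (ht.ex (s ⊗ₜ x' - z)).1 (by
          rw [map_sub, LinearMap.lTensor_tmul, h2, sub_self])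
        refine ⟨(x', w), Subtype.ext ?_⟩
        change j (x', w) = (x, z)
        rw [hj, h1, hw, sub_sub_cancel]
      · rintro ⟨z, w⟩
        have key : r (z, w) = 0 ↔ φ (p z) = 0 ∧ s ⊗ₜ z = i.lTensor S w := by
          rw [← Subtype.val_inj]
          change j (z, w) = 0 ↔ _
          rw [hj, Prod.mk_eq_zero, sub_eq_zero]
        rw [key]
        constructor
        · rintro ⟨h1, h2⟩
          have h3 : p z = 0 := by
            apply h.inj
            rw [map_zero]
            refine Prod.ext h1 ?_
            change s ⊗ₜ p z = 0
            have := congrArg (p.lTensor S) h2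
            rwa [ht.gf, LinearMap.lTensor_tmul] at this
          obtain ⟨k, rfl⟩ := (hs.ex z).1 h3
          refine ⟨k, Prod.ext rfl (ht.inj ?_)⟩
          change i.lTensor S (s ⊗ₜ k) = i.lTensor S w
          rw [← h2, LinearMap.lTensor_tmul]
        · rintro ⟨k, hk⟩
          have h1 : i k = z := congrArg Prod.fst hk
          have h2 : s ⊗ₜ k = w := congrArg Prod.snd hk
          subst h1 h2
          refine ⟨by rw [hs.gf, map_zero], ?_⟩
          rw [LinearMap.lTensor_tmul]
    have h5 := ih (K := K') (X := X') (C := LinearMap.ker q) hK' hX' i hr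
    exact Paper.ResDimLE.cons bicF_iso (SES.of_ker q hq) (bicF_prod hX (bicF_tensor S hX')) h5

theorem bicF_zero : Bic (rF R) (.of R PUnit.{u+1}) := by
  refine ⟨fun G => G = .of R PUnit.{u+1}, ?_, rfl⟩
  rintro _ rfl
  have : rF R (.of R PUnit.{u+1}) (.of R PUnit.{u+1}) := by
    refine ⟨.of R PUnit.{u+1}, LinearMap.id, LinearMap.id, inferInstanceAs (Module.Flat R PUnit.{u+1}),
      ⟨Function.injective_id, Function.surjective_id, fun x => ?_⟩, fun I hi => ?_⟩
    · exact ⟨fun _ => ⟨x, rfl⟩, fun _ => rfl⟩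
    · rw [LinearMap.rTensor_id]; exact Function.injective_id
  exact ⟨⟨_, this, rfl⟩, ⟨_, this, rfl⟩⟩

theorem res_coker [Module.Flat R S] (s : S) {a : ℕ} (hK : ResDimLE R (Bic (rF R)) a (.of R K))
    {g : S ⊗[R] K →ₗ[R] C} (h : SES (TensorProduct.mk R S K s) g) :
    ResDimLE R (Bic (rF R)) (a+1) (.of R C) := by
  refine res_cone (X := PUnit.{u+1}) s hK bicF_zero 0
    (g := g.comp (LinearMap.snd R PUnit.{u+1} (S ⊗[R] K))) ⟨?_, ?_, ?_⟩
  · intro a b hab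
    exact h.inj (congrArg Prod.snd hab)
  · exact h.surj.comp LinearMap.snd_surjective
  · rintro ⟨_, w⟩
    refine (h.ex w).trans ⟨fun ⟨k, hk⟩ => ⟨k, Prod.ext rfl hk⟩, fun ⟨k, hk⟩ => ⟨k, congrArg Prod.snd hk⟩⟩
end H1
end FileH1

section FileE1
open CategoryTheory IsLocalRing Paper TensorProduct Pointwise

/-- `coker (A → A_y)` -/
noncomputable def Tm {R : Type u} [CommRing R] (y : R) (A : ModuleCat.{u} R) : ModuleCat.{u} R :=
  .of R ((Localization.Away y ⊗[R] A) ⧸ LinearMap.range (TensorProduct.mk R (Localization.Away y) A 1))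

noncomputable def TT {R : Type u} [CommRing R] : List R → ModuleCat.{u} R → ModuleCat.{u} R
  | [], A => A
  | y :: ys, A => TT ys (Tm y A)

def Rg {R : Type u} [CommRing R] : List R → ModuleCat.{u} R → Prop
  | [], _ => True
  | y :: ys, A => IsSMulRegular A y ∧ Rg ys (Tm y A)

def Kx {R : Type u} [CommRing R] (x : R) (A D : ModuleCat.{u} R) : Prop :=
  (∃ f : A →ₗ[R] D, SES f (x • LinearMap.id : D →ₗ[R] D)) ∧ ∀ d : D, ∃ k : ℕ, x ^ k • d = 0

def KCh {R : Type u} [CommRing R] : List R → ModuleCat.{u} R → ModuleCat.{u} R → Prop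
  | [], A, D => Nonempty (A ≃ₗ[R] D)
  | x :: xs, A, D => ∃ D', KCh xs A D' ∧ Kx x D' D

section E1
variable {R : Type u} [CommRing R] 

noncomputable def Tq (y : R) (A : ModuleCat.{u} R) : Localization.Away y ⊗[R] A →ₗ[R] Tm y A :=
  (LinearMap.range (TensorProduct.mk R (Localization.Away y) A 1)).mkQ

theorem Tq_surj (y : R) (A : ModuleCat.{u} R) : Function.Surjective (Tq y A) :=
  Submodule.mkQ_surjective _

theorem Tq_ex (y : R) (A : ModuleCat.{u} R) :
    Function.Exact (TensorProduct.mk R (Localization.Away y) A 1) (Tq y A) :=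
  fun x => (Submodule.Quotient.mk_eq_zero _)

theorem loc_mk (y : R) (A : ModuleCat.{u} R) :
    IsLocalizedModule (Submonoid.powers y) (TensorProduct.mk R (Localization.Away y) A 1) :=
  (isLocalizedModule_iff_isBaseChange (Submonoid.powers y) (Localization.Away y) _).2
    (TensorProduct.isBaseChange R A (Localization.Away y))

theorem reg_pow {y : R} {A : ModuleCat.{u} R} (h : IsSMulRegular A y) {k : ℕ} {a : A}
    (ha : y ^ k • a = 0) : a = 0 :=
  (h.pow k) (ha.trans (smul_zero _).symm)

theorem Tm_ses {y : R} {A : ModuleCat.{u} R} (h : IsSMulRegular A y) :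
    SES (TensorProduct.mk R (Localization.Away y) A 1) (Tq y A) := by
  refine ⟨?_, Tq_surj y A, Tq_ex y A⟩
  have := loc_mk y A
  rw [injective_iff_map_eq_zero]
  intro a ha
  obtain ⟨⟨_, k, rfl⟩, hk⟩ := (IsLocalizedModule.eq_zero_iff (Submonoid.powers y) _).1 ha
  exact reg_pow h hk

theorem loc_bij (y : R) (A : ModuleCat.{u} R) :
    Function.Bijective (fun s : Localization.Away y ⊗[R] A => y • s) := by
  have := loc_mk y A
  exact (Module.End.isUnit_iff _).1 (IsLocalizedModule.map_units
    (TensorProduct.mk R (Localization.Away y) A 1) (⟨y, Submonoid.mem_powers y⟩ : Submonoid.powers y))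

theorem SES.tmap {y : R} {A B C : ModuleCat.{u} R} {f : A →ₗ[R] B} {g : B →ₗ[R] C} (h : SES f g)
    (hA : IsSMulRegular A y) (hB : IsSMulRegular B y) (hC : IsSMulRegular C y) :
    ∃ (f' : Tm y A →ₗ[R] Tm y B) (g' : Tm y B →ₗ[R] Tm y C), SES f' g' ∧
      (∀ t, g' (Tq y B t) = Tq y C (g.lTensor _ t)) := by
  have a := Tm_ses hA
  have b := Tm_ses hB
  have c := Tm_ses hC
  have t : SES (f.lTensor (Localization.Away y)) (g.lTensor (Localization.Away y)) :=
    ⟨Module.Flat.lTensor_preserves_injective_linearMap f h.inj, LinearMap.lTensor_surjective _ h.surj,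
    lTensor_exact _ h.ex h.surj⟩
  let f' : Tm y A →ₗ[R] Tm y B := Submodule.mapQ _ _ (f.lTensor (Localization.Away y)) (by
    rintro _ ⟨z, rfl⟩; exact ⟨f z, rfl⟩)
  let g' : Tm y B →ₗ[R] Tm y C := Submodule.mapQ _ _ (g.lTensor (Localization.Away y)) (by
    rintro _ ⟨z, rfl⟩; exact ⟨g z, rfl⟩)
  have hf' : ∀ t, f' (Tq y A t) = Tq y B (f.lTensor _ t) := fun t => rfl
  have hg' : ∀ t, g' (Tq y B t) = Tq y C (g.lTensor _ t) := fun t => rfl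
  refine ⟨f', g', ⟨?_, ?_, ?_⟩, hg'⟩
  · rw [injective_iff_map_eq_zero]
    intro z hz
    obtain ⟨z, rfl⟩ := a.surj z
    rw [hf'] at hz
    obtain ⟨w, hw⟩ := (b.ex _).1 hz
    have h0 : g w = 0 := by
      apply c.inj
      rw [map_zero]
      have := congrArg (g.lTensor (Localization.Away y)) hw
      rw [t.gf] at this
      exact this
    obtain ⟨v, rfl⟩ := (h.ex _).1 h0
    have : TensorProduct.mk R (Localization.Away y) A 1 v = z := t.inj hw
    rw [← this, a.gf]
  · intro z
    obtain ⟨z, rfl⟩ := c.surj z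
    obtain ⟨z, rfl⟩ := t.surj z
    exact ⟨Tq y B z, hg' z⟩
  · intro z
    obtain ⟨z, rfl⟩ := b.surj z
    constructor
    · intro hz
      rw [hg'] at hz
      obtain ⟨w, hw⟩ := (c.ex _).1 hz
      obtain ⟨w, rfl⟩ := h.surj w
      obtain ⟨v, hv⟩ := (t.ex (z - TensorProduct.mk R (Localization.Away y) B 1 w)).1 (by
        rw [map_sub, ← hw]; exact sub_self _)
      refine ⟨Tq y A v, ?_⟩
      rw [hf', hv, map_sub, b.gf, sub_zero]
    · rintro ⟨w, hw⟩
      obtain ⟨w, rfl⟩ := a.surj w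
      rw [← hw, hf', hg', t.gf, map_zero]

theorem Kx.reg {x y : R} {A D : ModuleCat.{u} R} (h : Kx x A D) (hA : IsSMulRegular A y) :
    IsSMulRegular D y := by
  obtain ⟨⟨f, hs⟩, ht⟩ := h
  have key : ∀ (k : ℕ) (d : D), x ^ k • d = 0 → y • d = 0 → d = 0 := by
    intro k
    induction k with
    | zero => intro d hd _; simpa using hd
    | succ k ih =>
      intro d hd hy
      refine ih d ?_ hy
      have h1 : (x • LinearMap.id : D →ₗ[R] D) (x ^ k • d) = 0 := by
        change x • x ^ k • d = 0
        rw [smul_smul, ← pow_succ', hd]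
      obtain ⟨a, ha⟩ := (hs.ex _).1 h1
      have : a = 0 := by
        apply hA
        apply hs.inj
        change f (y • a) = f (y • 0)
        rw [map_smul, ha, smul_zero, map_zero, smul_comm, hy, smul_zero]
      rw [← ha, this, map_zero]
  intro a b hab
  obtain ⟨k, hk⟩ := ht (a - b)
  exact sub_eq_zero.1 (key k _ hk (by rw [smul_sub]; exact sub_eq_zero.2 hab))

theorem Kx.tmap {x y : R} {A D : ModuleCat.{u} R} (h : Kx x A D) (hA : IsSMulRegular A y) :
    Kx x (Tm y A) (Tm y D) := by
  have hD := h.reg hA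
  obtain ⟨⟨f, hs⟩, ht⟩ := h
  obtain ⟨f', g', hs', hg'⟩ := hs.tmap hA hD hD
  refine ⟨⟨f', ?_⟩, ?_⟩
  · have : g' = x • LinearMap.id := by
      refine LinearMap.ext fun z => ?_
      obtain ⟨z, rfl⟩ := Tq_surj y D z
      rw [hg', LinearMap.lTensor_smul, LinearMap.lTensor_id]
      change Tq y D (x • z) = x • Tq y D z
      rw [map_smul]
    rw [← this]; exact hs'
  · intro z
    obtain ⟨z, rfl⟩ := Tq_surj y D z
    suffices ∃ k : ℕ, x ^ k • z = 0 by
      obtain ⟨k, hk⟩ := this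
      exact ⟨k, by rw [← map_smul, hk, map_zero]⟩
    induction z using TensorProduct.induction_on with
    | zero => exact ⟨0, by simp⟩
    | tmul s d =>
      obtain ⟨k, hk⟩ := ht d
      exact ⟨k, by rw [← TensorProduct.tmul_smul, hk, TensorProduct.tmul_zero]⟩
    | add a b ha hb =>
      obtain ⟨k, hk⟩ := ha
      obtain ⟨l, hl⟩ := hb
      refine ⟨k + l, ?_⟩
      rw [smul_add, pow_add, mul_smul, mul_smul, hl, smul_zero, add_zero, smul_comm, hk, smul_zero]

theorem Kx.ttmap {x : R} {ys : List R} {A D : ModuleCat.{u} R} (h : Kx x A D) (hA : Rg ys A) :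
    Rg ys D ∧ Kx x (TT ys A) (TT ys D) := by
  induction ys generalizing A D with
  | nil => exact ⟨trivial, h⟩
  | cons y ys ih =>
    obtain ⟨h1, h2⟩ := ih (h.tmap hA.1) hA.2
    exact ⟨⟨h.reg hA.1, h1⟩, h2⟩

theorem Kx_base {y : R} {A : ModuleCat.{u} R} (h : IsSMulRegular A y) :
    Kx y (.of R (QuotSMulTop y A)) (Tm y A) := by
  have hs := Tm_ses h
  have hb := loc_bij y A
  constructor
  · let e : (Localization.Away y ⊗[R] A) ≃ₗ[R] (Localization.Away y ⊗[R] A) :=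
      LinearEquiv.ofBijective (y • LinearMap.id) hb
    have he : ∀ z, y • e.symm z = z := fun z => e.apply_symm_apply z
    let φ : A →ₗ[R] Tm y A := (Tq y A).comp (e.symm.toLinearMap.comp
      (TensorProduct.mk R (Localization.Away y) A 1))
    have hφ : ∀ a, φ a = Tq y A (e.symm (TensorProduct.mk R (Localization.Away y) A 1 a)) := fun _ => rfl
    have hk : y • (⊤ : Submodule R A) = LinearMap.ker φ := by
      ext a
      rw [LinearMap.mem_ker, hφ, hs.ex _, Submodule.mem_smul_pointwise_iff_exists]
      constructor
      · rintro ⟨b, -, rfl⟩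
        refine ⟨b, hb.1 ?_⟩
        change y • _ = y • _
        rw [he, map_smul]
      · rintro ⟨b, hb⟩
        refine ⟨b, trivial, hs.inj ?_⟩
        rw [map_smul, hb, he]
    let f : QuotSMulTop y A →ₗ[R] Tm y A := (y • (⊤ : Submodule R A)).liftQ φ hk.le
    have hf : ∀ a, f (Submodule.Quotient.mk a) = φ a := fun _ => rfl
    refine ⟨f, ?_, ?_, ?_⟩
    · rw [← LinearMap.ker_eq_bot]
      exact Submodule.ker_liftQ_eq_bot _ _ _ hk.ge
    · intro z
      obtain ⟨z, rfl⟩ := hs.surj z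
      refine ⟨Tq y A (e.symm z), ?_⟩
      change y • Tq y A (e.symm z) = Tq y A z
      rw [← map_smul, he]
    · intro z
      obtain ⟨z, rfl⟩ := hs.surj z
      change y • Tq y A z = 0 ↔ _
      rw [← map_smul, hs.ex]
      constructor
      · rintro ⟨a, ha⟩
        refine ⟨Submodule.Quotient.mk a, ?_⟩
        change φ a = _
        rw [hφ, ha]
        exact congrArg (Tq y A) (e.symm_apply_apply z)
      · rintro ⟨w, hw⟩
        obtain ⟨a, rfl⟩ := Submodule.Quotient.mk_surjective _ w
        change φ a = _ at hw
        have := congrArg (y • ·) hw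
        change y • _ = y • _ at this
        rw [hφ, ← map_smul, he, hs.gf, ← map_smul] at this
        exact (hs.ex _).1 this.symm
  · intro z
    obtain ⟨z, rfl⟩ := hs.surj z
    have := loc_mk y A
    obtain ⟨⟨m, ⟨_, k, rfl⟩⟩, hm⟩ := IsLocalizedModule.surj (Submonoid.powers y)
      (TensorProduct.mk R (Localization.Away y) A 1) z
    refine ⟨k, ?_⟩
    rw [← map_smul]
    have : y ^ k • z = TensorProduct.mk R (Localization.Away y) A 1 m := hm
    rw [this, hs.gf]

theorem KCh.iso {xs : List R} {A A' D : ModuleCat.{u} R} (e : A' ≃ₗ[R] A) (h : KCh xs A D) :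
    KCh xs A' D := by
  induction xs generalizing D with
  | nil => exact h.elim fun e' => ⟨e.trans e'⟩
  | cons x xs ih =>
    obtain ⟨D', h1, h2⟩ := h
    exact ⟨D', ih h1, h2⟩

theorem reg_kch (rs : List R) (A : ModuleCat.{u} R) (h : RingTheory.Sequence.IsWeaklyRegular A rs) :
    Rg rs A ∧ KCh rs (.of R (A ⧸ (Ideal.ofList rs • ⊤ : Submodule R A))) (TT rs A) := by
  induction rs generalizing A with
  | nil =>
    refine ⟨trivial, ⟨?_⟩⟩
    refine Submodule.quotEquivOfEqBot _ ?_
    simp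
  | cons y ys ih =>
    rw [RingTheory.Sequence.isWeaklyRegular_cons_iff] at h
    obtain ⟨h1, h2⟩ := ih (.of R (QuotSMulTop y A)) h.2
    obtain ⟨h3, h4⟩ := (Kx_base h.1).ttmap h1
    refine ⟨⟨h.1, h3⟩, _, ?_, h4⟩
    exact KCh.iso (Submodule.quotOfListConsSMulTopEquivQuotSMulTopInner A y ys) h2

/-- elementwise torsion with respect to an ideal -/
theorem KCh.torsion {J : Ideal R} {xs : List R} {A D : ModuleCat.{u} R} 
    (h : KCh xs A D) (hA : ∀ y ∈ J, ∀ a : A, ∃ k : ℕ, y ^ k • a = 0) :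
    ∀ y ∈ J, ∀ a : D, ∃ k : ℕ, y ^ k • a = 0 := by
  induction xs generalizing D with
  | nil =>
    obtain ⟨e⟩ := h
    intro y hy a
    obtain ⟨k, hk⟩ := hA y hy (e.symm a)
    exact ⟨k, e.symm.injective (by rw [map_smul, hk, map_zero])⟩
  | cons x xs ih =>
    obtain ⟨D', h1, ⟨f, hs⟩, ht⟩ := h
    intro y hy d
    obtain ⟨k, hk⟩ := ht d
    induction k generalizing d with
    | zero => exact ⟨0, by simpa using hk⟩
    | succ k ih2 =>
      have h1' : (x • LinearMap.id : D →ₗ[R] D) (x ^ k • d) = 0 := by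
        change x • x ^ k • d = 0
        rw [smul_smul, ← pow_succ', hk]
      obtain ⟨a, ha⟩ := (hs.ex _).1 h1'
      obtain ⟨t, ht'⟩ := ih h1 y hy a
      obtain ⟨s, hs'⟩ := ih2 (y ^ t • d) (by
        rw [smul_comm, ← ha, ← map_smul, ht', map_zero])
      exact ⟨s + t, by rw [pow_add, mul_smul, hs']⟩

theorem tors_pow [IsNoetherianRing R] {J : Ideal R} {D : ModuleCat.{u} R}
    (h : ∀ y ∈ J, ∀ a : D, ∃ k : ℕ, y ^ k • a = 0) (d : D) : ∃ t : ℕ, ∀ a ∈ J ^ t, a • d = 0 := by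
  obtain ⟨t, ht⟩ := Ideal.exists_pow_le_of_le_radical_of_fg (I := J) (J := Ideal.torsionOf R D d)
    (fun y hy => by
      obtain ⟨k, hk⟩ := h y hy d
      exact ⟨k, hk⟩) (IsNoetherian.noetherian J)
  exact ⟨t, fun a ha => ht ha⟩
end E1
end FileE1

section FileZ1
open CategoryTheory IsLocalRing Paper TensorProduct Pointwise

section Z1
variable {R : Type u} [CommRing R] 

theorem TT_res {rs : List R} {A : ModuleCat.{u} R} (h : Rg rs A) {a : ℕ}
    (hA : ResDimLE R (Bic (rF R)) a A) : ResDimLE R (Bic (rF R)) (a + rs.length) (TT rs A) := by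
  induction rs generalizing A a with
  | nil => exact hA
  | cons y ys ih =>
    have h1 : ResDimLE R (Bic (rF R)) (a+1) (Tm y A) :=
      res_coker (S := Localization.Away y) (K := A) (C := Tm y A) 1 hA (Tm_ses h.1)
    have h2 := ih h.2 h1
    rw [List.length_cons, show a + (ys.length + 1) = a + 1 + ys.length by omega]
    exact h2

theorem TT_lc (J : Ideal R) {rs : List R} {A : ModuleCat.{u} R} (h : Rg rs A) (hJ : ∀ x ∈ rs, x ∈ J)
    (ht : ∀ d : TT rs A, ∃ t : ℕ, ∀ a ∈ J ^ t, a • d = 0) :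
    Nonempty ((localCohomology J rs.length).obj A ≅ TT rs A) := by
  induction rs generalizing A with
  | nil => exact lc_zero J A ht
  | cons y ys ih =>
    obtain ⟨e⟩ := ih h.2 (fun x hx => hJ x (List.mem_cons_of_mem _ hx)) ht
    have hs := Tm_ses h.1
    obtain ⟨e'⟩ := lc_shift J ys.length (A := A) (S := .of R (Localization.Away y ⊗[R] A)) (B := Tm y A)
      (TensorProduct.mk R (Localization.Away y) A 1) (Tq y A) hs.inj hs.surj hs.ex y
      (hJ y List.mem_cons_self) (loc_bij y A)
    exact ⟨e'.trans e⟩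

theorem KCh.res {P : ModuleCat.{u} R → Prop} (hP : Resolving R P) {xs : List R} {A D : ModuleCat.{u} R}
    (h : KCh xs A D) {e : ℕ} (hD : ResDimLE R P e D) : ResDimLE R P e A := by
  induction xs generalizing D with
  | nil =>
    obtain ⟨i⟩ := h
    exact Paper.ResDimLE.iso (A := D) (B := A) hP.iso i.symm hD
  | cons x xs ih =>
    obtain ⟨D', h1, ⟨f, hs⟩, ht⟩ := h
    exact ih h1 (res_ker (A := D') (B := D) (C := D) hP hs hD hD)

theorem quot_nontrivial [IsLocalRing R] {M : Type u} [AddCommGroup M] [Module R M] [Module.Finite R M]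
    [hM : Nontrivial M] {y : R} (hy : y ∈ maximalIdeal R) : Nontrivial (QuotSMulTop y M) := by
  rw [← not_subsingleton_iff_nontrivial]
  intro h
  have : Subsingleton M := nak0 (R := R) hy (fun m => by
    have h1 : (Submodule.Quotient.mk m : QuotSMulTop y M) = 0 := Subsingleton.elim _ _
    rw [Submodule.Quotient.mk_eq_zero, Submodule.mem_smul_pointwise_iff_exists] at h1
    obtain ⟨b, -, hb⟩ := h1
    exact ⟨b, hb.symm⟩)
  exact not_subsingleton M this

theorem quot_ses {M : Type u} [AddCommGroup M] [Module R M] {y : R} (h : IsSMulRegular M y) :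
    SES (y • LinearMap.id : M →ₗ[R] M) (y • (⊤ : Submodule R M)).mkQ := by
  refine ⟨h, Submodule.mkQ_surjective _, fun x => ?_⟩
  rw [Submodule.mkQ_apply, Submodule.Quotient.mk_eq_zero, Submodule.mem_smul_pointwise_iff_exists]
  exact ⟨fun ⟨b, _, hb⟩ => ⟨b, hb⟩, fun ⟨b, hb⟩ => ⟨b, trivial, hb⟩⟩

theorem res_regular_seq [IsNoetherianRing R] [IsLocalRing R] (rs : List R)
    (hrs : ∀ x ∈ rs, x ∈ maximalIdeal R) (M : Type u) [AddCommGroup M] [Module R M]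
    [Module.Finite R M] [Nontrivial M] (hreg : RingTheory.Sequence.IsWeaklyRegular M rs) {e : ℕ}
    (h : ResDimLE R (GPc R) e (.of R (M ⧸ (Ideal.ofList rs • ⊤ : Submodule R M)))) :
    ∃ e', e = e' + rs.length ∧ ResDimLE R (GPc R) e' (.of R M) := by
  induction rs generalizing M with
  | nil =>
    refine ⟨e, rfl, Paper.ResDimLE.iso gpc_resolving.iso (Submodule.quotEquivOfEqBot _ (by simp)) h⟩
  | cons y ys ih =>
    rw [RingTheory.Sequence.isWeaklyRegular_cons_iff] at hreg
    have hy := hrs y List.mem_cons_self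
    have := quot_nontrivial (M := M) hy
    obtain ⟨e1, he1, h1⟩ := ih (fun x hx => hrs x (List.mem_cons_of_mem _ hx)) (QuotSMulTop y M) hreg.2
      (Paper.ResDimLE.iso gpc_resolving.iso
        (Submodule.quotOfListConsSMulTopEquivQuotSMulTopInner M y ys) h)
    obtain ⟨e2, he2, h2⟩ := res_regular hy (quot_ses hreg.1) h1
    exact ⟨e2, by rw [he1, he2, List.length_cons]; omega, h2⟩

theorem exists_reg_seq [IsNoetherianRing R] [IsLocalRing R]
    (M : Type u) [AddCommGroup M] [Module R M] [Module.Finite R M]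
    (hM : Nontrivial M) (n : ℕ) (hdim : moduleDim R M = (n : WithBot ℕ∞))
    (hCM : IsCohenMacaulayModule R M) : ∃ rs : List R, rs.length = n ∧
      (∀ x ∈ rs, x ∈ maximalIdeal R) ∧ RingTheory.Sequence.IsRegular M rs := by
  rcases n with _ | n
  · exact ⟨[], rfl, by simp, RingTheory.Sequence.IsRegular.nil R M⟩
  have hd : depth R M = ((n+1 : ℕ) : ℕ∞) := by
    have : (depth R M : WithBot ℕ∞) = (((n+1 : ℕ) : ℕ∞) : WithBot ℕ∞) := by
      unfold IsCohenMacaulayModule at hCM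
      rw [hCM, hdim]; rfl
    exact WithBot.coe_injective this
  have hlt : ((n : ℕ) : ℕ∞) < depth R M := by
    rw [hd]; exact_mod_cast Nat.lt_succ_self n
  unfold depth at hlt
  obtain ⟨_, ⟨rs, rfl, h1, h2⟩, h3⟩ := lt_sSup_iff.1 hlt
  refine ⟨rs, ?_, h1, h2⟩
  have h4 : (rs.length : ℕ∞) ≤ depth R M := le_sSup ⟨rs, rfl, h1, h2⟩
  rw [hd] at h4
  have h5 : rs.length ≤ n + 1 := by exact_mod_cast h4
  have h6 : n < rs.length := by exact_mod_cast h3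
  omega

theorem quot_torsion [IsNoetherianRing R] [IsLocalRing R]
    (M : Type u) [AddCommGroup M] [Module R M] [Module.Finite R M]
    (n : ℕ) (hdim : moduleDim R M = (n : WithBot ℕ∞)) (rs : List R) (hl : rs.length = n)
    (hreg : RingTheory.Sequence.IsRegular M rs) : ∀ y ∈ maximalIdeal R,
      ∀ a : M ⧸ (Ideal.ofList rs • ⊤ : Submodule R M), ∃ k : ℕ, y ^ k • a = 0 := by
  have h1 := Module.supportDim_add_length_eq_supportDim_of_isRegular rs hreg
  rw [Module.supportDim_eq_ringKrullDim_quotient_annihilator R M] at h1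
  change _ = moduleDim R M at h1
  rw [hdim, hl] at h1
  have h2 : Module.supportDim R (M ⧸ (Ideal.ofList rs • ⊤ : Submodule R M)) = 0 := by
    generalize Module.supportDim R (M ⧸ (Ideal.ofList rs • ⊤ : Submodule R M)) = z at h1
    induction z using WithBot.recBotCoe with
    | bot => simp at h1
    | coe z =>
      have h3 : z + (n : ℕ∞) = n := by exact_mod_cast h1
      have h4 : z = 0 := by
        have h5 : z + (n : ℕ∞) = 0 + n := by rw [h3, zero_add]
        exact (ENat.add_left_injective_of_ne_top (ENat.natCast_ne_top n)) h5
      rw [h4]; rfl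
  have h3 := support_of_supportDim_eq_zero R _ h2
  rw [Module.support_eq_zeroLocus] at h3
  have h4 : maximalIdeal R ≤
      (Module.annihilator R (M ⧸ (Ideal.ofList rs • ⊤ : Submodule R M))).radical := by
    rw [← PrimeSpectrum.zeroLocus_subset_zeroLocus_iff, h3]
  intro y hy a
  obtain ⟨k, hk⟩ := h4 hy
  exact ⟨k, Module.mem_annihilator.1 hk a⟩

theorem resDim_le {P : ModuleCat.{u} R → Prop} {M : ModuleCat.{u} R} {k : ℕ}
    (h : ResDimLE R P k M) : ResDim R P M ≤ k := sInf_le ⟨k, rfl, h⟩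

theorem resDim_attained {P : ModuleCat.{u} R → Prop} {M : ModuleCat.{u} R} (h : ResDim R P M ≠ ⊤) :
    ∃ k : ℕ, ResDim R P M = k ∧ ResDimLE R P k M := by
  have hne : {n : ℕ∞ | ∃ k : ℕ, (k : ℕ∞) = n ∧ ResDimLE R P k M}.Nonempty := by
    by_contra hc
    rw [Set.not_nonempty_iff_eq_empty] at hc
    apply h
    unfold ResDim
    rw [hc, sInf_empty]
  obtain ⟨k, hk, hk'⟩ := csInf_mem hne
  exact ⟨k, hk.symm, hk'⟩

theorem main_alpha [IsNoetherianRing R] {M : Type u} [AddCommGroup M] [Module R M] [Module.Finite R M]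
    {rs : List R} (hr : Rg rs (.of R M)) {g : ℕ}
    (h : ResDimLE R (fun N => IsGorensteinProjective R N) g (.of R M)) :
    ResDimLE R (Bic (rF R)) (g + rs.length) (TT rs (.of R M)) := by
  have h1 : ResDimLE R (GPc R) g (.of R M) :=
    Paper.ResDimLE.mono_class (fun N hN => gpc_of_isGorensteinProjective (A := N) hN) h
  have h2 := res_gc gpc_resolving (fun L _ _ _ hL => gc_of_gpc hL) g M h1
  exact TT_res hr (Paper.ResDimLE.mono_class (fun N hN => gc_bicF hN) h2)

theorem main_beta [IsNoetherianRing R] [IsLocalRing R] {M : Type u} [AddCommGroup M] [Module R M]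
    [Module.Finite R M] [Nontrivial M] {rs : List R} (hrs : ∀ x ∈ rs, x ∈ maximalIdeal R)
    (hreg : RingTheory.Sequence.IsWeaklyRegular M rs) {e : ℕ}
    (h : ResDimLE R (GDc R) e (TT rs (.of R M))) :
    ∃ e', e = e' + rs.length ∧ ResDimLE R (fun N => IsGorensteinProjective R N) e' (.of R M) := by
  have h1 := (reg_kch rs (.of R M) hreg).2.res gdc_resolving h
  have h2 := res_gc gdc_resolving (fun L _ _ _ hL => gc_of_gdc hL) e
    (M ⧸ (Ideal.ofList rs • ⊤ : Submodule R M)) h1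
  obtain ⟨e', he, h3⟩ := res_regular_seq rs hrs M hreg
    (Paper.ResDimLE.mono_class (fun N hN => hN.2) h2)
  have h4 := res_gc gpc_resolving (fun L _ _ _ hL => gc_of_gpc hL) e' M h3
  exact ⟨e', he, Paper.ResDimLE.mono_class (fun N hN => gc_isGP hN) h4⟩
end Z1
end FileZ1

/-- **Theorem 4.2.** Let `M` be a non-zero finitely generated Cohen-Macaulay module of
dimension `n` over a Noetherian local ring `R`. Then `Gpd_R M` and `Gfd_R H^n_𝔪(M)` are
simultaneously finite, and when they are finite `Gfd_R H^n_𝔪(M) = Gpd_R M + n`. -/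
theorem GflatDim_localCohomology_eq_GprojDim_add
    (R : Type u) [CommRing R] [IsNoetherianRing R] [IsLocalRing R]
    (M : Type u) [AddCommGroup M] [Module R M] [Module.Finite R M]
    (hM : Nontrivial M) (n : ℕ) (hdim : moduleDim R M = (n : WithBot ℕ∞))
    (hCM : IsCohenMacaulayModule R M) :
    (GprojDim R M ≠ ⊤ ↔ GflatDim R (lcoh R (maximalIdeal R) n M) ≠ ⊤) ∧
    (GprojDim R M ≠ ⊤ →
      GflatDim R (lcoh R (maximalIdeal R) n M) = GprojDim R M + n) := by
  obtain ⟨rs, hl, hrs, hreg⟩ := exists_reg_seq M hM n hdim hCM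
  obtain ⟨hRg, hK⟩ := reg_kch rs (.of R M) hreg.toIsWeaklyRegular
  have ht := quot_torsion M n hdim rs hl hreg
  have ht2 := tors_pow (hK.torsion ht)
  obtain ⟨i⟩ := TT_lc (maximalIdeal R) hRg hrs ht2
  rw [hl] at i
  have e : lcoh R (maximalIdeal R) n M ≃ₗ[R] TT rs (.of R M) := i.toLinearEquiv
  have alpha : ∀ g : ℕ, ResDimLE R (fun N => IsGorensteinProjective R N) g (.of R M) →
      ResDimLE R (fun N => IsGorensteinFlat R N) (g + n)
        (.of R (lcoh R (maximalIdeal R) n M)) := by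
    intro g h
    have h1 := main_alpha hRg h
    rw [hl] at h1
    exact Paper.ResDimLE.mono_class (fun N hN => hN.isGorensteinFlat)
      (Paper.ResDimLE.iso (A := TT rs (.of R M)) bicF_iso e.symm h1)
  have beta : ∀ k : ℕ, ResDimLE R (fun N => IsGorensteinFlat R N) k
        (.of R (lcoh R (maximalIdeal R) n M)) →
      ∃ e', k = e' + n ∧ ResDimLE R (fun N => IsGorensteinProjective R N) e' (.of R M) := by
    intro k h
    have h1 : ResDimLE R (GDc R) k (.of R (lcoh R (maximalIdeal R) n M)) :=
      Paper.ResDimLE.mono_class (fun N hN => gdc_of_isGorensteinFlat (A := N) hN) h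
    have h2 := Paper.ResDimLE.iso (B := TT rs (.of R M)) gdc_resolving.iso e h1
    have h3 := main_beta hrs hreg.toIsWeaklyRegular h2
    rw [hl] at h3
    exact h3
  have fin1 : GprojDim R M ≠ ⊤ → GflatDim R (lcoh R (maximalIdeal R) n M) ≠ ⊤ := by
    intro h
    obtain ⟨g, -, hg⟩ := resDim_attained h
    exact ne_top_of_le_ne_top (ENat.natCast_ne_top _) (resDim_le (alpha g hg))
  refine ⟨⟨fin1, fun h => ?_⟩, fun h => ?_⟩
  · obtain ⟨k, -, hk⟩ := resDim_attained h
    obtain ⟨e', -, he'⟩ := beta k hk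
    exact ne_top_of_le_ne_top (ENat.natCast_ne_top _) (resDim_le he')
  · obtain ⟨g, hg, hg'⟩ := resDim_attained h
    obtain ⟨k, hk, hk'⟩ := resDim_attained (fin1 h)
    obtain ⟨e', he, he'⟩ := beta k hk'
    have h1 := resDim_le (alpha g hg')
    have h2 := resDim_le he'
    rw [hk] at h1
    rw [hg] at h2
    have h3 : GprojDim R M = g := hg
    have h4 : GflatDim R (lcoh R (maximalIdeal R) n M) = k := hk
    rw [h3, h4]
    have h5 : k ≤ g + n := by exact_mod_cast h1
    have h6 : g ≤ e' := by exact_mod_cast h2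
    have h7 : k = g + n := by omega
    rw [h7]; push_cast; rfl
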